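/- The infima I_1 and I_{−1} are achieved: for k = 1 and for k = −1 there exists φ ∈ X with d(φ) = k and ℰ(φ) = I_k (i.e., there exist minimizing Skyrmions of degree ±1). -/

import Mathlib

/- Common setting: Skyrme maps φ : ℝ³ → S³ ⊂ ℝ⁴ with weak partial derivatives. -/

open MeasureTheory Real Filter
open scoped Topology ENNReal BigOperators

noncomputable section

abbrev R3 : Type := Fin 3 → ℝ
abbrev R4 : Type := Fin 4 → ℝ

/-- Euclidean dot product on ℝ⁴. -/
def dot (u v : R4) : ℝ := ∑ a, u a * v a

/-- Squared Euclidean norm on ℝ⁴. -/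
def nsq (u : R4) : ℝ := dot u u

/-- |u∧v|² = |u|²|v|² − ⟨u,v⟩². -/
def wedgeSq (u v : R4) : ℝ := nsq u * nsq v - (dot u v) ^ 2

/-- Gram determinant of three vectors of ℝ⁴. -/
def gram (u v w : R4) : ℝ :=
  Matrix.det !![dot u u, dot u v, dot u w; dot v u, dot v v, dot v w; dot w u, dot w v, dot w w]

/-- Determinant of the 4×4 matrix with columns a, b, c, d. -/
def det4 (a b c d : R4) : ℝ := Matrix.det (Matrix.of fun i j => ![a, b, c, d] j i)

/-- Smooth compactly supported test functions on ℝ³. -/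
def IsTestFun {E : Type*} [NormedAddCommGroup E] [NormedSpace ℝ E] (ψ : R3 → E) : Prop :=
  ContDiff ℝ (⊤ : ℕ∞) ψ ∧ HasCompactSupport ψ

/-- A weakly differentiable map φ : ℝ³ → S³ ⊂ ℝ⁴ together with its weak
partial derivatives `pderiv i = ∂ᵢφ`. -/
structure SkyrmeMap where
  toFun : R3 → R4
  pderiv : Fin 3 → R3 → R4
  meas : Measurable toFun
  pderiv_locInt : ∀ i, LocallyIntegrable (pderiv i) volume
  sphere : ∀ᵐ x : R3, nsq (toFun x) = 1
  weak : ∀ (i : Fin 3) (a : Fin 4) (ψ : R3 → ℝ), IsTestFun ψ →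
    ∫ x : R3, fderiv ℝ ψ x (Pi.single i 1) * toFun x a
      = - ∫ x : R3, ψ x * pderiv i x a

/-- |∇φ|² = Σᵢ |∂ᵢφ|². -/
def gradSq (φ : SkyrmeMap) (x : R3) : ℝ := ∑ i, nsq (φ.pderiv i x)

/-- |A(φ)|² = Σᵢⱼ |∂ᵢφ∧∂ⱼφ|². -/
def ASq (φ : SkyrmeMap) (x : R3) : ℝ := ∑ i, ∑ j, wedgeSq (φ.pderiv i x) (φ.pderiv j x)

/-- The Skyrme energy density |∇φ|² + |A(φ)|². -/
def energyDensity (φ : SkyrmeMap) (x : R3) : ℝ := gradSq φ x + ASq φ x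

/-- φ ∈ X : finite Skyrme energy. -/
def memX (φ : SkyrmeMap) : Prop := Integrable (energyDensity φ) volume

/-- The Skyrme energy ℰ(φ). -/
def energy (φ : SkyrmeMap) : ℝ := ∫ x, energyDensity φ x

/-- det(φ, ∇φ)(x). -/
def detDen (φ : SkyrmeMap) (x : R3) : ℝ :=
  det4 (φ.toFun x) (φ.pderiv 0 x) (φ.pderiv 1 x) (φ.pderiv 2 x)

/-- The topological degree d(φ) = (1/(2π²)) ∫ det(φ,∇φ). -/
def degree (φ : SkyrmeMap) : ℝ := (1 / (2 * π ^ 2)) * ∫ x, detDen φ x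

/-- I_k = inf of the energy over maps of degree k. -/
def Skyrme.I (k : ℤ) : ℝ :=
  sInf {E : ℝ | ∃ φ : SkyrmeMap, memX φ ∧ degree φ = (k : ℝ) ∧ energy φ = E}

/-- The north pole P = (0,0,0,1) of S³. -/
def northPole : R4 := ![0, 0, 0, 1]

/-- The Euclidean ball B(y,r) in ℝ³. -/
def eball (y : R3) (r : ℝ) : Set R3 := {x | ∑ i, (x i - y i) ^ 2 < r ^ 2}

/-- standard basis vector -/
abbrev ee (i : Fin 3) : R3 := Pi.single i 1

def rhoBump : ContDiffBump (0 : R3) := ⟨1/2, 1, by norm_num, by norm_num⟩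

def rho : R3 → ℝ := rhoBump.normed volume

lemma rho_nonneg (w : R3) : 0 ≤ rho w := rhoBump.nonneg_normed w
lemma rho_contDiff : ContDiff ℝ (⊤ : ℕ∞) rho := rhoBump.contDiff_normed
lemma rho_continuous : Continuous rho := rhoBump.continuous_normed
lemma rho_hcs : HasCompactSupport rho := rhoBump.hasCompactSupport_normed
lemma rho_integral : ∫ w, rho w = 1 := rhoBump.integral_normed
lemma rho_integrable : Integrable rho volume := rhoBump.integrable_normed
lemma rho_neg (w : R3) : rho (-w) = rho w := rhoBump.normed_neg w
lemma rho_zero {w : R3} (h : 1 ≤ ‖w‖) : rho w = 0 := by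
  have : w ∉ Function.support rho := by
    rw [rho, rhoBump.support_normed_eq]
    simp [rhoBump]
    exact h
  simpa using this
lemma rho_test : IsTestFun rho := ⟨rho_contDiff, rho_hcs⟩
lemma rho_bdd : ∃ C, 0 < C ∧ ∀ w, rho w ≤ C := by
  obtain ⟨C, hC⟩ := rho_continuous.bounded_above_of_compact_support rho_hcs
  refine ⟨|C| + 1, by positivity, fun w => ?_⟩
  have := hC w
  rw [Real.norm_eq_abs] at this
  have h2 := le_abs_self (rho w)
  have h3 := le_abs_self C
  linarith

/-- the probability measure rho dx -/
def mrho : Measure R3 := volume.withDensity (fun w => ENNReal.ofReal (rho w))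

lemma rho_meas : Measurable rho := rho_continuous.measurable

instance : IsProbabilityMeasure mrho := by
  constructor
  rw [mrho, withDensity_apply _ MeasurableSet.univ, Measure.restrict_univ,
    ← ofReal_integral_eq_lintegral_ofReal rho_integrable (Eventually.of_forall rho_nonneg),
    rho_integral, ENNReal.ofReal_one]

lemma mrho_integral (f : R3 → ℝ) : ∫ w, f w ∂mrho = ∫ w, rho w * f w := by
  rw [mrho, integral_withDensity_eq_integral_toReal_smul (by have := rho_meas; fun_prop) (by simp)]
  · simp only [ENNReal.toReal_ofReal (rho_nonneg _), smul_eq_mul]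

lemma mrho_ae_ball : ∀ᵐ w ∂mrho, ‖w‖ < 1 := by
  rw [mrho, ae_withDensity_iff (by have := rho_meas; fun_prop)]
  refine Eventually.of_forall fun w hw => ?_
  by_contra h
  push Not at h
  exact hw (by simp [rho_zero h])

lemma mrho_ac : mrho ≪ volume := withDensity_absolutelyContinuous _ _

/-- mollification at scale s -/
def mol (s : ℝ) (f : R3 → ℝ) (x : R3) : ℝ := ∫ w, f (x - s • w) ∂mrho

def kr (s : ℝ) (z : R3) : ℝ := s⁻¹ ^ 3 * rho (s⁻¹ • z)

lemma kr_contDiff (s : ℝ) : ContDiff ℝ (⊤ : ℕ∞) (kr s) := by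
  unfold kr
  exact contDiff_const.mul (rho_contDiff.comp (contDiff_const_smul _))

lemma kr_hcs {s : ℝ} (hs : 0 < s) : HasCompactSupport (kr s) := by
  unfold kr
  apply HasCompactSupport.mul_left
  exact rho_hcs.comp_smul (inv_ne_zero hs.ne')

lemma kr_nonneg {s : ℝ} (hs : 0 < s) (z : R3) : 0 ≤ kr s z := by
  unfold kr; have := rho_nonneg (s⁻¹ • z); positivity

lemma kr_zero {s : ℝ} (hs : 0 < s) {z : R3} (h : s ≤ ‖z‖) : kr s z = 0 := by
  unfold kr
  rw [rho_zero, mul_zero]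
  rw [norm_smul, norm_inv, Real.norm_eq_abs, abs_of_pos hs, ← div_eq_inv_mul, le_div_iff₀ hs]
  linarith

lemma mol_eq_kr {s : ℝ} (hs : 0 < s) (f : R3 → ℝ) (x : R3) :
    mol s f x = ∫ y, kr s (x - y) * f y := by
  rw [mol, mrho_integral]
  have h1 : ∫ y, kr s (x - y) * f y = ∫ z, kr s z * f (x - z) := by
    rw [← integral_sub_left_eq_self (fun z => kr s z * f (x - z)) volume x]
    simp
  rw [h1]
  have h2 := Measure.integral_comp_smul (volume : Measure R3)
    (fun z => kr s z * f (x - z)) s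
  have h3 : Module.finrank ℝ R3 = 3 := by simp
  rw [h3, abs_of_pos (by positivity), smul_eq_mul] at h2
  have h4 : ∀ w, kr s (s • w) * f (x - s • w) = s⁻¹ ^ 3 * (rho w * f (x - s • w)) := by
    intro w
    unfold kr
    rw [smul_smul, inv_mul_cancel₀ hs.ne', one_smul]; ring
  simp_rw [h4] at h2
  rw [integral_const_mul] at h2
  have h5 : s⁻¹ ^ 3 = (s ^ 3)⁻¹ := by rw [inv_pow]
  rw [h5] at h2
  exact mul_left_cancel₀ (by positivity) h2

lemma mol_eq_conv {s : ℝ} (hs : 0 < s) (f : R3 → ℝ) :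
    mol s f = convolution (kr s) f (ContinuousLinearMap.lsmul ℝ ℝ) volume := by
  ext x
  rw [mol_eq_kr hs, convolution_lsmul_swap]
  rfl

lemma mol_contDiff {s : ℝ} (hs : 0 < s) {f : R3 → ℝ} (hf : LocallyIntegrable f volume) :
    ContDiff ℝ (⊤ : ℕ∞) (mol s f) := by
  rw [mol_eq_conv hs]
  exact (kr_hcs hs).contDiff_convolution_left _ (kr_contDiff s) hf

lemma kr_test (s : ℝ) (hs : 0 < s) (x : R3) : IsTestFun (fun y => kr s (x - y)) := by
  refine ⟨(kr_contDiff s).comp (contDiff_const.sub contDiff_id), ?_⟩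
  exact (kr_hcs hs).comp_homeomorph (Homeomorph.subLeft x)

lemma mol_fderiv {s : ℝ} (hs : 0 < s) {f : R3 → ℝ} (hf : LocallyIntegrable f volume) (x : R3)
    (v : R3) : fderiv ℝ (mol s f) x v = ∫ y, fderiv ℝ (kr s) (x - y) v * f y := by
  have h := (kr_hcs hs).hasFDerivAt_convolution_left (ContinuousLinearMap.lsmul ℝ ℝ)
    ((kr_contDiff s).of_le (by exact_mod_cast le_top)) hf x
  rw [mol_eq_conv hs, h.fderiv, convolution_eq_swap]
  have hintg : Integrable (fun y => ((ContinuousLinearMap.lsmul ℝ ℝ).precompL R3)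
      (fderiv ℝ (kr s) (x - y)) (f y)) volume := by
    have hc : HasCompactSupport (fderiv ℝ (kr s)) := (kr_hcs hs).fderiv ℝ
    have := hc.convolutionExists_left ((ContinuousLinearMap.lsmul ℝ ℝ).precompL R3)
      ((kr_contDiff s).continuous_fderiv (by simp)) hf x
    exact this.integrable_swap
  rw [ContinuousLinearMap.integral_apply hintg]
  congr 1

lemma fderiv_kr_sub (s : ℝ) (x y v : R3) :
    fderiv ℝ (fun y => kr s (x - y)) y v = - fderiv ℝ (kr s) (x - y) v := by
  have h1 : HasFDerivAt (fun y : R3 => x - y) (-(ContinuousLinearMap.id ℝ R3)) y := by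
    simpa using (hasFDerivAt_id (𝕜 := ℝ) y).const_sub x
  have h2 : HasFDerivAt (kr s) (fderiv ℝ (kr s) (x - y)) (x - y) :=
    ((kr_contDiff s).differentiable (by simp) _).hasFDerivAt
  have h3 := h2.comp y h1
  have h4 := h3.fderiv
  have h5 : (kr s ∘ fun y => x - y) = fun y => kr s (x - y) := rfl
  rw [h5] at h4
  rw [h4]; simp

/-- scalar weakly differentiable bounded functions with L^2 gradient -/
structure W (u : R3 → ℝ) (g : Fin 3 → R3 → ℝ) : Prop where
  meas : Measurable u
  bdd : ∃ C, ∀ x, |u x| ≤ C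
  gmeas : ∀ i, Measurable (g i)
  gL2 : ∀ i, MemLp (g i) 2 volume
  weak : ∀ (i : Fin 3) (ψ : R3 → ℝ), IsTestFun ψ →
    ∫ x : R3, fderiv ℝ ψ x (ee i) * u x = - ∫ x : R3, ψ x * g i x

lemma locInt_of_bdd {u : R3 → ℝ} (hu : Measurable u) (hb : ∃ C, ∀ x, |u x| ≤ C) :
    LocallyIntegrable u volume := by
  obtain ⟨C, hC⟩ := hb
  have h : LocallyIntegrable (fun _ : R3 => C) volume := locallyIntegrable_const C
  exact h.mono hu.aestronglyMeasurable (Eventually.of_forall fun x => by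
    rw [Real.norm_eq_abs, Real.norm_eq_abs]; exact (hC x).trans (le_abs_self C))

lemma locInt_of_L2 {f : R3 → ℝ} (hf : MemLp f 2 volume) : LocallyIntegrable f volume :=
  hf.locallyIntegrable (by norm_num)

lemma W.locInt {u g} (h : W u g) : LocallyIntegrable u volume := locInt_of_bdd h.meas h.bdd

lemma W.mol_deriv {u g} (h : W u g) {s : ℝ} (hs : 0 < s) (i : Fin 3) (x : R3) :
    fderiv ℝ (mol s u) x (ee i) = mol s (g i) x := by
  rw [mol_fderiv hs h.locInt, mol_eq_kr hs]
  have := h.weak i _ (kr_test s hs x)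
  simp_rw [fderiv_kr_sub, neg_mul] at this
  rw [integral_neg, neg_inj] at this
  exact this

lemma mol_bdd {u : R3 → ℝ} {C : ℝ} (hC : ∀ x, |u x| ≤ C) (s : ℝ) (x : R3) : |mol s u x| ≤ C := by
  have := norm_integral_le_of_norm_le_const (μ := mrho) (f := fun w => u (x - s • w)) (C := C)
    (Eventually.of_forall fun w => hC _)
  simpa [mol] using this

lemma int_affine {s : ℝ} (hs : 0 < s) (F : R3 → ℝ) (x : R3) :
    ∫ w, F (x - s • w) = s⁻¹ ^ 3 * ∫ y, F y := by
  have h2 := Measure.integral_comp_smul (volume : Measure R3) (fun z => F (x - z)) s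
  have h3 : Module.finrank ℝ R3 = 3 := by simp
  rw [h3, abs_of_pos (by positivity), smul_eq_mul, integral_sub_left_eq_self F volume x] at h2
  rw [h2, inv_pow]

lemma int_affine_ball {s : ℝ} (hs : 0 < s) (F : R3 → ℝ) (x : R3) (r : ℝ) :
    ∫ w in Metric.closedBall (0 : R3) r, F (x - s • w) =
      s⁻¹ ^ 3 * ∫ y in Metric.closedBall x (s * r), F y := by
  rw [← integral_indicator Metric.isClosed_closedBall.measurableSet,
    ← integral_indicator Metric.isClosed_closedBall.measurableSet, ← int_affine hs _ x]
  congr 1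
  ext w
  by_cases h : w ∈ Metric.closedBall (0 : R3) r
  · have h' : x - s • w ∈ Metric.closedBall x (s * r) := by
      simp only [Metric.mem_closedBall, dist_zero_right, dist_self_sub_left, norm_smul,
        Real.norm_eq_abs, abs_of_pos hs] at h ⊢
      gcongr
    rw [Set.indicator_of_mem h, Set.indicator_of_mem h']
  · have h' : x - s • w ∉ Metric.closedBall x (s * r) := by
      simp only [Metric.mem_closedBall, dist_zero_right, dist_self_sub_left, norm_smul,
        Real.norm_eq_abs, abs_of_pos hs, not_le] at h ⊢
      gcongr
    rw [Set.indicator_of_notMem h, Set.indicator_of_notMem h']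

lemma integrable_affine {s : ℝ} (hs : 0 < s) {F : R3 → ℝ} (hF : Integrable F volume) (x : R3) :
    Integrable (fun w => F (x - s • w)) volume := by
  have h1 : Integrable (fun z => F (x - z)) volume := hF.comp_sub_left x
  exact h1.comp_smul hs.ne'

lemma integrableOn_affine {s : ℝ} (hs : 0 < s) {F : R3 → ℝ} (hF : LocallyIntegrable F volume)
    (x : R3) (r : ℝ) :
    IntegrableOn (fun w => F (x - s • w)) (Metric.closedBall (0 : R3) r) volume := by
  have h1 : IntegrableOn F (Metric.closedBall x (s * r)) volume :=
    hF.integrableOn_isCompact (isCompact_closedBall _ _)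
  rw [← integrable_indicator_iff Metric.isClosed_closedBall.measurableSet] at h1 ⊢
  refine (integrable_affine hs h1 x).congr (Eventually.of_forall fun w => ?_)
  by_cases h : w ∈ Metric.closedBall (0 : R3) r
  · have h' : x - s • w ∈ Metric.closedBall x (s * r) := by
      simp only [Metric.mem_closedBall, dist_zero_right, dist_self_sub_left, norm_smul,
        Real.norm_eq_abs, abs_of_pos hs] at h ⊢
      gcongr
    simp only [Set.indicator_of_mem h, Set.indicator_of_mem h']
  · have h' : x - s • w ∉ Metric.closedBall x (s * r) := by
      simp only [Metric.mem_closedBall, dist_zero_right, dist_self_sub_left, norm_smul,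
        Real.norm_eq_abs, abs_of_pos hs, not_le] at h ⊢
      gcongr
    simp only [Set.indicator_of_notMem h, Set.indicator_of_notMem h']

/-- local oscillation -/
def osc (f : R3 → ℝ) (x : R3) (s : ℝ) : ℝ :=
  ∫ w in Metric.closedBall (0 : R3) 1, |f (x - s • w) - f x|

lemma leb_osc {f : R3 → ℝ} (hf : LocallyIntegrable f volume) :
    ∀ᵐ x, Tendsto (osc f x) (𝓝[>] 0) (𝓝 0) := by
  filter_upwards [IsUnifLocDoublingMeasure.ae_tendsto_average_norm_sub (μ := volume) hf 1] with x hx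
  have h := hx (l := 𝓝[>] (0:ℝ)) (fun _ => x) (fun s => s) tendsto_id (by
    filter_upwards [self_mem_nhdsWithin] with s hs
    have : (0:ℝ) < s := hs
    simp [this.le])
  have h2 := h.const_mul 8
  rw [mul_zero] at h2
  refine h2.congr' ?_
  filter_upwards [self_mem_nhdsWithin] with s hs
  have hs : (0:ℝ) < s := hs
  rw [osc, int_affine_ball hs (fun y => |f y - f x|) x, mul_one, setAverage_eq]
  have hv : volume.real (Metric.closedBall x s) = (2 * s) ^ 3 := by
    rw [Measure.real, Real.volume_pi_closedBall _ hs.le]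
    simp [ENNReal.toReal_ofReal, hs.le]
  rw [hv, smul_eq_mul]
  simp only [Real.norm_eq_abs]
  field_simp
  norm_num

lemma mol_sub_integral {f : R3 → ℝ} (hf : LocallyIntegrable f volume) {s : ℝ} (hs : 0 < s)
    (x : R3) (c : ℝ) : Integrable (fun w => f (x - s • w)) mrho ∧
      mol s f x - c = ∫ w, (f (x - s • w) - c) ∂mrho := by
  have h1 : Integrable (fun w => f (x - s • w)) mrho := by
    have hi := integrableOn_affine hs hf x 1
    rw [mrho, integrable_withDensity_iff_integrable_smul' (by have := rho_meas; fun_prop) (by simp)]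
    obtain ⟨C, hC0, hC⟩ := rho_bdd
    have h2 : Integrable ((Metric.closedBall (0 : R3) 1).indicator
        (fun w => C * |f (x - s • w)|)) volume := by
      rw [integrable_indicator_iff Metric.isClosed_closedBall.measurableSet]
      exact hi.norm.const_mul C
    have hm : AEStronglyMeasurable (fun w => f (x - s • w)) volume := by
      have hq : Measure.QuasiMeasurePreserving (fun w : R3 => x - s • w) volume volume := by
        have ha := (Measure.measurePreserving_sub_left (volume : Measure R3) x).quasiMeasurePreserving
        have hb : Measure.QuasiMeasurePreserving (fun w : R3 => s • w) volume volume := by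
          refine ⟨by fun_prop, ?_⟩
          have := Measure.map_addHaar_smul (volume : Measure R3) hs.ne'
          change Measure.map (fun w : R3 => s • w) volume = _ at this
          rw [this]
          exact Measure.smul_absolutelyContinuous
        exact ha.comp hb
      exact hf.aestronglyMeasurable.comp_quasiMeasurePreserving hq
    refine h2.mono' ?_ (Eventually.of_forall fun w => ?_)
    · have hr : Measurable (fun w => (ENNReal.ofReal (rho w)).toReal) :=
        rho_meas.ennreal_ofReal.ennreal_toReal
      exact hr.aestronglyMeasurable.smul hm
    · rw [ENNReal.toReal_ofReal (rho_nonneg w), norm_smul, Real.norm_eq_abs, Real.norm_eq_abs,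
        abs_of_nonneg (rho_nonneg w)]
      by_cases h : w ∈ Metric.closedBall (0 : R3) 1
      · rw [Set.indicator_of_mem h]
        exact mul_le_mul_of_nonneg_right (hC w) (abs_nonneg _)
      · rw [Set.indicator_of_notMem h, rho_zero, zero_mul]
        simp at h; exact h.le
  refine ⟨h1, ?_⟩
  rw [integral_sub h1 (integrable_const _), integral_const]
  simp [mol]

lemma mol_sub_le {f : R3 → ℝ} (hf : LocallyIntegrable f volume) {C : ℝ} (hC : ∀ w, rho w ≤ C)
    {s : ℝ} (hs : 0 < s) (x : R3) (c : ℝ) :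
    |mol s f x - c| ≤ C * ∫ w in Metric.closedBall (0 : R3) 1, |f (x - s • w) - c| := by
  rw [(mol_sub_integral hf hs x c).2, mrho_integral]
  have hi : IntegrableOn (fun w => |f (x - s • w) - c|) (Metric.closedBall (0 : R3) 1) volume := by
    have h1 := integrableOn_affine hs hf x 1
    have h2 : IntegrableOn (fun _ : R3 => c) (Metric.closedBall (0 : R3) 1) volume :=
      continuousOn_const.integrableOn_compact (isCompact_closedBall _ _)
    exact (h1.sub h2).norm
  rw [← integral_const_mul,
    ← integral_indicator (Metric.isClosed_closedBall (x := (0:R3)) (ε := 1)).measurableSet]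
  rw [← Real.norm_eq_abs]
  refine norm_integral_le_of_norm_le ((integrable_indicator_iff
    (Metric.isClosed_closedBall (x := (0:R3)) (ε := 1)).measurableSet).2
      (hi.const_mul C)) (Eventually.of_forall fun w => ?_)
  rw [norm_mul, Real.norm_eq_abs, Real.norm_eq_abs, abs_of_nonneg (rho_nonneg w)]
  by_cases h : w ∈ Metric.closedBall (0 : R3) 1
  · rw [Set.indicator_of_mem h]
    exact mul_le_mul_of_nonneg_right (hC w) (abs_nonneg _)
  · rw [Set.indicator_of_notMem h, rho_zero, zero_mul]
    simp at h; exact h.le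

lemma mol_tendsto_ae {f : R3 → ℝ} (hf : LocallyIntegrable f volume) :
    ∀ᵐ x, Tendsto (fun s => mol s f x) (𝓝[>] 0) (𝓝 (f x)) := by
  obtain ⟨C, hC0, hC⟩ := rho_bdd
  filter_upwards [leb_osc hf] with x hx
  rw [tendsto_iff_norm_sub_tendsto_zero]
  have h2 := hx.const_mul C
  rw [mul_zero] at h2
  refine squeeze_zero' (Eventually.of_forall fun _ => norm_nonneg _) ?_ h2
  filter_upwards [self_mem_nhdsWithin] with s hs
  exact mol_sub_le hf hC hs x (f x)

lemma sq_lintegral_le (μ : Measure R3) [IsProbabilityMeasure μ] {F : R3 → ℝ≥0∞}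
    (hF : AEMeasurable F μ) : (∫⁻ w, F w ∂μ) ^ 2 ≤ ∫⁻ w, F w ^ 2 ∂μ := by
  have h := ENNReal.lintegral_mul_le_Lp_mul_Lq μ Real.HolderConjugate.two_two hF
    (aemeasurable_const (b := (1:ℝ≥0∞)))
  simp only [Pi.mul_apply, mul_one, ENNReal.one_rpow, lintegral_const, measure_univ, one_mul] at h
  calc (∫⁻ w, F w ∂μ) ^ 2 ≤ ((∫⁻ w, F w ^ (2:ℝ) ∂μ) ^ (1 / (2:ℝ))) ^ 2 := by gcongr
    _ = ∫⁻ w, F w ^ 2 ∂μ := by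
      rw [← ENNReal.rpow_natCast, ← ENNReal.rpow_mul]
      norm_num

lemma jensen_mol {f : R3 → ℝ} (hm : Measurable f) (hf : LocallyIntegrable f volume) {s : ℝ}
    (hs : 0 < s) (S : Set R3) :
    ∫⁻ x in S, ‖mol s f x - f x‖ₑ ^ 2 ≤
      ∫⁻ w, (∫⁻ x in S, ‖f (x - s • w) - f x‖ₑ ^ 2) ∂mrho := by
  have hmm : Measurable (fun p : R3 × R3 => ‖f (p.1 - s • p.2) - f p.1‖ₑ ^ 2) := by fun_prop
  calc ∫⁻ x in S, ‖mol s f x - f x‖ₑ ^ 2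
      ≤ ∫⁻ x in S, (∫⁻ w, ‖f (x - s • w) - f x‖ₑ ^ 2 ∂mrho) := by
        refine lintegral_mono fun x => ?_
        rw [(mol_sub_integral hf hs x (f x)).2]
        refine le_trans ?_ (sq_lintegral_le mrho (by fun_prop))
        gcongr
        exact enorm_integral_le_lintegral_enorm _
    _ = _ := lintegral_lintegral_swap hmm.aemeasurable

lemma jensen_bound {f : R3 → ℝ} (hm : Measurable f) (hf : LocallyIntegrable f volume) {s : ℝ}
    (hs : 0 < s) (S : Set R3) (B : ℝ≥0∞)
    (hB : ∀ w : R3, ‖w‖ < 1 → ∫⁻ x in S, ‖f (x - s • w) - f x‖ₑ ^ 2 ≤ B) :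
    ∫⁻ x in S, ‖mol s f x - f x‖ₑ ^ 2 ≤ B := by
  refine (jensen_mol hm hf hs S).trans ?_
  calc _ ≤ ∫⁻ w, B ∂mrho := by
        refine lintegral_mono_ae ?_
        filter_upwards [mrho_ae_ball] with w hw using hB w hw
    _ = B := by simp

lemma lint_sq_eq {f : R3 → ℝ} {μ : Measure R3} : ∫⁻ x, ‖f x‖ₑ ^ 2 ∂μ = (eLpNorm f 2 μ) ^ 2 := by
  rw [eLpNorm_eq_lintegral_rpow_enorm_toReal (by norm_num) (by norm_num)]
  rw [← ENNReal.rpow_natCast, ← ENNReal.rpow_mul]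
  norm_num

lemma memLp_of_lint {f : R3 → ℝ} {μ : Measure R3} (hm : AEStronglyMeasurable f μ)
    (h : ∫⁻ x, ‖f x‖ₑ ^ 2 ∂μ < ⊤) : MemLp f 2 μ := by
  refine ⟨hm, ?_⟩
  rw [lint_sq_eq] at h
  by_contra h2
  rw [not_lt, top_le_iff] at h2
  simp [h2] at h

lemma lint_sq_real {f : R3 → ℝ} {μ : Measure R3} (hf : MemLp f 2 μ) :
    ∫⁻ x, ‖f x‖ₑ ^ 2 ∂μ = ENNReal.ofReal (∫ x, f x ^ 2 ∂μ) := by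
  rw [ofReal_integral_eq_lintegral_ofReal hf.integrable_sq (Eventually.of_forall fun x => sq_nonneg _)]
  congr 1
  ext x
  rw [Real.enorm_eq_ofReal_abs, ← ENNReal.ofReal_pow (abs_nonneg _), sq_abs]

lemma mulL2 {f g : R3 → ℝ} {μ : Measure R3} (hf : MemLp f 2 μ) (hg : MemLp g 2 μ) :
    Integrable (fun x => f x * g x) μ := hf.integrable_mul hg

lemma subL2 {f g : R3 → ℝ} {μ : Measure R3} (hf : MemLp f 2 μ) (hg : MemLp g 2 μ) :
    MemLp (fun x => f x - g x) 2 μ := hf.sub hg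

lemma addL2 {f g : R3 → ℝ} {μ : Measure R3} (hf : MemLp f 2 μ) (hg : MemLp g 2 μ) :
    MemLp (fun x => f x + g x) 2 μ := hf.add hg

lemma cs {f g : R3 → ℝ} {μ : Measure R3} (hf : MemLp f 2 μ) (hg : MemLp g 2 μ) :
    |∫ x, f x * g x ∂μ| ≤ √(∫ x, f x ^ 2 ∂μ) * √(∫ x, g x ^ 2 ∂μ) := by
  have hi : Integrable (fun x => f x * g x) μ := hf.integrable_mul hg
  have h0 := hf.integrable_sq
  have h1 := hg.integrable_sq
  set A := ∫ x, f x ^ 2 ∂μ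
  set B := ∫ x, g x ^ 2 ∂μ
  set C := ∫ x, f x * g x ∂μ
  have key : ∀ t : ℝ, 0 ≤ A * (t * t) + (2 * C) * t + B := by
    intro t
    have : A * (t * t) + (2 * C) * t + B = ∫ x, (t * f x + g x) ^ 2 ∂μ := by
      have : ∀ x, (t * f x + g x) ^ 2 = (t * t) * f x ^ 2 + (2 * t) * (f x * g x) + g x ^ 2 := by
        intro x; ring
      simp_rw [this]
      rw [integral_add ((h0.const_mul _).fun_add (hi.const_mul _)) h1,
        integral_add (h0.const_mul _) (hi.const_mul _), integral_const_mul, integral_const_mul]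
      ring
    rw [this]
    exact integral_nonneg fun x => sq_nonneg _
  have hd := discrim_le_zero key
  rw [discrim] at hd
  have hA : 0 ≤ A := integral_nonneg fun x => sq_nonneg _
  rw [← Real.sqrt_mul hA]
  apply Real.abs_le_sqrt
  nlinarith

lemma transl_cont {f : R3 → ℝ} (hf : MemLp f 2 volume) {ε : ℝ≥0∞} (hε : 0 < ε) :
    ∃ δ > 0, ∀ z : R3, ‖z‖ < δ → ∫⁻ x, ‖f (x - z) - f x‖ₑ ^ 2 ≤ ε := by
  have : Fact ((2 : ℝ≥0∞) ≠ ⊤) := ⟨by norm_num⟩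
  have hc : Continuous (fun z : R3 => DomAddAct.mk (-z) +ᵥ hf.toLp f) := by
    have h1 : Continuous (fun z : R3 => DomAddAct.mk (-z)) :=
      DomAddAct.continuous_mk.comp continuous_neg
    exact h1.vadd continuous_const
  have h0 : Tendsto (fun z : R3 => edist (DomAddAct.mk (-z) +ᵥ hf.toLp f) (hf.toLp f) ^ 2) (𝓝 0) (𝓝 0) := by
    have : Continuous (fun z : R3 => edist (DomAddAct.mk (-z) +ᵥ hf.toLp f) (hf.toLp f) ^ 2) :=
      (ENNReal.continuous_pow 2).comp (hc.edist continuous_const)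
    have h2 := this.tendsto 0
    simpa using h2
  have h3 := h0.eventually_le_const hε
  obtain ⟨δ, hδ, h⟩ := Metric.eventually_nhds_iff.1 h3
  refine ⟨δ, hδ, fun z hz => ?_⟩
  have h4 := h (y := z) (by simpa using hz)
  rw [DomAddAct.mk_vadd_toLp, Lp.edist_toLp_toLp, ← lint_sq_eq] at h4
  simpa [sub_eq_neg_add] using h4

lemma mol_L2 {f : R3 → ℝ} (hm : Measurable f) (hf : MemLp f 2 volume) :
    (∀ s > 0, MemLp (mol s f) 2 volume) ∧
    Tendsto (fun s => ∫ x, (mol s f x - f x) ^ 2) (𝓝[>] 0) (𝓝 0) := by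
  have hl := locInt_of_L2 hf
  have hme : ∀ s > 0, Measurable (mol s f) := fun s hs => (mol_contDiff hs hl).continuous.measurable
  have hd : ∀ s > 0, MemLp (fun x => mol s f x - f x) 2 volume := by
    intro s hs
    refine memLp_of_lint ((hme s hs).sub hm).aestronglyMeasurable ?_
    have hB : ∀ w : R3, ‖w‖ < 1 → ∫⁻ x in Set.univ, ‖f (x - s • w) - f x‖ₑ ^ 2 ≤
        (2 * eLpNorm f 2 volume) ^ 2 := by
      intro w _
      rw [setLIntegral_univ]
      rw [show (fun x => ‖f (x - s • w) - f x‖ₑ ^ 2) =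
        fun x => ‖((fun y => f (y - s • w)) - f) x‖ₑ ^ 2 from rfl, lint_sq_eq]
      gcongr
      have hp := measurePreserving_sub_right (volume : Measure R3) (s • w)
      have h1 := eLpNorm_comp_measurePreserving (p := 2) hf.1 hp
      refine (eLpNorm_sub_le (hf.1.comp_measurePreserving hp) hf.1 (by norm_num)).trans ?_
      rw [h1, two_mul]
    have := jensen_bound hm hl hs Set.univ _ hB
    rw [setLIntegral_univ] at this
    exact this.trans_lt (ENNReal.pow_lt_top (ENNReal.mul_lt_top (by simp) hf.2))
  refine ⟨fun s hs => ?_, ?_⟩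
  · have := (hd s hs).add hf
    refine this.ae_eq (Eventually.of_forall fun x => ?_)
    simp
  · rw [Metric.tendsto_nhds]
    intro ε hε
    obtain ⟨δ, hδ, h⟩ := transl_cont hf (ε := ENNReal.ofReal (ε/2)) (by simpa using hε)
    filter_upwards [Ioo_mem_nhdsGT hδ] with s hs
    have hs0 : 0 < s := hs.1
    have hB := jensen_bound hm hl hs0 Set.univ (ENNReal.ofReal (ε/2)) (fun w hw => by
      rw [setLIntegral_univ]
      refine h _ ?_
      rw [norm_smul, Real.norm_eq_abs, abs_of_pos hs0]
      have := hs.2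
      nlinarith [norm_nonneg w])
    rw [setLIntegral_univ, lint_sq_real (hd s hs0), ENNReal.ofReal_le_ofReal_iff (by positivity)] at hB
    rw [dist_zero_right, Real.norm_eq_abs, abs_of_nonneg (integral_nonneg fun x => sq_nonneg _)]
    linarith

lemma lim_cf {ι : Type*} {l : Filter ι} [l.IsCountablyGenerated] {c : ι → R3 → ℝ} {c0 : R3 → ℝ}
    {f : ι → R3 → ℝ} {f0 Ψ : R3 → ℝ} (hΨ : MemLp Ψ 2 volume)
    (hcm : ∀ᶠ s in l, AEStronglyMeasurable (c s) volume)
    (hcb : ∀ᶠ s in l, ∀ᵐ x, |c s x| ≤ Ψ x)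
    (hc : ∀ᵐ x, Tendsto (fun s => c s x) l (𝓝 (c0 x)))
    (hf0 : MemLp f0 2 volume) (hf : ∀ᶠ s in l, MemLp (f s) 2 volume)
    (hlim : Tendsto (fun s => ∫ x, (f s x - f0 x) ^ 2) l (𝓝 0)) :
    Tendsto (fun s => ∫ x, c s x * f s x) l (𝓝 (∫ x, c0 x * f0 x)) := by
  have h1 : Tendsto (fun s => ∫ x, c s x * f0 x) l (𝓝 (∫ x, c0 x * f0 x)) := by
    refine tendsto_integral_filter_of_dominated_convergence (fun x => Ψ x * |f0 x|) ?_ ?_ ?_ ?_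
    · filter_upwards [hcm] with s hs using hs.mul hf0.1
    · filter_upwards [hcb] with s hs
      filter_upwards [hs] with x hx
      rw [norm_mul, Real.norm_eq_abs, Real.norm_eq_abs]
      gcongr
    · exact hΨ.integrable_mul hf0.norm
    · filter_upwards [hc] with x hx using hx.mul_const _
  have h2 : Tendsto (fun s => ∫ x, c s x * (f s x - f0 x)) l (𝓝 0) := by
    have h3 : Tendsto (fun s => √(∫ x, Ψ x ^ 2) * √(∫ x, (f s x - f0 x) ^ 2)) l (𝓝 0) := by
      have := (hlim.sqrt).const_mul (√(∫ x, Ψ x ^ 2))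
      simpa using this
    refine squeeze_zero_norm' ?_ h3
    filter_upwards [hcm, hcb, hf] with s hs1 hs2 hs3
    have hcL : MemLp (c s) 2 volume := hΨ.mono' hs1 (by
      filter_upwards [hs2] with x hx using hx)
    refine (cs hcL (hs3.sub hf0)).trans ?_
    refine mul_le_mul_of_nonneg_right (Real.sqrt_le_sqrt ?_) (Real.sqrt_nonneg _)
    refine integral_mono_ae hcL.integrable_sq hΨ.integrable_sq ?_
    filter_upwards [hs2] with x hx
    exact sq_le_sq' (by linarith [neg_abs_le (c s x)]) (by linarith [le_abs_self (c s x)])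
  have h4 := h1.add h2
  rw [add_zero] at h4
  refine h4.congr' ?_
  filter_upwards [hcm, hcb, hf] with s hs1 hs2 hs3
  have hcL : MemLp (c s) 2 volume := hΨ.mono' hs1 (by
      filter_upwards [hs2] with x hx using hx)
  rw [← integral_add (mulL2 hcL hf0) (mulL2 hcL (subL2 hs3 hf0))]
  congr 1
  ext x
  ring

lemma IsTestFun.cont {ψ : R3 → ℝ} (h : IsTestFun ψ) : Continuous ψ := h.1.continuous
lemma IsTestFun.diff {ψ : R3 → ℝ} (h : IsTestFun ψ) : Differentiable ℝ ψ :=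
  h.1.differentiable (by simp)
lemma IsTestFun.integrable {ψ : R3 → ℝ} (h : IsTestFun ψ) : Integrable ψ volume :=
  h.cont.integrable_of_hasCompactSupport h.2
lemma IsTestFun.memLp {ψ : R3 → ℝ} (h : IsTestFun ψ) (p : ℝ≥0∞) : MemLp ψ p volume :=
  h.cont.memLp_of_hasCompactSupport h.2
lemma IsTestFun.bdd {ψ : R3 → ℝ} (h : IsTestFun ψ) : ∃ C, ∀ x, |ψ x| ≤ C :=
  h.cont.bounded_above_of_compact_support h.2

lemma IsTestFun.d {ψ : R3 → ℝ} (h : IsTestFun ψ) (v : R3) :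
    IsTestFun (fun x => fderiv ℝ ψ x v) := by
  refine ⟨(h.1.fderiv_right (m := (⊤ : ℕ∞)) (by simp)).clm_apply contDiff_const, ?_⟩
  exact h.2.fderiv_apply ℝ v

lemma IsTestFun.mul {ψ v : R3 → ℝ} (h : IsTestFun ψ) (hv : ContDiff ℝ (⊤ : ℕ∞) v) :
    IsTestFun (fun x => ψ x * v x) := ⟨h.1.mul hv, h.2.mul_right⟩

lemma ibp {ψ v : R3 → ℝ} (h : IsTestFun ψ) (hv : ContDiff ℝ (⊤ : ℕ∞) v) (e : R3) :
    ∫ x, fderiv ℝ ψ x e * v x = - ∫ x, ψ x * fderiv ℝ v x e := by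
  have hvd : Differentiable ℝ v := hv.differentiable (by simp)
  have h1 := ((h.d e).mul hv).integrable
  have h2 : ContDiff ℝ (⊤ : ℕ∞) (fun x => fderiv ℝ v x e) :=
    (hv.fderiv_right (m := (⊤ : ℕ∞)) (by simp)).clm_apply contDiff_const
  have h3 := (h.mul h2).integrable
  have := integral_mul_fderiv_eq_neg_fderiv_mul_of_integrable (μ := (volume : Measure R3)) (v := e)
    (f := ψ) (g := v) h1 h3 ((h.mul hv).integrable) (fun x _ => h.diff x) (fun x _ => hvd x)
  rw [this, neg_neg]

lemma fderiv_mul_ee {ψ v : R3 → ℝ} (h : Differentiable ℝ ψ) (hv : Differentiable ℝ v) (e x : R3) :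
    fderiv ℝ (fun x => ψ x * v x) x e = ψ x * fderiv ℝ v x e + fderiv ℝ ψ x e * v x := by
  rw [fderiv_fun_mul (h x) (hv x)]
  simp
  ring

lemma bddL2 {c f : R3 → ℝ} {C : ℝ} (hc : Measurable c) (hb : ∀ x, |c x| ≤ C)
    (hf : MemLp f 2 volume) : MemLp (fun x => c x * f x) 2 volume := by
  refine (hf.norm.const_mul C).mono' (hc.aestronglyMeasurable.mul hf.1) (Eventually.of_forall fun x => ?_)
  rw [norm_mul]
  exact mul_le_mul_of_nonneg_right (hb x) (norm_nonneg _)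

/-- chain rule -/
lemma W.comp {u : Fin 4 → R3 → ℝ} {g : Fin 4 → Fin 3 → R3 → ℝ} (h : ∀ b, W (u b) (g b))
    {a : R4 → ℝ} (ha : ContDiff ℝ (⊤ : ℕ∞) a) :
    W (fun x => a (fun b => u b x))
      (fun i x => ∑ b, fderiv ℝ a (fun b => u b x) (Pi.single b 1) * g b i x) := by
  have hum : Measurable (fun x => (fun b => u b x : R4)) :=
    measurable_pi_lambda _ fun b => (h b).meas
  choose C hC using fun b => (h b).bdd
  obtain ⟨R, hR⟩ : ∃ R, ∀ b, C b ≤ R :=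
    ⟨∑ b, |C b|, fun b => (le_abs_self _).trans
      (Finset.single_le_sum (f := fun b => |C b|) (fun i _ => abs_nonneg _) (Finset.mem_univ b))⟩
  have hR0 : 0 ≤ R := (abs_nonneg _).trans ((hC 0 0).trans (hR 0))
  have hub : ∀ x, (fun b => u b x : R4) ∈ Metric.closedBall (0 : R4) R := by
    intro x
    rw [mem_closedBall_zero_iff, pi_norm_le_iff_of_nonneg hR0]
    exact fun b => (hC b x).trans (hR b)
  have hmb : ∀ s x, (fun b => mol s (u b) x : R4) ∈ Metric.closedBall (0 : R4) R := by
    intro s x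
    rw [mem_closedBall_zero_iff, pi_norm_le_iff_of_nonneg hR0]
    exact fun b => (mol_bdd (hC b) s x).trans (hR b)
  have hbd : ∀ F : R4 → ℝ, Continuous F → ∃ K, ∀ y ∈ Metric.closedBall (0 : R4) R, |F y| ≤ K :=
    fun F hF => (isCompact_closedBall (0 : R4) R).exists_bound_of_continuousOn hF.continuousOn
  have hda : ∀ b, Continuous (fun y => fderiv ℝ a y (Pi.single b (1:ℝ))) := fun b =>
    (ha.continuous_fderiv (by simp)).clm_apply continuous_const
  obtain ⟨K, hK⟩ := hbd a ha.continuous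
  choose K' hK' using fun b => hbd _ (hda b)
  have htl : ∀ b, MemLp (g b 0) 2 volume := fun b => (h b).gL2 0
  refine ⟨ha.continuous.measurable.comp hum, ⟨K, fun x => hK _ (hub x)⟩, fun i => ?_, fun i => ?_, ?_⟩
  · refine Finset.measurable_sum _ fun b _ => ?_
    exact ((hda b).measurable.comp hum).mul ((h b).gmeas i)
  · refine memLp_finsetSum _ fun b _ => ?_
    exact bddL2 ((hda b).measurable.comp hum) (fun x => hK' b _ (hub x)) ((h b).gL2 i)
  · intro i ψ hψ
    have hmc : ∀ b s, 0 < s → ContDiff ℝ (⊤ : ℕ∞) (mol s (u b)) := fun b s hs =>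
      mol_contDiff hs (h b).locInt
    have hmcc : ∀ s, 0 < s → ContDiff ℝ (⊤ : ℕ∞) (fun x => (fun b => mol s (u b) x : R4)) :=
      fun s hs => contDiff_pi.2 fun b => hmc b s hs
    have hid : ∀ s, 0 < s → ∫ x, fderiv ℝ ψ x (ee i) * a (fun b => mol s (u b) x) =
        - ∑ b, ∫ x, (ψ x * fderiv ℝ a (fun b => mol s (u b) x) (Pi.single b 1)) * mol s (g b i) x := by
      intro s hs
      have hibp := ibp hψ (ha.comp (hmcc s hs)) (ee i)
      simp only [Function.comp_apply] at hibp
      rw [hibp, ← integral_finsetSum]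
      · congr 2
        ext x
        have h1 : HasFDerivAt (fun x => (fun b => mol s (u b) x : R4))
            (ContinuousLinearMap.pi fun b => fderiv ℝ (mol s (u b)) x) x :=
          hasFDerivAt_pi.2 fun b => ((hmc b s hs).differentiable (by simp) x).hasFDerivAt
        have h2 := ((ha.differentiable (by simp) _).hasFDerivAt.comp x h1).fderiv
        rw [h2]
        simp only [ContinuousLinearMap.comp_apply]
        have h3 : (ContinuousLinearMap.pi fun b => fderiv ℝ (mol s (u b)) x) (ee i) =
            ∑ b, mol s (g b i) x • (Pi.single b (1:ℝ) : R4) := by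
          ext c
          simp [Finset.sum_apply, Pi.single_apply, (h c).mol_deriv hs]
        rw [h3, map_sum, Finset.mul_sum]
        refine Finset.sum_congr rfl fun b _ => ?_
        rw [map_smul, smul_eq_mul]; ring
      · intro b _
        refine mulL2 ?_ ((mol_L2 ((h b).gmeas i) ((h b).gL2 i)).1 s hs)
        have : Continuous fun x => ψ x * fderiv ℝ a (fun b => mol s (u b) x) (Pi.single b 1) :=
          hψ.cont.mul ((hda b).comp (hmcc s hs).continuous)
        exact this.memLp_of_hasCompactSupport hψ.2.mul_right
    have hae : ∀ᵐ x, Tendsto (fun s => (fun b => mol s (u b) x : R4)) (𝓝[>] 0) (𝓝 (fun b => u b x)) := by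
      have : ∀ᵐ x, ∀ b, Tendsto (fun s => mol s (u b) x) (𝓝[>] 0) (𝓝 (u b x)) :=
        ae_all_iff.2 fun b => mol_tendsto_ae (h b).locInt
      filter_upwards [this] with x hx
      exact tendsto_pi_nhds.2 hx
    have hL : Tendsto (fun s => ∫ x, fderiv ℝ ψ x (ee i) * a (fun b => mol s (u b) x)) (𝓝[>] 0)
        (𝓝 (∫ x, fderiv ℝ ψ x (ee i) * a (fun b => u b x))) := by
      refine tendsto_integral_filter_of_dominated_convergence (fun x => |fderiv ℝ ψ x (ee i)| * K) ?_ ?_ ?_ ?_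
      · filter_upwards [self_mem_nhdsWithin] with s hs
        exact ((hψ.d _).cont.mul (ha.continuous.comp (hmcc s hs).continuous)).aestronglyMeasurable
      · refine Eventually.of_forall fun s => Eventually.of_forall fun x => ?_
        rw [norm_mul]
        exact mul_le_mul_of_nonneg_left (hK _ (hmb s x)) (norm_nonneg _)
      · exact (hψ.d _).integrable.norm.mul_const K
      · filter_upwards [hae] with x hx
        exact ((ha.continuous.tendsto _).comp hx).const_mul _
    have hRr : Tendsto (fun s => - ∑ b, ∫ x, (ψ x * fderiv ℝ a (fun b => mol s (u b) x)
        (Pi.single b 1)) * mol s (g b i) x) (𝓝[>] 0) (𝓝 (- ∑ b, ∫ x, (ψ x * fderiv ℝ a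
          (fun b => u b x) (Pi.single b 1)) * g b i x)) := by
      refine (tendsto_finsetSum _ fun b _ => ?_).neg
      refine lim_cf (Ψ := fun x => |ψ x| * K' b) ((hψ.memLp 2).norm.mul_const (K' b)) ?_ ?_ ?_
        ((h b).gL2 i) ?_ (mol_L2 ((h b).gmeas i) ((h b).gL2 i)).2
      · filter_upwards [self_mem_nhdsWithin] with s hs
        exact (hψ.cont.mul ((hda b).comp (hmcc s hs).continuous)).aestronglyMeasurable
      · refine Eventually.of_forall fun s => Eventually.of_forall fun x => ?_
        rw [abs_mul]
        exact mul_le_mul_of_nonneg_left (hK' b _ (hmb s x)) (abs_nonneg _)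
      · filter_upwards [hae] with x hx
        exact (((hda b).tendsto _).comp hx).const_mul _
      · filter_upwards [self_mem_nhdsWithin] with s hs
        exact (mol_L2 ((h b).gmeas i) ((h b).gL2 i)).1 s hs
    have huniq := tendsto_nhds_unique hL (hRr.congr' (by
      filter_upwards [self_mem_nhdsWithin] with s hs
      exact (hid s hs).symm))
    rw [huniq, ← integral_finsetSum]
    · congr 2
      ext x
      rw [Finset.mul_sum]
      exact Finset.sum_congr rfl fun b _ => by ring
    · intro b _
      refine mulL2 ?_ ((h b).gL2 i)
      have := bddL2 (c := fun x => fderiv ℝ a (fun b => u b x) (Pi.single b 1))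
        ((hda b).measurable.comp hum) (fun x => hK' b _ (hub x)) (hψ.memLp 2)
      simpa only [mul_comm] using this

lemma W.gloc {u g} (h : W u g) (i : Fin 3) : LocallyIntegrable (g i) volume := locInt_of_L2 (h.gL2 i)

lemma lemG {F : Fin 3 → R3 → ℝ} (hF : ∀ i, MemLp (F i) 2 volume)
    (hdiv : ∀ ζ : R3 → ℝ, IsTestFun ζ → ∫ x, ∑ i, fderiv ℝ ζ x (ee i) * F i x = 0)
    {w : R3 → ℝ} {g : Fin 3 → R3 → ℝ} (hw : W w g) {ψ : R3 → ℝ} (hψ : IsTestFun ψ) :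
    ∫ x, ψ x * ∑ i, g i x * F i x = - ∫ x, w x * ∑ i, fderiv ℝ ψ x (ee i) * F i x := by
  obtain ⟨C, hC⟩ := hw.bdd
  have hmc : ∀ s, 0 < s → ContDiff ℝ (⊤ : ℕ∞) (mol s w) := fun s hs => mol_contDiff hs hw.locInt
  have hA' : ∀ i, MemLp (fun x => ψ x * F i x) 2 volume := fun i => by
    obtain ⟨K, hK⟩ := hψ.bdd
    exact bddL2 hψ.cont.measurable hK (hF i)
  have hD : ∀ i, Integrable (fun x => fderiv ℝ ψ x (ee i) * F i x) volume := fun i =>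
    mulL2 ((hψ.d _).memLp 2) (hF i)
  have hid : ∀ s, 0 < s → (∑ i, ∫ x, (ψ x * F i x) * mol s (g i) x) +
      ∫ x, mol s w x * ∑ i, fderiv ℝ ψ x (ee i) * F i x = 0 := by
    intro s hs
    have h1 := hdiv _ (hψ.mul (hmc s hs))
    have hi1 : ∀ i, Integrable (fun x => (ψ x * F i x) * mol s (g i) x) volume := fun i =>
      mulL2 (hA' i) ((mol_L2 (hw.gmeas i) (hw.gL2 i)).1 s hs)
    have hi2 : Integrable (fun x => mol s w x * ∑ i, fderiv ℝ ψ x (ee i) * F i x) volume := by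
      refine (integrable_finsetSum _ fun i _ => hD i).bdd_mul (c := C)
        (hmc s hs).continuous.aestronglyMeasurable (Eventually.of_forall fun x => ?_)
      exact mol_bdd hC s x
    rw [← integral_finsetSum _ (fun i _ => hi1 i), ← integral_add (integrable_finsetSum _ fun i _ => hi1 i) hi2,
      ← h1]
    congr 1
    ext x
    rw [Finset.mul_sum, ← Finset.sum_add_distrib]
    refine Finset.sum_congr rfl fun i _ => ?_
    rw [fderiv_mul_ee hψ.diff ((hmc s hs).differentiable (by simp)), hw.mol_deriv hs]
    ring
  have hl1 : Tendsto (fun s => ∑ i, ∫ x, (ψ x * F i x) * mol s (g i) x) (𝓝[>] 0)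
      (𝓝 (∑ i, ∫ x, (ψ x * F i x) * g i x)) := by
    refine tendsto_finsetSum _ fun i _ => ?_
    refine lim_cf (Ψ := fun x => |ψ x * F i x|) (hA' i).norm (Eventually.of_forall fun s => (hA' i).1)
      (Eventually.of_forall fun s => Eventually.of_forall fun x => le_rfl)
      (Eventually.of_forall fun x => tendsto_const_nhds) (hw.gL2 i) ?_ (mol_L2 (hw.gmeas i) (hw.gL2 i)).2
    filter_upwards [self_mem_nhdsWithin] with s hs
    exact (mol_L2 (hw.gmeas i) (hw.gL2 i)).1 s hs
  have hl2 : Tendsto (fun s => ∫ x, mol s w x * ∑ i, fderiv ℝ ψ x (ee i) * F i x) (𝓝[>] 0)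
      (𝓝 (∫ x, w x * ∑ i, fderiv ℝ ψ x (ee i) * F i x)) := by
    have hI := (integrable_finsetSum (μ := volume) Finset.univ fun i _ => hD i)
    refine tendsto_integral_filter_of_dominated_convergence
      (fun x => C * ‖∑ i, fderiv ℝ ψ x (ee i) * F i x‖) ?_ ?_ (hI.norm.const_mul C) ?_
    · filter_upwards [self_mem_nhdsWithin] with s hs
      exact (hmc s hs).continuous.aestronglyMeasurable.mul hI.1
    · refine Eventually.of_forall fun s => Eventually.of_forall fun x => ?_
      rw [norm_mul]
      exact mul_le_mul_of_nonneg_right (mol_bdd hC s x) (norm_nonneg _)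
    · filter_upwards [mol_tendsto_ae hw.locInt] with x hx using hx.mul_const _
  have hl := hl1.add hl2
  have h0 := tendsto_nhds_unique hl ((tendsto_const_nhds (x := (0:ℝ))).congr' (by
    filter_upwards [self_mem_nhdsWithin] with s hs
    exact (hid s hs).symm))
  rw [← integral_finsetSum _ (fun i _ => mulL2 (hA' i) (hw.gL2 i))] at h0
  rw [← add_eq_zero_iff_eq_neg, ← h0]
  congr 2
  ext x
  rw [Finset.mul_sum]
  exact Finset.sum_congr rfl fun i _ => by ring

/-- cross product -/
def cr (a b : Fin 3 → ℝ) (k : Fin 3) : ℝ := a (k+1) * b (k+2) - a (k+2) * b (k+1)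

/-- cross product of fields -/
def crf (g h : Fin 3 → R3 → ℝ) (k : Fin 3) (x : R3) : ℝ := cr (fun i => g i x) (fun i => h i x) k

lemma snd_symm {ζ : R3 → ℝ} (h : IsTestFun ζ) (x a b : R3) :
    fderiv ℝ (fun x => fderiv ℝ ζ x a) x b = fderiv ℝ (fun x => fderiv ℝ ζ x b) x a := by
  have hd : DifferentiableAt ℝ (fderiv ℝ ζ) x :=
    (h.1.fderiv_right (m := (⊤ : ℕ∞)) (by simp)).differentiable (by simp) x
  have hs : IsSymmSndFDerivAt ℝ ζ x := h.1.contDiffAt.isSymmSndFDerivAt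
    (by rw [minSmoothness_of_isRCLikeNormedField]; exact WithTop.coe_le_coe.2 (le_top (a := (2 : ℕ∞))))
  have e : ∀ c d : R3, fderiv ℝ (fun x => fderiv ℝ ζ x c) x d = fderiv ℝ (fderiv ℝ ζ) x d c := by
    intro c d
    rw [fderiv_clm_apply hd (differentiableAt_const c)]
    simp
  rw [e, e]
  exact hs.eq b a

lemma sum_ee (k : Fin 3) (F : Fin 3 → ℝ) : ∑ i, F i = F k + F (k+1) + F (k+2) := by
  fin_cases k <;> simp [Fin.sum_univ_three] <;> ring

lemma crf_int {u gu v gv} (hu : W u gu) (hv : W v gv) (k : Fin 3) :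
    Integrable (crf gu gv k) volume :=
  (mulL2 (hu.gL2 _) (hv.gL2 _)).sub (mulL2 (hu.gL2 _) (hv.gL2 _))

lemma minor_ibp {u gu v gv} (hu : W u gu) (hv : W v gv) {ψ : R3 → ℝ} (hψ : IsTestFun ψ) (k : Fin 3) :
    ∫ x, ψ x * crf gu gv k x =
      - ∫ x, u x * (fderiv ℝ ψ x (ee (k+1)) * gv (k+2) x - fderiv ℝ ψ x (ee (k+2)) * gv (k+1) x) := by
  have hk : (k + 1 ≠ k) ∧ (k + 2 ≠ k) ∧ (k + 2 ≠ k + 1) := by fin_cases k <;> decide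
  let F : Fin 3 → R3 → ℝ := fun i x => if i = k + 1 then gv (k+2) x else
    if i = k + 2 then - gv (k+1) x else 0
  have e0 : ∀ x, F k x = 0 := fun x => by simp [F, hk.1.symm, hk.2.1.symm]
  have e1 : ∀ x, F (k+1) x = gv (k+2) x := fun x => by simp [F]
  have e2 : ∀ x, F (k+2) x = - gv (k+1) x := fun x => by simp [F, hk.2.2]
  have hF : ∀ i, MemLp (F i) 2 volume := by
    intro i
    by_cases h1 : i = k + 1
    · simpa [F, h1] using hv.gL2 (k+2)
    · by_cases h2 : i = k + 2
      · have : F i = - gv (k+1) := by ext x; rw [h2]; exact e2 x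
        rw [this]; exact (hv.gL2 (k+1)).neg
      · simp [F, h1, h2]
  have hs : ∀ (a : Fin 3 → ℝ) x, ∑ i, a i * F i x = a (k+1) * gv (k+2) x - a (k+2) * gv (k+1) x := by
    intro a x
    rw [sum_ee k, e0, e1, e2]; ring
  have := lemG hF (fun ζ hζ => ?_) hu hψ
  · simp_rw [hs] at this
    exact this
  · simp_rw [hs]
    rw [integral_sub (mulL2 ((hζ.d _).memLp 2) (hv.gL2 _)) (mulL2 ((hζ.d _).memLp 2) (hv.gL2 _))]
    have h1 := hv.weak (k+2) _ (hζ.d (ee (k+1)))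
    have h2 := hv.weak (k+1) _ (hζ.d (ee (k+2)))
    simp_rw [snd_symm hζ _ (ee (k+1)) (ee (k+2))] at h1
    rw [h1] at h2
    linarith

lemma minor_div {u gu v gv} (hu : W u gu) (hv : W v gv) {ζ : R3 → ℝ} (hζ : IsTestFun ζ) :
    ∫ x, ∑ k, fderiv ℝ ζ x (ee k) * crf gu gv k x = 0 := by
  have hb : ∀ k, Integrable (fun x => fderiv ℝ ζ x (ee k) * crf gu gv k x) volume := fun k => by
    obtain ⟨C, hC⟩ := (hζ.d (ee k)).bdd
    exact (crf_int hu hv k).bdd_mul (c := C) (hζ.d _).cont.aestronglyMeasurable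
      (Eventually.of_forall hC)
  rw [integral_finsetSum _ fun k _ => hb k]
  have e : ∀ k, ∫ x, fderiv ℝ ζ x (ee k) * crf gu gv k x = _ := fun k => minor_ibp hu hv (hζ.d (ee k)) k
  simp_rw [e]
  obtain ⟨C, hC⟩ := hu.bdd
  have hi : ∀ a b c : Fin 3, Integrable (fun x => u x * (fderiv ℝ (fun x => fderiv ℝ ζ x (ee a)) x (ee b) * gv c x)) volume := by
    intro a b c
    refine (mulL2 (((hζ.d (ee a)).d (ee b)).memLp 2) (hv.gL2 c)).bdd_mul (c := C)
      hu.meas.aestronglyMeasurable (Eventually.of_forall hC)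
  simp_rw [mul_sub]
  simp_rw [fun k => integral_sub (hi k (k+1) (k+2)) (hi k (k+2) (k+1))]
  simp only [Fin.sum_univ_three]
  simp only [Fin.reduceAdd, zero_add, Fin.isValue]
  simp_rw [snd_symm hζ _ (ee 1) (ee 0), snd_symm hζ _ (ee 2) (ee 0), snd_symm hζ _ (ee 2) (ee 1)]
  ring

lemma det_ibp {w gw u gu v gv} (hw : W w gw) (hu : W u gu) (hv : W v gv)
    (hJ : ∀ k, MemLp (crf gu gv k) 2 volume) {ψ : R3 → ℝ} (hψ : IsTestFun ψ) :
    ∫ x, ψ x * ∑ k, gw k x * crf gu gv k x =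
      - ∫ x, w x * ∑ k, fderiv ℝ ψ x (ee k) * crf gu gv k x :=
  lemG hJ (fun _ hζ => minor_div hu hv hζ) hw hψ

/-- cutoff -/
def chiB : ContDiffBump (0 : R3) := ⟨1, 2, by norm_num, by norm_num⟩

def chi (R : ℝ) (x : R3) : ℝ := chiB (R⁻¹ • x)

lemma chi_nonneg (R : ℝ) (x : R3) : 0 ≤ chi R x := chiB.nonneg
lemma chi_le_one (R : ℝ) (x : R3) : chi R x ≤ 1 := chiB.le_one
lemma chi_test {R : ℝ} (hR : 0 < R) : IsTestFun (chi R) := by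
  refine ⟨chiB.contDiff.comp (contDiff_const_smul _), ?_⟩
  exact chiB.hasCompactSupport.comp_smul (inv_ne_zero hR.ne')
lemma chi_one {R : ℝ} (hR : 0 < R) {x : R3} (hx : ‖x‖ ≤ R) : chi R x = 1 := by
  apply chiB.one_of_mem_closedBall
  rw [mem_closedBall_zero_iff, norm_smul, norm_inv, Real.norm_eq_abs, abs_of_pos hR]
  rw [inv_mul_le_iff₀ hR]
  simpa [chiB] using hx
lemma chi_zero {R : ℝ} (hR : 0 < R) {x : R3} (hx : 2 * R ≤ ‖x‖) : chi R x = 0 := by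
  apply chiB.zero_of_le_dist
  rw [dist_zero_right, norm_smul, norm_inv, Real.norm_eq_abs, abs_of_pos hR]
  rw [le_inv_mul_iff₀ hR]
  simp only [chiB]; linarith

lemma chi_deriv : ∃ C > 0, ∀ R > 0, ∀ i x, |fderiv ℝ (chi R) x (ee i)| ≤ C / R := by
  have ht : IsTestFun (chiB : R3 → ℝ) := ⟨chiB.contDiff, chiB.hasCompactSupport⟩
  choose C hC using fun i => (ht.d (ee i)).bdd
  have hC0 : ∀ i, 0 ≤ C i := fun i => (abs_nonneg _).trans (hC i 0)
  refine ⟨∑ i, C i + 1, by have := Finset.sum_nonneg (s := Finset.univ) fun i _ => hC0 i; linarith,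
    fun R hR i x => ?_⟩
  have h1 : fderiv ℝ (chi R) x (ee i) = R⁻¹ * fderiv ℝ (chiB : R3 → ℝ) (R⁻¹ • x) (ee i) := by
    have : chi R = fun x => (chiB : R3 → ℝ) (R⁻¹ • x) := rfl
    rw [this, fderiv_comp_smul]
    simp
  rw [h1, abs_mul, abs_of_pos (inv_pos.2 hR), div_eq_inv_mul]
  gcongr
  refine (hC i _).trans ((Finset.single_le_sum (fun i _ => hC0 i) (Finset.mem_univ i)).trans ?_)
  linarith

lemma chi_tendsto {f : R3 → ℝ} (hf : Integrable f volume) :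
    Tendsto (fun R => ∫ x, chi R x * f x) atTop (𝓝 (∫ x, f x)) := by
  refine tendsto_integral_filter_of_dominated_convergence (fun x => ‖f x‖) ?_ ?_ hf.norm ?_
  · filter_upwards [eventually_gt_atTop 0] with R hR
    exact (chi_test hR).cont.aestronglyMeasurable.mul hf.1
  · refine Eventually.of_forall fun R => Eventually.of_forall fun x => ?_
    rw [norm_mul, Real.norm_eq_abs, abs_of_nonneg (chi_nonneg _ _)]
    exact mul_le_of_le_one_left (norm_nonneg _) (chi_le_one _ _)
  · refine Eventually.of_forall fun x => ?_
    refine tendsto_const_nhds.congr' ?_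
    filter_upwards [eventually_gt_atTop 0, eventually_ge_atTop ‖x‖] with R hR h2
    rw [chi_one hR h2, one_mul]

lemma lemB {w gw u gu v gv} (hw : W w gw) (hu : W u gu) (hv : W v gv)
    (hJ : ∀ k, MemLp (crf gu gv k) 2 volume)
    (hT : Integrable (fun x => ∑ k, gw k x * crf gu gv k x) volume) :
    ∫ x, ∑ k, gw k x * crf gu gv k x = 0 := by
  have h1 := chi_tendsto hT
  obtain ⟨C, hC0, hC⟩ := chi_deriv
  obtain ⟨K, hK⟩ := hw.bdd
  have hK0 : 0 ≤ K := (abs_nonneg _).trans (hK 0)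
  have h2 : Tendsto (fun R => ∫ x, chi R x * ∑ k, gw k x * crf gu gv k x) atTop (𝓝 0) := by
    have h3 : Tendsto (fun R : ℝ => (K * C * ∫ x, ∑ k, |crf gu gv k x|) / R) atTop (𝓝 0) :=
      tendsto_const_nhds.div_atTop tendsto_id
    refine squeeze_zero_norm' ?_ h3
    filter_upwards [eventually_gt_atTop 0] with R hR
    rw [det_ibp hw hu hv hJ (chi_test hR), norm_neg]
    have : K * C * (∫ x, ∑ k, |crf gu gv k x|) / R = ∫ x, (K * C / R) * ∑ k, |crf gu gv k x| := by
      rw [integral_const_mul]; ring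
    rw [this]
    refine norm_integral_le_of_norm_le ((integrable_finsetSum _ fun k _ => (crf_int hu hv k).norm).const_mul _)
      (Eventually.of_forall fun x => ?_)
    rw [norm_mul, mul_div_assoc, mul_assoc]
    refine mul_le_mul (hK x) ?_ (norm_nonneg _) hK0
    rw [Finset.mul_sum]
    refine (norm_sum_le _ _).trans (Finset.sum_le_sum fun k _ => ?_)
    rw [norm_mul]
    exact mul_le_mul_of_nonneg_right (hC R hR k x) (norm_nonneg _)
  exact tendsto_nhds_unique h1 h2

/-- components -/
def cu (φ : SkyrmeMap) (a : Fin 4) (x : R3) : ℝ := φ.toFun x a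
def cg (φ : SkyrmeMap) (a : Fin 4) (i : Fin 3) (x : R3) : ℝ := φ.pderiv i x a
def cJ (φ : SkyrmeMap) (a b : Fin 4) (k : Fin 3) (x : R3) : ℝ := crf (cg φ a) (cg φ b) k x

lemma gradSq_eq (φ : SkyrmeMap) (x : R3) : gradSq φ x = ∑ a, ∑ i, cg φ a i x ^ 2 := by
  rw [Finset.sum_comm]
  simp only [gradSq, nsq, dot, cg, sq]

lemma ASq_eq (φ : SkyrmeMap) (x : R3) : ASq φ x = ∑ a, ∑ b, ∑ k, cJ φ a b k x ^ 2 := by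
  simp only [ASq, wedgeSq, nsq, dot, cJ, crf, cr, cg]
  simp only [Fin.sum_univ_four, Fin.sum_univ_three, Fin.reduceAdd, zero_add, Fin.isValue]
  ring

lemma dens_eq (φ : SkyrmeMap) (x : R3) :
    energyDensity φ x = ∑ a, ∑ i, cg φ a i x ^ 2 + ∑ a, ∑ b, ∑ k, cJ φ a b k x ^ 2 := by
  rw [energyDensity, gradSq_eq, ASq_eq]

lemma gradSq_nonneg (φ : SkyrmeMap) (x : R3) : 0 ≤ gradSq φ x := by
  rw [gradSq_eq]; positivity
lemma ASq_nonneg (φ : SkyrmeMap) (x : R3) : 0 ≤ ASq φ x := by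
  rw [ASq_eq]; positivity
lemma dens_nonneg (φ : SkyrmeMap) (x : R3) : 0 ≤ energyDensity φ x := by
  rw [dens_eq]; positivity

lemma cg_sq_le (φ : SkyrmeMap) (a : Fin 4) (i : Fin 3) (x : R3) : cg φ a i x ^ 2 ≤ energyDensity φ x := by
  have h1 : cg φ a i x ^ 2 ≤ ∑ a, ∑ i, cg φ a i x ^ 2 :=
    (Finset.single_le_sum (f := fun i => cg φ a i x ^ 2) (fun i _ => sq_nonneg _) (Finset.mem_univ i)).trans
    (Finset.single_le_sum (f := fun a => ∑ i, cg φ a i x ^ 2)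
      (fun i _ => Finset.sum_nonneg fun i _ => sq_nonneg _) (Finset.mem_univ a))
  have := ASq_nonneg φ x
  rw [energyDensity, gradSq_eq]
  linarith

lemma cJ_sq_le (φ : SkyrmeMap) (a b : Fin 4) (k : Fin 3) (x : R3) :
    cJ φ a b k x ^ 2 ≤ energyDensity φ x := by
  have h1 : cJ φ a b k x ^ 2 ≤ ∑ a, ∑ b, ∑ k, cJ φ a b k x ^ 2 :=
    ((Finset.single_le_sum (f := fun k => cJ φ a b k x ^ 2) (fun i _ => sq_nonneg _)
      (Finset.mem_univ k)).trans
    (Finset.single_le_sum (f := fun b => ∑ k, cJ φ a b k x ^ 2)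
      (fun i _ => Finset.sum_nonneg fun i _ => sq_nonneg _) (Finset.mem_univ b))).trans
    (Finset.single_le_sum (f := fun a => ∑ b, ∑ k, cJ φ a b k x ^ 2)
      (fun i _ => Finset.sum_nonneg fun i _ => Finset.sum_nonneg fun i _ => sq_nonneg _) (Finset.mem_univ a))
  have := gradSq_nonneg φ x
  rw [energyDensity, ASq_eq]
  linarith

structure Nice (φ : SkyrmeMap) : Prop where
  memX : memX φ
  sph : ∀ x, ∑ a, cu φ a x ^ 2 = 1
  orth : ∀ x i, ∑ a, cu φ a x * cg φ a i x = 0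
  pm : ∀ i a, Measurable (cg φ a i)

structure Nice0 (φ : SkyrmeMap) : Prop where
  memX : memX φ
  sph : ∀ x, ∑ a, cu φ a x ^ 2 = 1
  pm : ∀ i a, Measurable (cg φ a i)

lemma Nice.n0 {φ : SkyrmeMap} (h : Nice φ) : Nice0 φ := ⟨h.memX, h.sph, h.pm⟩

lemma cu_meas (φ : SkyrmeMap) (a : Fin 4) : Measurable (cu φ a) :=
  (measurable_pi_apply a).comp φ.meas

lemma abs_le_one_of_sum {v : Fin 4 → ℝ} (h : ∑ a, v a ^ 2 = 1) (a : Fin 4) : |v a| ≤ 1 := by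
  have := Finset.single_le_sum (f := fun a => v a ^ 2) (fun i _ => sq_nonneg _) (Finset.mem_univ a)
  rw [h] at this
  exact (sq_le_one_iff_abs_le_one _).1 this

lemma Nice0.gL2 {φ : SkyrmeMap} (h : Nice0 φ) (a : Fin 4) (i : Fin 3) : MemLp (cg φ a i) 2 volume := by
  rw [memLp_two_iff_integrable_sq (h.pm i a).aestronglyMeasurable]
  refine Integrable.mono' h.memX ((h.pm i a).pow_const 2).aestronglyMeasurable (Eventually.of_forall fun x => ?_)
  rw [Real.norm_eq_abs, abs_of_nonneg (sq_nonneg _)]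
  exact cg_sq_le φ a i x

lemma Nice0.W {φ : SkyrmeMap} (h : Nice0 φ) (a : Fin 4) : W (cu φ a) (cg φ a) :=
  ⟨cu_meas φ a, ⟨1, fun x => abs_le_one_of_sum (h.sph x) a⟩, fun i => h.pm i a, fun i => h.gL2 a i,
    fun i ψ hψ => φ.weak i a ψ hψ⟩

lemma Nice0.cJm {φ : SkyrmeMap} (h : Nice0 φ) (a b : Fin 4) (k : Fin 3) : Measurable (cJ φ a b k) :=
  ((h.pm _ a).mul (h.pm _ b)).sub ((h.pm _ a).mul (h.pm _ b))

lemma Nice0.JL2 {φ : SkyrmeMap} (h : Nice0 φ) (a b : Fin 4) (k : Fin 3) : MemLp (cJ φ a b k) 2 volume := by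
  rw [memLp_two_iff_integrable_sq (h.cJm a b k).aestronglyMeasurable]
  refine Integrable.mono' h.memX ((h.cJm a b k).pow_const 2).aestronglyMeasurable (Eventually.of_forall fun x => ?_)
  rw [Real.norm_eq_abs, abs_of_nonneg (sq_nonneg _)]
  exact cJ_sq_le φ a b k x

lemma Nice.W {φ : SkyrmeMap} (h : Nice φ) (a : Fin 4) : W (cu φ a) (cg φ a) := h.n0.W a
lemma Nice.JL2 {φ : SkyrmeMap} (h : Nice φ) (a b : Fin 4) (k : Fin 3) : MemLp (cJ φ a b k) 2 volume :=
  h.n0.JL2 a b k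

lemma locInt_congr {E : Type*} [NormedAddCommGroup E] {f g : R3 → E} (hf : LocallyIntegrable f volume)
    (h : f =ᵐ[volume] g) :
    LocallyIntegrable g volume := fun x => by
  obtain ⟨U, hU, hi⟩ := hf x
  exact ⟨U, hU, hi.congr (ae_restrict_of_ae h)⟩

/-- modification on a null set -/
def modif (φ : SkyrmeMap) (u : R3 → R4) (p : Fin 3 → R3 → R4) (hu : Measurable u)
    (hue : φ.toFun =ᵐ[volume] u) (hpe : ∀ i, φ.pderiv i =ᵐ[volume] p i) : SkyrmeMap where
  toFun := u
  pderiv := p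
  meas := hu
  pderiv_locInt := fun i => locInt_congr (φ.pderiv_locInt i) (hpe i)
  sphere := by
    filter_upwards [φ.sphere, hue] with x hx h2
    rw [← h2]; exact hx
  weak := fun i a ψ hψ => by
    have := φ.weak i a ψ hψ
    have e1 : ∫ x, fderiv ℝ ψ x (Pi.single i 1) * u x a = ∫ x, fderiv ℝ ψ x (Pi.single i 1) * φ.toFun x a := by
      apply integral_congr_ae
      filter_upwards [hue] with x hx
      rw [hx]
    have e2 : ∫ x, ψ x * p i x a = ∫ x, ψ x * φ.pderiv i x a := by
      apply integral_congr_ae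
      filter_upwards [hpe i] with x hx
      rw [hx]
    rw [e1, e2, this]

lemma modif_dens (φ : SkyrmeMap) (u : R3 → R4) (p : Fin 3 → R3 → R4) (hu : Measurable u)
    (hue : φ.toFun =ᵐ[volume] u) (hpe : ∀ i, φ.pderiv i =ᵐ[volume] p i) :
    energyDensity (modif φ u p hu hue hpe) =ᵐ[volume] energyDensity φ := by
  filter_upwards [ae_all_iff.2 hpe] with x hx
  simp only [energyDensity, gradSq, ASq, modif, hx]

lemma modif_det (φ : SkyrmeMap) (u : R3 → R4) (p : Fin 3 → R3 → R4) (hu : Measurable u)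
    (hue : φ.toFun =ᵐ[volume] u) (hpe : ∀ i, φ.pderiv i =ᵐ[volume] p i) :
    detDen (modif φ u p hu hue hpe) =ᵐ[volume] detDen φ := by
  filter_upwards [ae_all_iff.2 hpe, hue] with x hx hx2
  simp only [detDen, modif, hx, hx2]

lemma modif_props (φ : SkyrmeMap) (u : R3 → R4) (p : Fin 3 → R3 → R4) (hu : Measurable u)
    (hue : φ.toFun =ᵐ[volume] u) (hpe : ∀ i, φ.pderiv i =ᵐ[volume] p i) (h : memX φ) :
    memX (modif φ u p hu hue hpe) ∧ degree (modif φ u p hu hue hpe) = degree φ ∧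
      energy (modif φ u p hu hue hpe) = energy φ := by
  refine ⟨Integrable.congr h (modif_dens φ u p hu hue hpe).symm, ?_, ?_⟩
  · rw [degree, degree, integral_congr_ae (modif_det φ u p hu hue hpe)]
  · rw [energy, energy, integral_congr_ae (modif_dens φ u p hu hue hpe)]

lemma exists_nice0 (φ : SkyrmeMap) (h : memX φ) :
    ∃ φ', Nice0 φ' ∧ degree φ' = degree φ ∧ energy φ' = energy φ ∧
      energyDensity φ' =ᵐ[volume] energyDensity φ ∧ detDen φ' =ᵐ[volume] detDen φ := by
  classical
  have hpm : ∀ i, AEStronglyMeasurable (φ.pderiv i) volume := fun i => (φ.pderiv_locInt i).aestronglyMeasurable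
  have hset : MeasurableSet {x | nsq (φ.toFun x) = 1} := by
    refine measurableSet_eq_fun ?_ measurable_const
    unfold nsq dot
    have := φ.meas
    fun_prop
  let u : R3 → R4 := fun x => if nsq (φ.toFun x) = 1 then φ.toFun x else Pi.single 0 1
  have hu : Measurable u := Measurable.ite hset φ.meas measurable_const
  have hue : φ.toFun =ᵐ[volume] u := by
    filter_upwards [φ.sphere] with x hx
    simp [u, hx]
  let p : Fin 3 → R3 → R4 := fun i => (hpm i).mk _
  have hpe : ∀ i, φ.pderiv i =ᵐ[volume] p i := fun i => (hpm i).ae_eq_mk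
  obtain ⟨h1, h2, h3⟩ := modif_props φ u p hu hue hpe h
  refine ⟨modif φ u p hu hue hpe, ⟨h1, fun x => ?_, fun i a => ?_⟩, h2, h3,
    modif_dens φ u p hu hue hpe, modif_det φ u p hu hue hpe⟩
  · simp only [cu, modif, u]
    split_ifs with hx
    · rw [← hx]; simp [nsq, dot, sq]
    · simp [Fin.sum_univ_four]
  · exact (measurable_pi_apply a).comp (hpm i).stronglyMeasurable_mk.measurable

lemma Nice0.orth {φ : SkyrmeMap} (h : Nice0 φ) : ∀ᵐ x, ∀ i, ∑ a, cu φ a x * cg φ a i x = 0 := by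
  rw [ae_all_iff]
  intro i
  have hW := W.comp (fun b => h.W b) (a := fun y : R4 => ∑ b, y b ^ 2) (by fun_prop)
  have hder : ∀ (y : R4) b, fderiv ℝ (fun y : R4 => ∑ b, y b ^ 2) y (Pi.single b 1) = 2 * y b := by
    intro y b
    have h1 : HasFDerivAt (fun y : R4 => ∑ b, y b ^ 2)
        (∑ b, (2 * y b) • (ContinuousLinearMap.proj b : R4 →L[ℝ] ℝ)) y := by
      refine HasFDerivAt.fun_sum fun c _ => ?_
      have := ((ContinuousLinearMap.proj c : R4 →L[ℝ] ℝ).hasFDerivAt (x := y)).pow 2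
      simpa using this
    rw [h1.fderiv]
    simp [Pi.single_apply]
  have hz : ∀ᵐ x, ∑ b, 2 * cu φ b x * cg φ b i x = 0 := by
    have hloc := hW.gloc i
    simp only [hder] at hloc
    refine ae_eq_zero_of_integral_contDiff_smul_eq_zero hloc fun ψ hψ hc => ?_
    have h1 := hW.weak i ψ ⟨hψ, hc⟩
    simp only [hder] at h1
    simp only [smul_eq_mul]
    simp_rw [h.sph] at h1
    have h2 := ibp (v := fun _ => (1:ℝ)) (⟨hψ, hc⟩ : IsTestFun ψ) contDiff_const (ee i)
    rw [h2] at h1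
    simp at h1
    exact h1
  filter_upwards [hz] with x hx
  simp_rw [mul_assoc, ← Finset.mul_sum] at hx
  linarith

lemma exists_nice (φ : SkyrmeMap) (h : memX φ) :
    ∃ φ', Nice φ' ∧ degree φ' = degree φ ∧ energy φ' = energy φ ∧
      energyDensity φ' =ᵐ[volume] energyDensity φ ∧ detDen φ' =ᵐ[volume] detDen φ := by
  obtain ⟨φ₀, h0, hd, he, hde, hdt⟩ := exists_nice0 φ h
  let p : Fin 3 → R3 → R4 := fun i x a => cg φ₀ a i x - (∑ b, cu φ₀ b x * cg φ₀ b i x) * cu φ₀ a x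
  have hpe : ∀ i, φ₀.pderiv i =ᵐ[volume] p i := by
    intro i
    filter_upwards [h0.orth] with x hx
    ext a
    simp only [p]
    rw [hx, zero_mul, sub_zero]; rfl
  obtain ⟨h1, h2, h3⟩ := modif_props φ₀ φ₀.toFun p φ₀.meas (ae_eq_refl _) hpe h0.memX
  refine ⟨modif φ₀ φ₀.toFun p φ₀.meas (ae_eq_refl _) hpe, ⟨h1, h0.sph, fun x i => ?_, fun i a => ?_⟩,
    h2.trans hd, h3.trans he, (modif_dens φ₀ φ₀.toFun p φ₀.meas (ae_eq_refl _) hpe).trans hde,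
    (modif_det φ₀ φ₀.toFun p φ₀.meas (ae_eq_refl _) hpe).trans hdt⟩
  · have hs := h0.sph x
    simp only [cu, cg, modif, p] at hs ⊢
    simp only [Fin.sum_univ_four] at hs ⊢
    linear_combination (-(φ₀.toFun x 0 * φ₀.pderiv i x 0 + φ₀.toFun x 1 * φ₀.pderiv i x 1
      + φ₀.toFun x 2 * φ₀.pderiv i x 2 + φ₀.toFun x 3 * φ₀.pderiv i x 3)) * hs
  · have h5 := fun a => cu_meas φ₀ a
    have h6 := fun a => h0.pm i a
    simp only [cg, modif, p]
    exact (h6 a).sub ((Finset.measurable_sum _ fun b _ => (h5 b).mul (h6 b)).mul (h5 a))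

def cD (φ : SkyrmeMap) (a b c : Fin 4) (x : R3) : ℝ := ∑ k, cg φ a k x * cJ φ b c k x

lemma det4_eq (f a b c : R4) : det4 f a b c =
    a 0 * (- f 1 * (b 2 * c 3 - b 3 * c 2) + f 2 * (b 1 * c 3 - b 3 * c 1) - f 3 * (b 1 * c 2 - b 2 * c 1))
    + a 1 * (f 0 * (b 2 * c 3 - b 3 * c 2) - f 2 * (b 0 * c 3 - b 3 * c 0) + f 3 * (b 0 * c 2 - b 2 * c 0))
    + a 2 * (- f 0 * (b 1 * c 3 - b 3 * c 1) + f 1 * (b 0 * c 3 - b 3 * c 0) - f 3 * (b 0 * c 1 - b 1 * c 0))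
    + a 3 * (f 0 * (b 1 * c 2 - b 2 * c 1) - f 1 * (b 0 * c 2 - b 2 * c 0) + f 2 * (b 0 * c 1 - b 1 * c 0))
    := by
  simp [det4, Matrix.det_succ_row_zero, Fin.sum_univ_succ, Fin.succAbove, Matrix.submatrix]
  ring

lemma det4_sq_le {f a b c : R4} (hf : nsq f = 1) (hb : dot f b = 0) (hc : dot f c = 0) :
    det4 f a b c ^ 2 ≤ nsq a * wedgeSq b c := by
  rw [det4_eq]
  set X0 := (- f 1 * (b 2 * c 3 - b 3 * c 2) + f 2 * (b 1 * c 3 - b 3 * c 1) - f 3 * (b 1 * c 2 - b 2 * c 1)) with h0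
  set X1 := (f 0 * (b 2 * c 3 - b 3 * c 2) - f 2 * (b 0 * c 3 - b 3 * c 0) + f 3 * (b 0 * c 2 - b 2 * c 0)) with h1
  set X2 := (- f 0 * (b 1 * c 3 - b 3 * c 1) + f 1 * (b 0 * c 3 - b 3 * c 0) - f 3 * (b 0 * c 1 - b 1 * c 0)) with h2
  set X3 := (f 0 * (b 1 * c 2 - b 2 * c 1) - f 1 * (b 0 * c 2 - b 2 * c 0) + f 2 * (b 0 * c 1 - b 1 * c 0)) with h3
  have key : X0 ^ 2 + X1 ^ 2 + X2 ^ 2 + X3 ^ 2 = wedgeSq b c := by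
    have e : X0 ^ 2 + X1 ^ 2 + X2 ^ 2 + X3 ^ 2 = nsq f * (nsq b * nsq c - dot b c ^ 2)
       - dot f b * (dot f b * nsq c - dot b c * dot f c) + dot f c * (dot f b * dot b c - nsq b * dot f c) := by
      simp only [h0, h1, h2, h3, nsq, dot, Fin.sum_univ_four]
      ring
    rw [e, hf, hb, hc, wedgeSq]; ring
  have hn : nsq a = a 0 ^ 2 + a 1 ^ 2 + a 2 ^ 2 + a 3 ^ 2 := by
    simp only [nsq, dot, Fin.sum_univ_four]; ring
  rw [← key, hn]
  clear_value X0 X1 X2 X3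
  nlinarith [sq_nonneg (a 0 * X1 - a 1 * X0), sq_nonneg (a 0 * X2 - a 2 * X0), sq_nonneg (a 0 * X3 - a 3 * X0),
    sq_nonneg (a 1 * X2 - a 2 * X1), sq_nonneg (a 1 * X3 - a 3 * X1), sq_nonneg (a 2 * X3 - a 3 * X2)]

lemma det4_cyc (f a b c : R4) : det4 f a b c = det4 f b c a := by
  rw [det4_eq, det4_eq]; ring

lemma Nice.nsq_eq {φ : SkyrmeMap} (h : Nice φ) (x : R3) : nsq (φ.toFun x) = 1 := by
  rw [← h.sph x]; simp [nsq, dot, cu, sq]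
lemma Nice.dot_eq {φ : SkyrmeMap} (h : Nice φ) (x : R3) (i : Fin 3) : dot (φ.toFun x) (φ.pderiv i x) = 0 :=
  h.orth x i

lemma nsq_nonneg (u : R4) : 0 ≤ nsq u := by
  unfold nsq dot; exact Finset.sum_nonneg fun i _ => mul_self_nonneg _

lemma two_abs_le {t A B : ℝ} (hA : 0 ≤ A) (hB : 0 ≤ B) (h : t ^ 2 ≤ A * B) : 2 * |t| ≤ A + B := by
  have : (2 * |t|) ^ 2 ≤ (A + B) ^ 2 := by
    rw [mul_pow, sq_abs]; nlinarith [sq_nonneg (A - B)]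
  exact le_of_sq_le_sq₀ this (by positivity) where
  le_of_sq_le_sq₀ {a b : ℝ} (h : a ^ 2 ≤ b ^ 2) (hb : 0 ≤ b) : a ≤ b := abs_le_of_sq_le_sq' h hb |>.2

lemma wedgeSq_nonneg (u v : R4) : 0 ≤ wedgeSq u v := by
  unfold wedgeSq nsq dot
  have := Finset.sum_mul_sq_le_sq_mul_sq Finset.univ u v
  simp only [← sq]
  linarith

lemma wedgeSq_comm (u v : R4) : wedgeSq u v = wedgeSq v u := by
  unfold wedgeSq nsq dot
  simp only [Fin.sum_univ_four]; ring

lemma six_det {φ : SkyrmeMap} (h : Nice φ) (x : R3) : 6 * |detDen φ x| ≤ energyDensity φ x := by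
  set f := φ.toFun x with hf
  have hn := h.nsq_eq x
  have ho := h.dot_eq x
  set p := fun i => φ.pderiv i x with hp
  have h1 := two_abs_le (nsq_nonneg (p 0)) (wedgeSq_nonneg _ _) (det4_sq_le (a := p 0) hn (ho 1) (ho 2))
  have h2 := two_abs_le (nsq_nonneg (p 1)) (wedgeSq_nonneg _ _) (det4_sq_le (a := p 1) hn (ho 2) (ho 0))
  have h3 := two_abs_le (nsq_nonneg (p 2)) (wedgeSq_nonneg _ _) (det4_sq_le (a := p 2) hn (ho 0) (ho 1))
  rw [← det4_cyc] at h2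
  rw [← det4_cyc, ← det4_cyc] at h3
  have w := wedgeSq_nonneg
  have e : energyDensity φ x = (nsq (p 0) + nsq (p 1) + nsq (p 2)) + ((wedgeSq (p 0) (p 0) + wedgeSq (p 0) (p 1) +
    wedgeSq (p 0) (p 2)) + (wedgeSq (p 1) (p 0) + wedgeSq (p 1) (p 1) +
    wedgeSq (p 1) (p 2)) + (wedgeSq (p 2) (p 0) + wedgeSq (p 2) (p 1) +
    wedgeSq (p 2) (p 2))) := by
    simp only [energyDensity, gradSq, ASq, Fin.sum_univ_three, hp]
  have hd : detDen φ x = det4 f (p 0) (p 1) (p 2) := rfl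
  rw [hd, e]
  have := w (p 0) (p 0); have := w (p 0) (p 1); have := w (p 0) (p 2)
  have := w (p 1) (p 0); have := w (p 1) (p 1); have := w (p 1) (p 2)
  have := w (p 2) (p 0); have := w (p 2) (p 1); have := w (p 2) (p 2)
  linarith

/-- determinant with a general first column -/
def dT (φ : SkyrmeMap) (t : R4) (x : R3) : ℝ :=
  t 0 * cD φ 1 2 3 x - t 1 * cD φ 0 2 3 x + t 2 * cD φ 0 1 3 x - t 3 * cD φ 0 1 2 x

lemma det_dT (φ : SkyrmeMap) (x : R3) : detDen φ x = dT φ (φ.toFun x) x := by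
  simp only [detDen, det4_eq, dT, cD, cJ, crf, cr, cg, Fin.sum_univ_three, Fin.reduceAdd, zero_add, Fin.isValue]
  ring

lemma Nice.D_eq {φ : SkyrmeMap} (h : Nice φ) (x : R3) :
    cD φ 1 2 3 x = cu φ 0 x * detDen φ x ∧ cD φ 0 2 3 x = - (cu φ 1 x * detDen φ x) ∧
    cD φ 0 1 3 x = cu φ 2 x * detDen φ x ∧ cD φ 0 1 2 x = - (cu φ 3 x * detDen φ x) := by
  have hs := h.sph x
  have h0 := h.orth x 0
  have h1 := h.orth x 1
  have h2 := h.orth x 2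
  have key : ∀ a b : Fin 4, cu φ 0 x * cD φ 0 a b x + cu φ 1 x * cD φ 1 a b x + cu φ 2 x * cD φ 2 a b x
      + cu φ 3 x * cD φ 3 a b x = 0 := by
    intro a b
    simp only [cD, Fin.sum_univ_three]
    simp only [Fin.sum_univ_four] at h0 h1 h2
    linear_combination cJ φ a b 0 x * h0 + cJ φ a b 1 x * h1 + cJ φ a b 2 x * h2
  have alt : ∀ a b : Fin 4, cD φ a a b x = 0 ∧ cD φ b a b x = 0 := by
    intro a b
    simp only [cD, cJ, crf, cr, Fin.sum_univ_three, Fin.reduceAdd, zero_add, Fin.isValue]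
    constructor <;> ring
  have sw : ∀ a b c : Fin 4, cD φ b a c x = - cD φ a b c x ∧ cD φ c a b x = cD φ a b c x := by
    intro a b c
    simp only [cD, cJ, crf, cr, Fin.sum_univ_three, Fin.reduceAdd, zero_add, Fin.isValue]
    constructor <;> ring
  have e := det_dT φ x
  simp only [dT] at e
  change detDen φ x = cu φ 0 x * cD φ 1 2 3 x - cu φ 1 x * cD φ 0 2 3 x + cu φ 2 x * cD φ 0 1 3 x
    - cu φ 3 x * cD φ 0 1 2 x at e
  have k01 := key 0 1; have k02 := key 0 2; have k03 := key 0 3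
  have k12 := key 1 2; have k13 := key 1 3; have k23 := key 2 3
  rw [(alt 0 1).1, (alt 0 1).2, (sw 0 2 1).1, (sw 0 3 1).1] at k01
  rw [(alt 0 2).1, (alt 0 2).2] at k02
  rw [(alt 0 3).1, (alt 0 3).2] at k03
  rw [(alt 1 2).1, (alt 1 2).2] at k12
  rw [(alt 1 3).1, (alt 1 3).2] at k13
  rw [(alt 2 3).1, (alt 2 3).2] at k23
  have s1 := (sw 0 1 2).1; have s2 := (sw 0 1 2).2
  have s3 := (sw 0 1 3).1; have s4 := (sw 0 1 3).2
  have s5 := (sw 0 2 3).1; have s6 := (sw 0 2 3).2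
  have s7 := (sw 1 2 3).1; have s8 := (sw 1 2 3).2
  have s9 : cD φ 0 2 1 x = - cD φ 0 1 2 x := by
    simp only [cD, cJ, crf, cr, Fin.sum_univ_three, Fin.reduceAdd, zero_add, Fin.isValue]; ring
  have s10 : cD φ 0 3 1 x = - cD φ 0 1 3 x := by
    simp only [cD, cJ, crf, cr, Fin.sum_univ_three, Fin.reduceAdd, zero_add, Fin.isValue]; ring
  rw [s9, s10] at k01
  rw [s1, (sw 0 2 3).2.symm.symm] at k02
  rw [s3, s5] at k03
  rw [s8] at k12
  rw [s7] at k13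
  simp only [Fin.sum_univ_four] at hs
  refine ⟨?_, ?_, ?_, ?_⟩
  · rw [e]; linear_combination (-cD φ 1 2 3 x) * hs + cu φ 1 x * k23 - cu φ 2 x * k13 + cu φ 3 x * k12
  · rw [e]; linear_combination (-cD φ 0 2 3 x) * hs + cu φ 0 x * k23 - cu φ 2 x * k03 + cu φ 3 x * k02
  · rw [e]; linear_combination (-cD φ 0 1 3 x) * hs + cu φ 0 x * k13 - cu φ 1 x * k03 + cu φ 3 x * k01
  · rw [e]; linear_combination (-cD φ 0 1 2 x) * hs + cu φ 0 x * k12 - cu φ 1 x * k02 + cu φ 2 x * k01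

lemma had3 (u v w : Fin 3 → ℝ) : (∑ k, u k * cr v w k) ^ 2 ≤ (∑ k, u k ^ 2) * ((∑ k, v k ^ 2) * (∑ k, w k ^ 2)) := by
  have h1 := Finset.sum_mul_sq_le_sq_mul_sq Finset.univ u (cr v w)
  refine h1.trans ?_
  have : 0 ≤ ∑ k, u k ^ 2 := Finset.sum_nonneg fun i _ => sq_nonneg _
  gcongr
  simp only [cr, Fin.sum_univ_three, Fin.reduceAdd, zero_add, Fin.isValue]
  nlinarith [sq_nonneg (v 0 * w 0 + v 1 * w 1 + v 2 * w 2)]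

lemma D_pow4 (φ : SkyrmeMap) (a b c : Fin 4) (x : R3) : cD φ a b c x ^ 4 ≤ energyDensity φ x ^ 3 := by
  have e : cD φ a b c x ^ 2 = ∑ k, cJ φ b c k x * cr (fun k => cJ φ c a k x) (fun k => cJ φ a b k x) k := by
    simp only [cD, cJ, crf, cr, Fin.sum_univ_three, Fin.reduceAdd, zero_add, Fin.isValue]; ring
  have hJ : ∀ b c, ∑ k, cJ φ b c k x ^ 2 ≤ energyDensity φ x := by
    intro b c
    have h1 : ∑ k, cJ φ b c k x ^ 2 ≤ ∑ a, ∑ b, ∑ k, cJ φ a b k x ^ 2 :=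
      (Finset.single_le_sum (f := fun c => ∑ k, cJ φ b c k x ^ 2)
        (fun i _ => Finset.sum_nonneg fun i _ => sq_nonneg _) (Finset.mem_univ c)).trans
      (Finset.single_le_sum (f := fun a => ∑ b, ∑ k, cJ φ a b k x ^ 2)
        (fun i _ => Finset.sum_nonneg fun i _ => Finset.sum_nonneg fun i _ => sq_nonneg _) (Finset.mem_univ b))
    have := gradSq_nonneg φ x
    rw [energyDensity, ASq_eq]
    linarith
  have h := had3 (fun k => cJ φ b c k x) (fun k => cJ φ c a k x) (fun k => cJ φ a b k x)
  rw [← e] at h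
  have hE := dens_nonneg φ x
  have hp : ∀ b c, 0 ≤ ∑ k, cJ φ b c k x ^ 2 := fun b c => Finset.sum_nonneg fun i _ => sq_nonneg _
  calc cD φ a b c x ^ 4 = (cD φ a b c x ^ 2) ^ 2 := by ring
    _ ≤ _ := h
    _ ≤ energyDensity φ x * (energyDensity φ x * energyDensity φ x) := by
      have := hp b c; have := hp c a; have := hp a b
      gcongr <;> apply hJ
    _ = _ := by ring

lemma young4 {X t s lam : ℝ} (hs : 0 ≤ s) (hl : 0 < lam) (h : X ^ 4 ≤ s ^ 3) :
    |t * X| ≤ lam * s + (lam ^ 3)⁻¹ * t ^ 4 := by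
  rcases le_total (t ^ 4) (lam ^ 4 * s) with h1 | h1
  · have : |t * X| ≤ lam * s := by
      refine le_of_pow_le_pow_left₀ (n := 4) (by norm_num) (by positivity) ?_
      rw [pow_abs, abs_of_nonneg (by positivity), mul_pow, mul_pow]
      calc t ^ 4 * X ^ 4 ≤ (lam ^ 4 * s) * s ^ 3 := by gcongr
        _ = _ := by ring
    have : 0 ≤ (lam ^ 3)⁻¹ * t ^ 4 := by positivity
    linarith
  · have : |t * X| ≤ (lam ^ 3)⁻¹ * t ^ 4 := by
      have hs2 : s ≤ t ^ 4 / lam ^ 4 := by rw [le_div_iff₀ (by positivity)]; linarith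
      refine le_of_pow_le_pow_left₀ (n := 4) (by norm_num) (by positivity) ?_
      rw [pow_abs, abs_of_nonneg (by positivity), mul_pow]
      calc t ^ 4 * X ^ 4 ≤ t ^ 4 * (t ^ 4 / lam ^ 4) ^ 3 := by gcongr; exact h.trans (by gcongr)
        _ = _ := by field_simp
    have : 0 ≤ lam * s := by positivity
    linarith

lemma sq_lintegral_le' {α : Type*} [MeasurableSpace α] (μ : Measure α) [IsProbabilityMeasure μ] {F : α → ℝ≥0∞}
    (hF : AEMeasurable F μ) : (∫⁻ w, F w ∂μ) ^ 2 ≤ ∫⁻ w, F w ^ 2 ∂μ := by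
  have h := ENNReal.lintegral_mul_le_Lp_mul_Lq μ Real.HolderConjugate.two_two hF
    (aemeasurable_const (b := (1:ℝ≥0∞)))
  simp only [Pi.mul_apply, mul_one, ENNReal.one_rpow, lintegral_const, measure_univ] at h
  calc (∫⁻ w, F w ∂μ) ^ 2 ≤ ((∫⁻ w, F w ^ (2:ℝ) ∂μ) ^ (1 / (2:ℝ))) ^ 2 := by gcongr
    _ = ∫⁻ w, F w ^ 2 ∂μ := by
      rw [← ENNReal.rpow_natCast, ← ENNReal.rpow_mul]
      norm_num

lemma vec_eq_sum (z : R3) : z = ∑ i, z i • ee i := by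
  ext j; simp [ee, Pi.single_apply]

lemma fderiv_apply_sum (L : R3 →L[ℝ] ℝ) (z : R3) : L z = ∑ i, z i * L (ee i) := by
  conv_lhs => rw [vec_eq_sum z]
  rw [map_sum]
  exact Finset.sum_congr rfl fun i _ => by rw [map_smul, smul_eq_mul]

lemma sq_sum_le (z : R3) (a : Fin 3 → ℝ) : (∑ i, z i * a i) ^ 2 ≤ 3 * ‖z‖ ^ 2 * ∑ i, a i ^ 2 := by
  have h1 := Finset.sum_mul_sq_le_sq_mul_sq Finset.univ z a
  refine h1.trans ?_
  have h2 : ∀ i, z i ^ 2 ≤ ‖z‖ ^ 2 := fun i => by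
    have := norm_le_pi_norm z i
    rw [Real.norm_eq_abs] at this
    rw [← sq_abs]; gcongr
  have : ∑ i, z i ^ 2 ≤ 3 * ‖z‖ ^ 2 := by
    rw [Fin.sum_univ_three]; linarith [h2 0, h2 1, h2 2]
  gcongr

lemma ball_shift {F : R3 → ℝ≥0∞} {y z : R3} {r r' : ℝ} (h : r + ‖z‖ ≤ r') :
    ∫⁻ x in Metric.closedBall y r, F (x - z) ≤ ∫⁻ x in Metric.closedBall y r', F x := by
  rw [← lintegral_indicator Metric.isClosed_closedBall.measurableSet,
    ← lintegral_indicator Metric.isClosed_closedBall.measurableSet,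
    ← lintegral_sub_right_eq_self ((Metric.closedBall y r').indicator F) z]
  refine lintegral_mono fun x => ?_
  by_cases hx : x ∈ Metric.closedBall y r
  · have hx' : x - z ∈ Metric.closedBall y r' := by
      rw [Metric.mem_closedBall, dist_eq_norm] at hx ⊢
      have : x - z - y = (x - y) - z := by abel
      rw [this]
      exact (norm_sub_le _ _).trans (by linarith)
    rw [Set.indicator_of_mem hx, Set.indicator_of_mem hx']
  · rw [Set.indicator_of_notMem hx]; exact zero_le

lemma smooth_transl {v : R3 → ℝ} (hv : ContDiff ℝ (⊤ : ℕ∞) v) (y z : R3) {r r' : ℝ} (h : r + ‖z‖ ≤ r') :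
    ∫⁻ x in Metric.closedBall y r, ‖v (x - z) - v x‖ₑ ^ 2 ≤
      ENNReal.ofReal (3 * ‖z‖ ^ 2) * ∫⁻ x in Metric.closedBall y r',
        ENNReal.ofReal (∑ i, fderiv ℝ v x (ee i) ^ 2) := by
  set G : R3 → ℝ := fun x => ∑ i, fderiv ℝ v x (ee i) ^ 2 with hG
  have hGc : Continuous G := by
    have : ∀ i, Continuous fun x => fderiv ℝ v x (ee i) := fun i =>
      (hv.continuous_fderiv (by simp)).clm_apply continuous_const
    fun_prop
  have hfc : Continuous (fderiv ℝ v) := hv.continuous_fderiv (by simp)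
  let μ : Measure ℝ := volume.restrict (Set.Ioc 0 1)
  have hμ : IsProbabilityMeasure μ := ⟨by simp [μ]⟩
  have hpt : ∀ x, ‖v (x - z) - v x‖ₑ ^ 2 ≤ ∫⁻ t, ENNReal.ofReal (3 * ‖z‖ ^ 2) * ENNReal.ofReal (G (x - t • z)) ∂μ := by
    intro x
    have hd : ∀ t : ℝ, HasDerivAt (fun t : ℝ => v (x - t • z)) (fderiv ℝ v (x - t • z) (-z)) t := by
      intro t
      have h1 : HasDerivAt (fun t : ℝ => x - t • z) (-z) t := by
        simpa using ((hasDerivAt_id t).smul_const z).const_sub x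
      exact ((hv.differentiable (by simp) _).hasFDerivAt).comp_hasDerivAt t h1
    have hc : Continuous fun t : ℝ => fderiv ℝ v (x - t • z) (-z) :=
      (hfc.comp (by fun_prop)).clm_apply continuous_const
    have hF := intervalIntegral.integral_eq_sub_of_hasDerivAt (a := 0) (b := 1) (fun t _ => hd t)
      (hc.intervalIntegrable 0 1)
    simp only [one_smul, zero_smul, sub_zero] at hF
    rw [← hF, intervalIntegral.integral_of_le zero_le_one]
    refine le_trans ?_ ((sq_lintegral_le' μ (F := fun t => ‖fderiv ℝ v (x - t • z) (-z)‖ₑ)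
      hc.measurable.enorm.aemeasurable).trans ?_)
    · gcongr; exact enorm_integral_le_lintegral_enorm _
    · refine lintegral_mono fun t => ?_
      rw [← ENNReal.ofReal_mul (by positivity), Real.enorm_eq_ofReal_abs, ← ENNReal.ofReal_pow (abs_nonneg _), sq_abs]
      apply ENNReal.ofReal_le_ofReal
      rw [fderiv_apply_sum]
      have := sq_sum_le (-z) (fun i => fderiv ℝ v (x - t • z) (ee i))
      rwa [norm_neg] at this
  calc _ ≤ ∫⁻ x in Metric.closedBall y r, (∫⁻ t, ENNReal.ofReal (3 * ‖z‖ ^ 2) * ENNReal.ofReal (G (x - t • z)) ∂μ) :=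
        lintegral_mono hpt
    _ = ∫⁻ t, (∫⁻ x in Metric.closedBall y r, ENNReal.ofReal (3 * ‖z‖ ^ 2) * ENNReal.ofReal (G (x - t • z))) ∂μ := by
        apply lintegral_lintegral_swap
        have : Continuous (fun p : R3 × ℝ => G (p.1 - p.2 • z)) := hGc.comp (by fun_prop)
        have := this.measurable
        exact (this.ennreal_ofReal.const_mul _).aemeasurable
    _ ≤ ∫⁻ t, (ENNReal.ofReal (3 * ‖z‖ ^ 2) * ∫⁻ x in Metric.closedBall y r', ENNReal.ofReal (G x)) ∂μ := by
        refine setLIntegral_mono' measurableSet_Ioc fun t ht => ?_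
        rw [lintegral_const_mul _ (by
          have : Continuous (fun x : R3 => G (x - t • z)) := hGc.comp (by fun_prop)
          exact this.measurable.ennreal_ofReal)]
        refine mul_le_mul' le_rfl (ball_shift (F := fun x => ENNReal.ofReal (G x)) ?_)
        rw [norm_smul, Real.norm_eq_abs, abs_of_pos ht.1]
        have := ht.2
        nlinarith [norm_nonneg z]
    _ = _ := by rw [lintegral_const, measure_univ, mul_one]

lemma L2_sq_tendsto {ι : Type*} {l : Filter ι} {f : ι → R3 → ℝ} {f0 : R3 → ℝ}
    (hf0 : MemLp f0 2 volume) (hf : ∀ᶠ s in l, MemLp (f s) 2 volume)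
    (hlim : Tendsto (fun s => ∫ x, (f s x - f0 x) ^ 2) l (𝓝 0)) (S : Set R3) :
    Tendsto (fun s => ∫ x in S, f s x ^ 2) l (𝓝 (∫ x in S, f0 x ^ 2)) := by
  have hb : Tendsto (fun s => (∫ x, (f s x - f0 x) ^ 2) + 2 * (√(∫ x in S, f0 x ^ 2) * √(∫ x, (f s x - f0 x) ^ 2)))
      l (𝓝 0) := by
    have := hlim.add ((hlim.sqrt.const_mul (√(∫ x in S, f0 x ^ 2))).const_mul 2)
    simpa using this
  rw [tendsto_iff_norm_sub_tendsto_zero]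
  refine squeeze_zero' (Eventually.of_forall fun _ => norm_nonneg _) ?_ hb
  filter_upwards [hf] with s hs
  have h0 := hf0.restrict S
  have h1 := hs.restrict S
  have hd := subL2 h1 h0
  have hd' := (subL2 hs hf0).integrable_sq
  have e : (∫ x in S, f s x ^ 2) - ∫ x in S, f0 x ^ 2 = (∫ x in S, (f s x - f0 x) ^ 2) +
      2 * ∫ x in S, f0 x * (f s x - f0 x) := by
    rw [← integral_const_mul, ← integral_add hd.integrable_sq ((mulL2 h0 hd).const_mul 2),
      ← integral_sub h1.integrable_sq h0.integrable_sq]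
    congr 1; ext x; ring
  have hle : ∫ x in S, (f s x - f0 x) ^ 2 ≤ ∫ x, (f s x - f0 x) ^ 2 :=
    setIntegral_le_integral hd' (Eventually.of_forall fun x => sq_nonneg _)
  rw [e]
  refine (norm_add_le _ _).trans ?_
  rw [Real.norm_eq_abs, abs_of_nonneg (integral_nonneg fun x => sq_nonneg _), norm_mul,
    Real.norm_eq_abs, Real.norm_eq_abs, abs_two]
  have := cs h0 hd
  gcongr
  refine this.trans ?_
  gcongr

lemma W.transl_est {u g} (h : W u g) (y z : R3) (r : ℝ) (hz : ‖z‖ ≤ 1) :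
    ∫⁻ x in Metric.closedBall y r, ‖u (x - z) - u x‖ₑ ^ 2 ≤
      ENNReal.ofReal (3 * ‖z‖ ^ 2 * ∑ i, ∫ x in Metric.closedBall y (r+1), g i x ^ 2) := by
  obtain ⟨C, hC⟩ := h.bdd
  have hu := h.locInt
  have hae := mol_tendsto_ae hu
  have hae2 : ∀ᵐ x, Tendsto (fun s => mol s u (x - z)) (𝓝[>] 0) (𝓝 (u (x - z))) :=
    (measurePreserving_sub_right (volume : Measure R3) z).quasiMeasurePreserving.ae hae
  have hlim : Tendsto (fun s => ∫⁻ x in Metric.closedBall y r, ‖mol s u (x - z) - mol s u x‖ₑ ^ 2) (𝓝[>] 0)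
      (𝓝 (∫⁻ x in Metric.closedBall y r, ‖u (x - z) - u x‖ₑ ^ 2)) := by
    refine tendsto_lintegral_filter_of_dominated_convergence (fun _ => ENNReal.ofReal ((2 * C) ^ 2)) ?_ ?_ ?_ ?_
    · filter_upwards [self_mem_nhdsWithin] with s hs
      have := (mol_contDiff hs hu).continuous
      have h2 : Continuous fun x => mol s u (x - z) - mol s u x := by fun_prop
      exact h2.measurable.enorm.pow_const 2
    · refine Eventually.of_forall fun s => Eventually.of_forall fun x => ?_
      rw [Real.enorm_eq_ofReal_abs, ← ENNReal.ofReal_pow (abs_nonneg _)]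
      apply ENNReal.ofReal_le_ofReal
      have h1 := mol_bdd hC s (x - z)
      have h2 := mol_bdd hC s x
      have h3 := abs_sub (mol s u (x - z)) (mol s u x)
      gcongr; linarith
    · rw [lintegral_const]
      exact ENNReal.mul_ne_top (by simp) (by simpa using (isCompact_closedBall y r).measure_lt_top.ne)
    · filter_upwards [ae_restrict_of_ae hae, ae_restrict_of_ae hae2] with x h1 h2
      exact ((ENNReal.continuous_pow 2).tendsto _).comp ((h2.sub h1).enorm)
  have hR : Tendsto (fun s => ENNReal.ofReal (3 * ‖z‖ ^ 2 * ∑ i, ∫ x in Metric.closedBall y (r+1), mol s (g i) x ^ 2))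
      (𝓝[>] 0) (𝓝 (ENNReal.ofReal (3 * ‖z‖ ^ 2 * ∑ i, ∫ x in Metric.closedBall y (r+1), g i x ^ 2))) := by
    refine ENNReal.tendsto_ofReal ((tendsto_finsetSum _ fun i _ => ?_).const_mul _)
    have := mol_L2 (h.gmeas i) (h.gL2 i)
    exact L2_sq_tendsto (h.gL2 i) (by filter_upwards [self_mem_nhdsWithin] with s hs using this.1 s hs) this.2 _
  refine le_of_tendsto_of_tendsto hlim hR ?_
  filter_upwards [self_mem_nhdsWithin] with s hs
  refine (smooth_transl (mol_contDiff hs hu) y z (r := r) (r' := r+1) (by linarith)).trans ?_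
  simp_rw [h.mol_deriv hs]
  have hi : ∀ i, Integrable (fun x => mol s (g i) x ^ 2) (volume.restrict (Metric.closedBall y (r+1))) := fun i =>
    (((mol_L2 (h.gmeas i) (h.gL2 i)).1 s hs).integrable_sq).restrict
  rw [← ofReal_integral_eq_lintegral_ofReal (integrable_finsetSum _ fun i _ => hi i)
    (Eventually.of_forall fun x => Finset.sum_nonneg fun i _ => sq_nonneg _), integral_finsetSum _ fun i _ => hi i,
    ← ENNReal.ofReal_mul (by positivity)]

/-- local Rellich estimate -/
lemma W.rel_est {u g} (h : W u g) (y : R3) (r : ℝ) {δ : ℝ} (hδ : 0 < δ) (hδ1 : δ ≤ 1) :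
    ∫ x in Metric.closedBall y r, (mol δ u x - u x) ^ 2 ≤
      3 * δ ^ 2 * ∑ i, ∫ x in Metric.closedBall y (r+1), g i x ^ 2 := by
  obtain ⟨C, hC⟩ := h.bdd
  have hS : 0 ≤ ∑ i, ∫ x in Metric.closedBall y (r+1), g i x ^ 2 :=
    Finset.sum_nonneg fun i _ => integral_nonneg fun x => sq_nonneg _
  have hb := jensen_bound h.meas h.locInt hδ (Metric.closedBall y r)
    (ENNReal.ofReal (3 * δ ^ 2 * ∑ i, ∫ x in Metric.closedBall y (r+1), g i x ^ 2)) (fun w hw => by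
      have hn : ‖δ • w‖ ≤ δ := by
        rw [norm_smul, Real.norm_eq_abs, abs_of_pos hδ]; nlinarith
      refine (h.transl_est y (δ • w) r (hn.trans hδ1)).trans ?_
      apply ENNReal.ofReal_le_ofReal
      gcongr)
  have hm : Measurable (fun x => mol δ u x - u x) := ((mol_contDiff hδ h.locInt).continuous.measurable).sub h.meas
  have hL : MemLp (fun x => mol δ u x - u x) 2 (volume.restrict (Metric.closedBall y r)) :=
    memLp_of_lint hm.aestronglyMeasurable (hb.trans_lt ENNReal.ofReal_lt_top)
  rw [lint_sq_real hL, ENNReal.ofReal_le_ofReal_iff (by positivity)] at hb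
  exact hb

/-- weak convergence in L2 along an ultrafilter -/
def wL2 (U : Ultrafilter ℕ) (f : ℕ → R3 → ℝ) (f0 : R3 → ℝ) : Prop :=
  MemLp f0 2 volume ∧ ∀ h : R3 → ℝ, MemLp h 2 volume →
    Tendsto (fun n => ∫ x, h x * f n x) U (𝓝 (∫ x, h x * f0 x))

/-- strong local convergence -/
def sL2 (U : Ultrafilter ℕ) (f : ℕ → R3 → ℝ) (f0 : R3 → ℝ) : Prop :=
  ∀ r : ℝ, Tendsto (fun n => ∫ x in Metric.closedBall (0:R3) r, (f n x - f0 x) ^ 2) U (𝓝 0)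

lemma exists_wL2 (U : Ultrafilter ℕ) {f : ℕ → R3 → ℝ} (hf : ∀ n, MemLp (f n) 2 volume) {C : ℝ}
    (hC : ∀ n, ∫ x, f n x ^ 2 ≤ C) : ∃ f0, Measurable f0 ∧ wL2 U f f0 := by
  let H := Lp ℝ 2 (volume : Measure R3)
  let F : ℕ → H := fun n => (hf n).toLp
  have hin : ∀ n (h : R3 → ℝ) (hh : MemLp h 2 volume), inner ℝ (F n) (hh.toLp) = ∫ x, h x * f n x := by
    intro n h hh
    rw [L2.inner_def]
    apply integral_congr_ae
    filter_upwards [(hf n).coeFn_toLp, hh.coeFn_toLp] with x h1 h2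
    simp only [F, h1, h2]; simp
  have hn : ∀ n, ‖F n‖ ≤ √C := by
    intro n
    apply Real.le_sqrt_of_sq_le
    rw [← real_inner_self_eq_norm_sq, hin]
    simpa [sq] using hC n
  let T : ℕ → WeakDual ℝ H := fun n => StrongDual.toWeakDual (InnerProductSpace.toDual ℝ H (F n))
  have hK := WeakDual.isCompact_closedBall (𝕜 := ℝ) (0 : StrongDual ℝ H) (√C)
  obtain ⟨x, hx, hle⟩ := hK.ultrafilter_le_nhds (U.map T) (by
    rw [Ultrafilter.coe_map, le_principal_iff, mem_map]
    refine Filter.univ_mem' fun n => ?_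
    simp only [T, Set.mem_preimage, Metric.mem_closedBall, dist_zero_right]
    refine le_trans (le_of_eq ?_) (hn n)
    exact (InnerProductSpace.toDual ℝ H).norm_map (F n))
  let G : H := (InnerProductSpace.toDual ℝ H).symm (WeakDual.toStrongDual x)
  have hGm := (Lp.aestronglyMeasurable G)
  have hGL : MemLp (hGm.mk G) 2 volume := (memLp_congr_ae hGm.ae_eq_mk).1 (Lp.memLp G)
  refine ⟨hGm.mk G, hGm.stronglyMeasurable_mk.measurable, hGL, fun h hh => ?_⟩
  have ht : Tendsto (fun n => T n (hh.toLp)) U (𝓝 (x hh.toLp)) :=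
    ((WeakDual.eval_continuous (hh.toLp : H)).tendsto x).comp hle
  have e1 : ∀ n, T n (hh.toLp) = ∫ x, h x * f n x := fun n => hin n h hh
  have e2 : x hh.toLp = ∫ x, h x * hGm.mk G x := by
    have : x hh.toLp = inner ℝ G hh.toLp := by
      rw [← InnerProductSpace.toDual_apply_apply]
      simp only [G, LinearIsometryEquiv.apply_symm_apply]; rfl
    rw [this, L2.inner_def]
    apply integral_congr_ae
    filter_upwards [hGm.ae_eq_mk, hh.coeFn_toLp] with x h1 h2
    simp only [h2, ← h1]; simp
  rw [← e2]
  simpa only [e1] using ht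

def ww (x : R3) : ℝ := (1 + ‖x‖) ^ (-2 : ℝ)
lemma ww_pos (x : R3) : 0 < ww x := Real.rpow_pos_of_pos (by positivity) _
lemma ww_cont : Continuous ww := by
  unfold ww
  refine Continuous.rpow_const (by fun_prop) fun x => Or.inl (by positivity)
lemma ww_le (x : R3) : ww x ≤ 1 := by
  unfold ww
  exact Real.rpow_le_one_of_one_le_of_nonpos (by linarith [norm_nonneg x]) (by norm_num)
lemma ww_L2 : MemLp ww 2 volume := by
  rw [memLp_two_iff_integrable_sq ww_cont.aestronglyMeasurable]
  have := integrable_one_add_norm (E := R3) (μ := volume) (r := 4) (by simp; norm_num)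
  refine this.congr (Eventually.of_forall fun x => ?_)
  simp only [ww]
  rw [← Real.rpow_natCast, ← Real.rpow_mul (by positivity)]
  norm_num

/-- weak limits of bounded functions -/
lemma exists_wbd (U : Ultrafilter ℕ) {f : ℕ → R3 → ℝ} (hf : ∀ n, Measurable (f n))
    (hb : ∀ n x, |f n x| ≤ 1) : ∃ f0, Measurable f0 ∧ LocallyIntegrable f0 volume ∧
      ∀ h : R3 → ℝ, Continuous h → HasCompactSupport h →
        Tendsto (fun n => ∫ x, h x * f n x) U (𝓝 (∫ x, h x * f0 x)) := by
  have hL : ∀ n, MemLp (fun x => f n x * ww x) 2 volume := fun n => bddL2 (hf n) (hb n) ww_L2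
  obtain ⟨F, hFm, hF2, hF⟩ := exists_wL2 U hL (C := ∫ x, ww x ^ 2) (fun n => by
    refine integral_mono (hL n).integrable_sq ww_L2.integrable_sq fun x => ?_
    have h1 := hb n x
    have : f n x ^ 2 ≤ 1 := by rw [← sq_abs]; exact pow_le_one₀ (abs_nonneg _) h1
    simp only [mul_pow]
    nlinarith [sq_nonneg (ww x)])
  have hwi : Continuous fun x => (ww x)⁻¹ := ww_cont.inv₀ fun x => (ww_pos x).ne'
  refine ⟨fun x => (ww x)⁻¹ * F x, hwi.measurable.mul hFm, ?_, fun h hc hs => ?_⟩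
  · exact (locInt_of_L2 hF2).continuous_smul hwi
  · have hk : MemLp (fun x => h x * (ww x)⁻¹) 2 volume :=
      (hc.mul hwi).memLp_of_hasCompactSupport hs.mul_right
    have := hF _ hk
    have e1 : ∀ n x, h x * (ww x)⁻¹ * (f n x * ww x) = h x * f n x := fun n x => by
      field_simp [(ww_pos x).ne']
    simp only [e1, mul_assoc] at this ⊢
    simpa only [← mul_assoc, e1] using this

lemma mol_lip {δ : ℝ} (hδ : 0 < δ) : ∃ L, 0 ≤ L ∧ ∀ u : R3 → ℝ, Measurable u → (∀ x, |u x| ≤ 1) →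
    ∀ x y, |mol δ u x - mol δ u y| ≤ L * ‖x - y‖ := by
  have hkt : IsTestFun (kr δ) := ⟨kr_contDiff δ, kr_hcs hδ⟩
  let A : Fin 3 → ℝ := fun i => ∫ z, |fderiv ℝ (kr δ) z (ee i)|
  have hA : ∀ i, 0 ≤ A i := fun i => integral_nonneg fun z => abs_nonneg _
  refine ⟨∑ i, A i, Finset.sum_nonneg fun i _ => hA i, fun u hu hb x y => ?_⟩
  have hl := locInt_of_bdd hu ⟨1, hb⟩
  have hd : Differentiable ℝ (mol δ u) := (mol_contDiff hδ hl).differentiable (by simp)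
  have h1 : ∀ x i, |fderiv ℝ (mol δ u) x (ee i)| ≤ A i := by
    intro x i
    rw [mol_fderiv hδ hl]
    have hi := (hkt.d (ee i)).integrable.norm
    calc _ ≤ ∫ y, |fderiv ℝ (kr δ) (x - y) (ee i)| := by
          rw [← Real.norm_eq_abs]
          refine norm_integral_le_of_norm_le (g := fun y => |fderiv ℝ (kr δ) (x - y) (ee i)|)
            (hi.comp_sub_left x) (Eventually.of_forall fun y => ?_)
          rw [norm_mul]
          exact mul_le_of_le_one_right (norm_nonneg _) (hb y)
      _ = A i := integral_sub_left_eq_self (fun z => |fderiv ℝ (kr δ) z (ee i)|) volume x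
  have h2 : ∀ x, ‖fderiv ℝ (mol δ u) x‖ ≤ ∑ i, A i := by
    intro x
    refine ContinuousLinearMap.opNorm_le_bound _ (Finset.sum_nonneg fun i _ => hA i) fun v => ?_
    rw [fderiv_apply_sum, Finset.sum_mul]
    refine (norm_sum_le _ _).trans (Finset.sum_le_sum fun i _ => ?_)
    rw [norm_mul, mul_comm]
    exact mul_le_mul (h1 x i) (norm_le_pi_norm v i) (norm_nonneg _) (hA i)
  have := Convex.norm_image_sub_le_of_norm_fderiv_le (𝕜 := ℝ) (f := mol δ u) (s := Set.univ) (x := y) (y := x)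
    (fun x _ => hd x) (fun x _ => h2 x) convex_univ trivial trivial
  exact this

lemma clamp_lim (U : Ultrafilter ℕ) {u : ℕ → R3 → ℝ} (hu : ∀ n, Measurable (u n))
    (hb : ∀ n x, |u n x| ≤ 1) : ∃ u0, Measurable u0 ∧ (∀ x, |u0 x| ≤ 1) ∧
      ∀ h : R3 → ℝ, Continuous h → HasCompactSupport h →
        Tendsto (fun n => ∫ x, h x * u n x) U (𝓝 (∫ x, h x * u0 x)) := by
  obtain ⟨f0, hm, hl, hlim⟩ := exists_wbd U hu hb
  have hae : ∀ᵐ x, |f0 x| ≤ 1 := by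
    filter_upwards [mol_tendsto_ae hl] with x hx
    refine le_of_tendsto hx.abs ?_
    filter_upwards [self_mem_nhdsWithin] with s hs
    rw [mol_eq_kr hs]
    have h1 := hlim _ (kr_test s hs x).cont (kr_test s hs x).2
    refine le_of_tendsto h1.abs (Eventually.of_forall fun n => ?_)
    rw [← mol_eq_kr hs]
    exact mol_bdd (hb n) s x
  refine ⟨fun x => max (-1) (min 1 (f0 x)), by fun_prop, fun x => ?_, fun h hc hs => ?_⟩
  · rw [abs_le]; constructor
    · exact le_max_left _ _
    · exact max_le (by norm_num) (min_le_left _ _)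
  · have : ∫ x, h x * max (-1) (min 1 (f0 x)) = ∫ x, h x * f0 x := by
      apply integral_congr_ae
      filter_upwards [hae] with x hx
      have := abs_le.1 hx
      rw [min_eq_right this.2, max_eq_right this.1]
    rw [this]; exact hlim h hc hs

/-- pointwise to uniform on compact sets -/
lemma mol_unif (U : Ultrafilter ℕ) {u : ℕ → R3 → ℝ} {u0 : R3 → ℝ} (hu : ∀ n, Measurable (u n))
    (hb : ∀ n x, |u n x| ≤ 1) (hu0 : Measurable u0) (hb0 : ∀ x, |u0 x| ≤ 1)
    (hlim : ∀ h : R3 → ℝ, Continuous h → HasCompactSupport h →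
        Tendsto (fun n => ∫ x, h x * u n x) U (𝓝 (∫ x, h x * u0 x))) {δ : ℝ} (hδ : 0 < δ) {K : Set R3}
    (hK : IsCompact K) {ε : ℝ} (hε : 0 < ε) : ∀ᶠ n in (U : Filter ℕ), ∀ x ∈ K, |mol δ (u n) x - mol δ u0 x| ≤ ε := by
  obtain ⟨L, hL0, hL⟩ := mol_lip hδ
  have hη : 0 < ε / (4 * (L + 1)) := by positivity
  obtain ⟨t, htK, htf, hcov⟩ := hK.finite_cover_balls hη
  have hp : ∀ p, Tendsto (fun n => mol δ (u n) p) U (𝓝 (mol δ u0 p)) := by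
    intro p
    simp_rw [mol_eq_kr hδ]
    exact hlim _ (kr_test δ hδ p).cont (kr_test δ hδ p).2
  have hev : ∀ᶠ n in (U : Filter ℕ), ∀ p ∈ t, |mol δ (u n) p - mol δ u0 p| < ε / 2 := by
    rw [eventually_all_finite htf]
    intro p _
    have := (Metric.tendsto_nhds.1 (hp p)) (ε / 2) (by positivity)
    simpa only [Real.dist_eq] using this
  filter_upwards [hev] with n hn x hx
  obtain ⟨p, hpt, hxp⟩ := Set.mem_iUnion₂.1 (hcov hx)
  rw [Metric.mem_ball, dist_eq_norm] at hxp
  have h1 := hL (u n) (hu n) (hb n) x p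
  have h2 := hL u0 hu0 hb0 x p
  have h3 := hn p hpt
  have h4 : L * ‖x - p‖ ≤ ε / 4 := by
    calc L * ‖x - p‖ ≤ (L + 1) * (ε / (4 * (L + 1))) := by
          apply mul_le_mul (by linarith) hxp.le (norm_nonneg _) (by linarith)
      _ = ε / 4 := by field_simp
  rw [abs_le] at *
  rw [abs_lt] at h3
  constructor <;> linarith [h1.1, h1.2, h2.1, h2.2, h3.1, h3.2]

lemma mol_loc_tendsto {u : R3 → ℝ} (hu : Measurable u) (hb : ∀ x, |u x| ≤ 1) (y : R3) (r : ℝ) :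
    Tendsto (fun δ => ∫ x in Metric.closedBall y r, (mol δ u x - u x) ^ 2) (𝓝[>] 0) (𝓝 0) := by
  have hl := locInt_of_bdd hu ⟨1, hb⟩
  have h0 : (0:ℝ) = ∫ x in Metric.closedBall y r, (0:ℝ) := by simp
  suffices h : Tendsto (fun δ => ∫ x in Metric.closedBall y r, (mol δ u x - u x) ^ 2) (𝓝[>] 0)
      (𝓝 (∫ x in Metric.closedBall y r, (0:ℝ))) by rwa [← h0] at h
  refine tendsto_integral_filter_of_dominated_convergence (fun _ => 4) ?_ ?_ ?_ ?_
  · filter_upwards [self_mem_nhdsWithin] with s hs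
    exact (((mol_contDiff hs hl).continuous.measurable.sub hu).pow_const 2).aestronglyMeasurable
  · refine Eventually.of_forall fun s => Eventually.of_forall fun x => ?_
    have h1 := abs_le.1 (mol_bdd hb s x)
    have h2 := abs_le.1 (hb x)
    rw [Real.norm_eq_abs, abs_of_nonneg (sq_nonneg _)]
    nlinarith
  · exact integrableOn_const (isCompact_closedBall y r).measure_lt_top.ne
  · filter_upwards [ae_restrict_of_ae (mol_tendsto_ae hl)] with x hx
    have := (hx.sub_const (u x)).pow 2
    simpa using this

lemma sq3 (a b c : ℝ) : (a + b + c) ^ 2 ≤ 3 * (a ^ 2 + b ^ 2 + c ^ 2) := by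
  nlinarith [sq_nonneg (a - b), sq_nonneg (b - c), sq_nonneg (a - c)]

lemma bddsq_int {u : R3 → ℝ} {C : ℝ} (hu : Measurable u) (hb : ∀ x, |u x| ≤ C) (y : R3) (r : ℝ) :
    IntegrableOn (fun x => u x ^ 2) (Metric.closedBall y r) volume := by
  refine Integrable.mono' (integrableOn_const (C := C ^ 2) (isCompact_closedBall y r).measure_lt_top.ne)
    (hu.pow_const 2).aestronglyMeasurable (Eventually.of_forall fun x => ?_)
  rw [Real.norm_eq_abs, abs_of_nonneg (sq_nonneg _), ← sq_abs]
  have := hb x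
  gcongr

lemma rellich (U : Ultrafilter ℕ) {u : ℕ → R3 → ℝ} {g : ℕ → Fin 3 → R3 → ℝ} (hW : ∀ n, W (u n) (g n))
    (hb : ∀ n x, |u n x| ≤ 1) {E : ℝ} (hE : ∀ n i, ∫ x, g n i x ^ 2 ≤ E) {u0 : R3 → ℝ}
    (hu0 : Measurable u0) (hb0 : ∀ x, |u0 x| ≤ 1)
    (hlim : ∀ h : R3 → ℝ, Continuous h → HasCompactSupport h →
        Tendsto (fun n => ∫ x, h x * u n x) U (𝓝 (∫ x, h x * u0 x))) : sL2 U u u0 := by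
  intro r
  have hE0 : 0 ≤ E := (integral_nonneg fun x => sq_nonneg _).trans (hE 0 0)
  set K := Metric.closedBall (0:R3) r
  have hKc : IsCompact K := isCompact_closedBall _ _
  rw [Metric.tendsto_nhds]
  intro ε hε
  have e1 : ∀ᶠ δ : ℝ in 𝓝[>] 0, δ ≤ 1 ∧ 27 * δ ^ 2 * E < ε / 4 := by
    have h1 : ∀ᶠ δ : ℝ in 𝓝 0, δ < 1 := gt_mem_nhds one_pos
    have h2 : Tendsto (fun δ : ℝ => 27 * δ ^ 2 * E) (𝓝 0) (𝓝 0) := by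
      have : Continuous fun δ : ℝ => 27 * δ ^ 2 * E := by fun_prop
      simpa using this.tendsto 0
    have h3 := h2.eventually (gt_mem_nhds (show (0:ℝ) < ε / 4 by positivity))
    filter_upwards [nhdsWithin_le_nhds h1, nhdsWithin_le_nhds h3] with δ a b using ⟨a.le, b⟩
  have e2 : ∀ᶠ δ : ℝ in 𝓝[>] 0, ∫ x in K, (mol δ u0 x - u0 x) ^ 2 < ε / 12 :=
    (mol_loc_tendsto hu0 hb0 0 r).eventually (gt_mem_nhds (by positivity))
  obtain ⟨δ, ⟨⟨hδ1, hδ2⟩, hδ3⟩, hδ0⟩ := ((e1.and e2).and self_mem_nhdsWithin).exists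
  replace hδ0 : 0 < δ := hδ0
  set V := volume.real K
  have hV : 0 ≤ V := measureReal_nonneg
  have hη : 0 < √(ε / (12 * (V + 1))) := by positivity
  filter_upwards [mol_unif U (fun n => (hW n).meas) hb hu0 hb0 hlim hδ0 hKc hη] with n hn
  rw [Real.dist_eq, sub_zero, abs_of_nonneg (integral_nonneg fun x => sq_nonneg _)]
  have m0 : Measurable (mol δ u0) := (mol_contDiff hδ0 (locInt_of_bdd hu0 ⟨1, hb0⟩)).continuous.measurable
  have mn : Measurable (mol δ (u n)) := (mol_contDiff hδ0 (hW n).locInt).continuous.measurable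
  have un := (hW n).meas
  have bd : ∀ {f g : R3 → ℝ}, (∀ x, |f x| ≤ 1) → (∀ x, |g x| ≤ 1) → ∀ x, |f x - g x| ≤ 2 := fun hf hg x => by
    have h1 := abs_le.1 (hf x); have h2 := abs_le.1 (hg x)
    rw [abs_le]; constructor <;> linarith
  have b0 := mol_bdd hb0 δ
  have bn := mol_bdd (hb n) δ
  have i1 : IntegrableOn (fun x => (mol δ (u n) x - u n x) ^ 2) K volume :=
    bddsq_int (mn.sub un) (bd bn (hb n)) _ _
  have i2 : IntegrableOn (fun x => (mol δ (u n) x - mol δ u0 x) ^ 2) K volume :=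
    bddsq_int (mn.sub m0) (bd bn b0) _ _
  have i3 : IntegrableOn (fun x => (mol δ u0 x - u0 x) ^ 2) K volume :=
    bddsq_int (m0.sub hu0) (bd b0 hb0) _ _
  have hle : ∫ x in K, (u n x - u0 x) ^ 2 ≤ ∫ x in K, 3 * ((mol δ (u n) x - u n x) ^ 2 +
      (mol δ (u n) x - mol δ u0 x) ^ 2 + (mol δ u0 x - u0 x) ^ 2) := by
    refine integral_mono (bddsq_int (un.sub hu0) (bd (hb n) hb0) _ _) (((i1.add i2).add i3).const_mul 3) fun x => ?_
    have := sq3 (-(mol δ (u n) x - u n x)) (mol δ (u n) x - mol δ u0 x) (mol δ u0 x - u0 x)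
    have e : -(mol δ (u n) x - u n x) + (mol δ (u n) x - mol δ u0 x) + (mol δ u0 x - u0 x) = u n x - u0 x := by ring
    rw [e, neg_sq] at this
    exact this
  rw [integral_const_mul, integral_add (i1.fun_add i2) i3, integral_add i1 i2] at hle
  have j1 := (hW n).rel_est 0 r hδ0 hδ1
  have j1' : ∑ i, ∫ x in Metric.closedBall (0:R3) (r+1), g n i x ^ 2 ≤ 3 * E := by
    have : ∀ i, ∫ x in Metric.closedBall (0:R3) (r+1), g n i x ^ 2 ≤ E := fun i =>
      (setIntegral_le_integral ((hW n).gL2 i).integrable_sq (Eventually.of_forall fun x => sq_nonneg _)).trans (hE n i)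
    rw [Fin.sum_univ_three]; linarith [this 0, this 1, this 2]
  have j2 : ∫ x in K, (mol δ (u n) x - mol δ u0 x) ^ 2 ≤ V * (ε / (12 * (V + 1))) := by
    have : ∀ x ∈ K, (mol δ (u n) x - mol δ u0 x) ^ 2 ≤ ε / (12 * (V + 1)) := fun x hx => by
      have h1 := hn x hx
      rw [← sq_abs]
      calc _ ≤ (√(ε / (12 * (V + 1)))) ^ 2 := by gcongr
        _ = _ := Real.sq_sqrt (by positivity)
    have h2 := setIntegral_mono_on i2 (integrableOn_const (C := ε / (12 * (V + 1))) hKc.measure_lt_top.ne)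
      hKc.measurableSet this
    rwa [setIntegral_const, smul_eq_mul] at h2
  have j3 : V * (ε / (12 * (V + 1))) ≤ ε / 12 := by
    rw [mul_div_assoc', div_le_div_iff₀ (by positivity) (by positivity)]
    nlinarith
  have j4 : 3 * δ ^ 2 * ∑ i, ∫ x in Metric.closedBall (0:R3) (r+1), g n i x ^ 2 ≤ 9 * δ ^ 2 * E := by
    nlinarith [sq_nonneg δ]
  change ∫ x in K, (u n x - u0 x) ^ 2 < ε
  linarith

lemma IsTestFun.supp {η : R3 → ℝ} (h : IsTestFun η) : ∃ r : ℝ, ∀ x, x ∉ Metric.closedBall (0:R3) r → η x = 0 := by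
  obtain ⟨r, hr⟩ := h.2.isBounded.subset_closedBall (0:R3)
  exact ⟨r, fun x hx => image_eq_zero_of_notMem_tsupport fun hx' => hx (hr hx')⟩

lemma supp_sq_le {η f : R3 → ℝ} {r C D : ℝ} (hη : Measurable η) (hs : ∀ x, x ∉ Metric.closedBall (0:R3) r → η x = 0)
    (hC : ∀ x, |η x| ≤ C) (hf : Measurable f) (hD : ∀ x, |f x| ≤ D) :
    MemLp (fun x => η x * f x) 2 volume ∧
    ∫ x, (η x * f x) ^ 2 ≤ C ^ 2 * ∫ x in Metric.closedBall (0:R3) r, f x ^ 2 := by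
  have hi : IntegrableOn (fun x => f x ^ 2) (Metric.closedBall (0:R3) r) volume := bddsq_int hf hD 0 r
  have hle : ∀ x, (η x * f x) ^ 2 ≤ (Metric.closedBall (0:R3) r).indicator (fun x => C ^ 2 * f x ^ 2) x := by
    intro x
    by_cases hx : x ∈ Metric.closedBall (0:R3) r
    · rw [Set.indicator_of_mem hx, mul_pow]
      have : η x ^ 2 ≤ C ^ 2 := by rw [← sq_abs]; have := hC x; gcongr
      gcongr
    · rw [hs x hx, Set.indicator_of_notMem hx]; simp
  have hI : Integrable ((Metric.closedBall (0:R3) r).indicator (fun x => C ^ 2 * f x ^ 2)) volume :=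
    IntegrableOn.integrable_indicator (hi.const_mul (C ^ 2)) Metric.isClosed_closedBall.measurableSet
  have hI2 : Integrable (fun x => (η x * f x) ^ 2) volume :=
    hI.mono' ((hη.mul hf).pow_const 2).aestronglyMeasurable (Eventually.of_forall fun x => by
      rw [Real.norm_eq_abs, abs_of_nonneg (sq_nonneg _)]; exact hle x)
  refine ⟨(memLp_two_iff_integrable_sq (hη.mul hf).aestronglyMeasurable).2 hI2, ?_⟩
  refine (integral_mono hI2 hI hle).trans (le_of_eq ?_)
  rw [integral_indicator Metric.isClosed_closedBall.measurableSet, integral_const_mul]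

/-- product of strong and weak convergence -/
lemma sw (U : Ultrafilter ℕ) {u : ℕ → R3 → ℝ} {u0 : R3 → ℝ} (hu : ∀ n, Measurable (u n))
    (hb : ∀ n x, |u n x| ≤ 1) (hu0 : Measurable u0) (hb0 : ∀ x, |u0 x| ≤ 1) (hs : sL2 U u u0)
    {J : ℕ → R3 → ℝ} {J0 : R3 → ℝ} (hJ : ∀ n, MemLp (J n) 2 volume) {E : ℝ} (hE : ∀ n, ∫ x, J n x ^ 2 ≤ E)
    (hw : wL2 U J J0) {η : R3 → ℝ} (hη : IsTestFun η) :
    Tendsto (fun n => ∫ x, u n x * (η x * J n x)) U (𝓝 (∫ x, u0 x * (η x * J0 x))) := by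
  obtain ⟨C, hC⟩ := hη.bdd
  obtain ⟨r, hr⟩ := hη.supp
  have hm := hη.cont.measurable
  have hE0 : 0 ≤ E := (integral_nonneg fun x => sq_nonneg _).trans (hE 0)
  have k0 := (supp_sq_le hm hr hC hu0 hb0).1
  have hd : ∀ n x, |u n x - u0 x| ≤ 2 := fun n x => by
    have h1 := abs_le.1 (hb n x); have h2 := abs_le.1 (hb0 x)
    rw [abs_le]; constructor <;> linarith
  have k1 := fun n => supp_sq_le (f := fun x => u n x - u0 x) hm hr hC ((hu n).sub hu0) (hd n)
  have e0 : ∀ (a b : ℝ) (c : ℝ), a * (b * c) = (b * a) * c := fun a b c => by ring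
  have h1 := hw.2 _ k0
  have h2 : Tendsto (fun n => ∫ x, (η x * (u n x - u0 x)) * J n x) U (𝓝 0) := by
    have hlim : Tendsto (fun n => √(C ^ 2 * ∫ x in Metric.closedBall (0:R3) r, (u n x - u0 x) ^ 2) * √E) U (𝓝 0) := by
      have := (((hs r).const_mul (C ^ 2)).sqrt).mul_const (√E)
      simpa using this
    refine squeeze_zero_norm (fun n => ?_) hlim
    refine (cs (k1 n).1 (hJ n)).trans ?_
    exact mul_le_mul (Real.sqrt_le_sqrt (k1 n).2) (Real.sqrt_le_sqrt (hE n)) (Real.sqrt_nonneg _) (Real.sqrt_nonneg _)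
  have h3 := h1.add h2
  rw [add_zero] at h3
  simp_rw [e0]
  refine h3.congr fun n => ?_
  rw [← integral_add (mulL2 k0 (hJ n)) (mulL2 (k1 n).1 (hJ n))]
  congr 1; ext x; ring

structure Conv (U : Ultrafilter ℕ) (φ : ℕ → SkyrmeMap) (ψ : SkyrmeMap) (E : ℝ) : Prop where
  nice : ∀ n, Nice (φ n)
  en : ∀ n, energy (φ n) ≤ E
  W : ∀ a, W (cu ψ a) (cg ψ a)
  bd : ∀ a x, |cu ψ a x| ≤ 1
  JL2 : ∀ a b k, MemLp (cJ ψ a b k) 2 volume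
  memX : memX ψ
  s : ∀ a, sL2 U (fun n => cu (φ n) a) (cu ψ a)
  wg : ∀ a i, wL2 U (fun n => cg (φ n) a i) (cg ψ a i)
  wJ : ∀ a b k, wL2 U (fun n => cJ (φ n) a b k) (cJ ψ a b k)

lemma Nice.bd {φ : SkyrmeMap} (h : Nice φ) (a : Fin 4) (x : R3) : |cu φ a x| ≤ 1 := abs_le_one_of_sum (h.sph x) a

lemma Nice.g_le {φ : SkyrmeMap} (h : Nice φ) (a : Fin 4) (i : Fin 3) : ∫ x, cg φ a i x ^ 2 ≤ energy φ :=
  integral_mono (h.n0.gL2 a i).integrable_sq h.memX fun x => cg_sq_le φ a i x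

lemma Nice.J_le {φ : SkyrmeMap} (h : Nice φ) (a b : Fin 4) (k : Fin 3) : ∫ x, cJ φ a b k x ^ 2 ≤ energy φ :=
  integral_mono (h.JL2 a b k).integrable_sq h.memX fun x => cJ_sq_le φ a b k x

lemma memX_of {ψ : SkyrmeMap} (hg : ∀ a i, MemLp (cg ψ a i) 2 volume) (hJ : ∀ a b k, MemLp (cJ ψ a b k) 2 volume) :
    memX ψ := by
  have : energyDensity ψ = fun x => ∑ a, ∑ i, cg ψ a i x ^ 2 + ∑ a, ∑ b, ∑ k, cJ ψ a b k x ^ 2 :=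
    funext fun x => dens_eq ψ x
  rw [memX, this]
  exact (integrable_finsetSum _ fun a _ => integrable_finsetSum _ fun i _ => (hg a i).integrable_sq).add
    (integrable_finsetSum _ fun a _ => integrable_finsetSum _ fun b _ => integrable_finsetSum _ fun k _ =>
      (hJ a b k).integrable_sq)

lemma exists_conv (U : Ultrafilter ℕ) {φ : ℕ → SkyrmeMap} (hN : ∀ n, Nice (φ n)) {E : ℝ}
    (hE : ∀ n, energy (φ n) ≤ E) : ∃ ψ, Conv U φ ψ E := by
  choose u hum hub hul using fun a => clamp_lim U (fun n => cu_meas (φ n) a) (fun n x => (hN n).bd a x)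
  choose g hgm hgw using fun a i => exists_wL2 U (fun n => (hN n).n0.gL2 a i)
    (fun n => ((hN n).g_le a i).trans (hE n))
  choose J hJm hJw using fun a b k => exists_wL2 U (fun n => (hN n).JL2 a b k)
    (fun n => ((hN n).J_le a b k).trans (hE n))
  have hS : ∀ a, sL2 U (fun n => cu (φ n) a) (u a) := fun a =>
    rellich U (fun n => (hN n).W a) (fun n => (hN n).bd a) (fun n i => ((hN n).g_le a i).trans (hE n))
      (hum a) (hub a) (hul a)
  have hweak : ∀ a i (η : R3 → ℝ), IsTestFun η → ∫ x, fderiv ℝ η x (ee i) * u a x = - ∫ x, η x * g a i x := by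
    intro a i η hη
    have h1 := hul a _ (hη.d (ee i)).cont (hη.d (ee i)).2
    have h2 := ((hgw a i).2 η (hη.memLp 2)).neg
    refine tendsto_nhds_unique h1 (h2.congr fun n => ?_)
    exact (((hN n).W a).weak i η hη).symm
  have hWa : ∀ a, W (u a) (g a) := fun a => ⟨hum a, ⟨1, hub a⟩, hgm a, fun i => (hgw a i).1, hweak a⟩
  have hJe : ∀ a b k, J a b k =ᵐ[volume] crf (g a) (g b) k := by
    intro a b k
    refine ae_eq_of_integral_contDiff_smul_eq (locInt_of_L2 (hJw a b k).1)
      (crf_int (hWa a) (hWa b) k).locallyIntegrable fun η h1 h2 => ?_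
    have hη : IsTestFun η := ⟨h1, h2⟩
    have l1 := (hJw a b k).2 η (hη.memLp 2)
    simp only [smul_eq_mul]
    rw [minor_ibp (hWa a) (hWa b) hη k]
    have swl := fun (i j : Fin 3) => sw U (fun n => cu_meas (φ n) a) (fun n => (hN n).bd a) (hum a) (hub a) (hS a)
      (fun n => (hN n).n0.gL2 b j) (fun n => ((hN n).g_le b j).trans (hE n)) (hgw b j) (hη.d (ee i))
    have l2 := ((swl (k+1) (k+2)).sub (swl (k+2) (k+1))).neg
    have hintg : ∀ {v : R3 → ℝ} {f : R3 → ℝ}, Measurable v → (∀ x, |v x| ≤ 1) → MemLp f 2 volume → ∀ i : Fin 3,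
        Integrable (fun x => v x * (fderiv ℝ η x (ee i) * f x)) volume := fun hv hb hf i =>
      (mulL2 ((hη.d (ee i)).memLp 2) hf).bdd_mul (c := 1) hv.aestronglyMeasurable (Eventually.of_forall hb)
    have e2 : (∫ x, u a x * (fderiv ℝ η x (ee (k+1)) * g b (k+2) x - fderiv ℝ η x (ee (k+2)) * g b (k+1) x)) =
       (∫ x, u a x * (fderiv ℝ η x (ee (k+1)) * g b (k+2) x)) - ∫ x, u a x * (fderiv ℝ η x (ee (k+2)) * g b (k+1) x) := by
      rw [← integral_sub (hintg (hum a) (hub a) (hgw b _).1 _) (hintg (hum a) (hub a) (hgw b _).1 _)]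
      congr 1; ext x; ring
    rw [e2]
    refine tendsto_nhds_unique l1 (l2.congr fun n => ?_)
    rw [← integral_sub (hintg (cu_meas _ a) ((hN n).bd a) ((hN n).n0.gL2 b _) _)
      (hintg (cu_meas _ a) ((hN n).bd a) ((hN n).n0.gL2 b _) _)]
    have := minor_ibp ((hN n).W a) ((hN n).W b) hη k
    simp only [cJ]
    rw [this]
    congr 2; ext x; ring
  have hsph : ∀ᵐ x, ∑ a, u a x ^ 2 = 1 := by
    have hball : ∀ N : ℕ, ∀ᵐ x, x ∈ Metric.closedBall (0:R3) N → ∑ a, u a x ^ 2 = 1 := by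
      intro N
      have hq : IntegrableOn (fun x => (∑ a, u a x ^ 2 - 1) ^ 2) (Metric.closedBall (0:R3) N) volume := by
        refine bddsq_int (C := 5) ((Finset.measurable_sum _ fun a _ => (hum a).pow_const 2).sub_const 1) (fun x => ?_) _ _
        have h1 := fun a => abs_le.1 (hub a x)
        have h2 : ∀ a, u a x ^ 2 ≤ 1 := fun a => by nlinarith [h1 a]
        rw [Fin.sum_univ_four, abs_le]
        constructor <;> nlinarith [h2 0, h2 1, h2 2, h2 3, sq_nonneg (u 0 x), sq_nonneg (u 1 x), sq_nonneg (u 2 x), sq_nonneg (u 3 x)]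
      have hz : ∫ x in Metric.closedBall (0:R3) N, (∑ a, u a x ^ 2 - 1) ^ 2 = 0 := by
        apply le_antisymm _ (integral_nonneg fun x => sq_nonneg _)
        have hl : Tendsto (fun n => 16 * ∑ a, ∫ x in Metric.closedBall (0:R3) N, (cu (φ n) a x - u a x) ^ 2) U (𝓝 0) := by
          have := (tendsto_finsetSum Finset.univ fun a _ => hS a N).const_mul 16
          simpa using this
        refine ge_of_tendsto hl (Eventually.of_forall fun n => ?_)
        have hdi : ∀ a, IntegrableOn (fun x => (cu (φ n) a x - u a x) ^ 2) (Metric.closedBall (0:R3) N) volume := fun a =>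
          bddsq_int (u := fun x => cu (φ n) a x - u a x) (C := 2) ((cu_meas _ a).sub (hum a)) (fun x => by
            have h1 := abs_le.1 ((hN n).bd a x); have h2 := abs_le.1 (hub a x)
            rw [abs_le]; constructor <;> linarith) _ _
        rw [← integral_finsetSum _ fun a _ => hdi a, ← integral_const_mul]
        refine integral_mono hq ((integrable_finsetSum _ fun a _ => hdi a).const_mul 16) fun x => ?_
        have hs := (hN n).sph x
        have h1 := fun a => abs_le.1 ((hN n).bd a x)
        have h2 := fun a => abs_le.1 (hub a x)
        have e : ∑ a, u a x ^ 2 - 1 = ∑ a, (u a x + cu (φ n) a x) * (u a x - cu (φ n) a x) := by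
          rw [← hs, ← Finset.sum_sub_distrib]
          exact Finset.sum_congr rfl fun a _ => by ring
        simp only
        rw [e]
        refine (Finset.sum_mul_sq_le_sq_mul_sq _ _ _).trans ?_
        have h3 : ∑ a, (u a x + cu (φ n) a x) ^ 2 ≤ 16 := by
          have : ∀ a, (u a x + cu (φ n) a x) ^ 2 ≤ 4 := fun a => by nlinarith [h1 a, h2 a]
          rw [Fin.sum_univ_four]; linarith [this 0, this 1, this 2, this 3]
        have h4 : ∑ a, (u a x - cu (φ n) a x) ^ 2 = ∑ a, (cu (φ n) a x - u a x) ^ 2 :=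
          Finset.sum_congr rfl fun a _ => by ring
        rw [h4]
        gcongr
      rw [setIntegral_eq_zero_iff_of_nonneg_ae (Eventually.of_forall fun x => sq_nonneg _) hq,
        EventuallyEq, ae_restrict_iff' Metric.isClosed_closedBall.measurableSet] at hz
      filter_upwards [hz] with x hx hx2
      have := hx hx2
      simp only [Pi.zero_apply] at this
      nlinarith [pow_eq_zero_iff (two_ne_zero) |>.1 this]
    filter_upwards [ae_all_iff.2 hball] with x hx
    obtain ⟨N, hN⟩ := exists_nat_ge ‖x‖
    exact hx N (by simpa using hN)
  let ψ : SkyrmeMap :=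
    { toFun := fun x a => u a x
      pderiv := fun i x a => g a i x
      meas := measurable_pi_lambda _ hum
      pderiv_locInt := fun i => (MemLp.of_eval fun a => (hgw a i).1).locallyIntegrable (by norm_num)
      sphere := by
        filter_upwards [hsph] with x hx
        rw [← hx]; simp [nsq, dot, sq]
      weak := fun i a η hη => hweak a i η hη }
  have hJL : ∀ a b k, MemLp (cJ ψ a b k) 2 volume := fun a b k => (memLp_congr_ae (hJe a b k)).1 (hJw a b k).1
  refine ⟨ψ, hN, hE, hWa, hub, hJL, memX_of (fun a i => (hgw a i).1) hJL, hS, hgw, fun a b k => ⟨hJL a b k, fun h hh => ?_⟩⟩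
  have := (hJw a b k).2 h hh
  have e : ∫ x, h x * cJ ψ a b k x = ∫ x, h x * J a b k x := by
    apply integral_congr_ae
    filter_upwards [hJe a b k] with x hx
    rw [hx]; rfl
  rw [e]; exact this

lemma cD_meas {φ : SkyrmeMap} (hm : ∀ a i, Measurable (cg φ a i)) (a b c : Fin 4) : Measurable (cD φ a b c) := by
  have hJ : ∀ k, Measurable (cJ φ b c k) := fun k =>
    ((hm b _).mul (hm c _)).sub ((hm b _).mul (hm c _))
  exact Finset.measurable_sum _ fun k _ => (hm a k).mul (hJ k)

/-- the basic Young type estimate -/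
lemma det_young {φ : SkyrmeMap} (hm : ∀ a i, Measurable (cg φ a i)) (hX : memX φ) (a b c : Fin 4)
    {S : Set R3} (hS : MeasurableSet S) (hSf : volume S ≠ ⊤) {η t : R3 → ℝ} (hη : Measurable η) {C : ℝ} (hC : ∀ x, |η x| ≤ C)
    (hs : ∀ x, x ∉ S → η x = 0) (ht : Measurable t) (hb : ∀ x, |t x| ≤ 2) {lam : ℝ} (hl : 0 < lam) :
    Integrable (fun x => η x * (t x * cD φ a b c x)) volume ∧
    |∫ x, η x * (t x * cD φ a b c x)| ≤ C * (lam * (∫ x in S, energyDensity φ x) +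
      (lam ^ 3)⁻¹ * (4 * ∫ x in S, t x ^ 2)) := by
  have hC0 : 0 ≤ C := (abs_nonneg _).trans (hC 0)
  have h2 : IntegrableOn (fun x => t x ^ 2) S volume := by
    refine Integrable.mono' (integrableOn_const (C := (2:ℝ) ^ 2) hSf)
      (ht.pow_const 2).aestronglyMeasurable (Eventually.of_forall fun x => ?_)
    rw [Real.norm_eq_abs, abs_of_nonneg (sq_nonneg _), ← sq_abs]
    have := hb x
    gcongr
  set G : R3 → ℝ := S.indicator (fun x => C * (lam * energyDensity φ x + (lam ^ 3)⁻¹ * (4 * t x ^ 2))) with hG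
  have hI : IntegrableOn (fun x => C * (lam * energyDensity φ x + (lam ^ 3)⁻¹ * (4 * t x ^ 2))) S volume :=
    ((hX.integrableOn.const_mul lam).add ((h2.const_mul 4).const_mul _)).const_mul C
  have hGi : Integrable G volume := hI.integrable_indicator hS
  have hle : ∀ x, ‖η x * (t x * cD φ a b c x)‖ ≤ G x := by
    intro x
    by_cases hx : x ∈ S
    · rw [hG, Set.indicator_of_mem hx, norm_mul]
      refine mul_le_mul (hC x) ?_ (norm_nonneg _) hC0
      have := young4 (t := t x) (dens_nonneg φ x) hl (D_pow4 φ a b c x)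
      refine this.trans ?_
      have h4 : t x ^ 4 ≤ 4 * t x ^ 2 := by
        have h5 : t x ^ 2 ≤ 4 := by have := abs_le.1 (hb x); nlinarith
        nlinarith [sq_nonneg (t x)]
      gcongr
    · rw [hs x hx, hG, Set.indicator_of_notMem hx]; simp
  have hmm : AEStronglyMeasurable (fun x => η x * (t x * cD φ a b c x)) volume :=
    (hη.mul (ht.mul (cD_meas hm a b c))).aestronglyMeasurable
  refine ⟨hGi.mono' hmm (Eventually.of_forall hle), ?_⟩
  refine (norm_integral_le_of_norm_le hGi (Eventually.of_forall hle)).trans (le_of_eq ?_)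
  rw [hG, integral_indicator hS, integral_const_mul, integral_add (hX.integrableOn.const_mul lam)
    ((h2.const_mul 4).const_mul _), integral_const_mul, integral_const_mul, integral_const_mul]

lemma cD_crf (φ : SkyrmeMap) (a b c : Fin 4) (x : R3) :
    cD φ a b c x = ∑ k, cg φ a k x * crf (cg φ b) (cg φ c) k x := rfl

lemma sum_int_split {u : R3 → ℝ} (hu : Measurable u) (hb : ∀ x, |u x| ≤ 1) {J : Fin 3 → R3 → ℝ}
    (hJ : ∀ k, MemLp (J k) 2 volume) {ζ : R3 → ℝ} (hζ : IsTestFun ζ) :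
    ∫ x, u x * ∑ k, fderiv ℝ ζ x (ee k) * J k x = ∑ k, ∫ x, u x * (fderiv ℝ ζ x (ee k) * J k x) := by
  rw [← integral_finsetSum]
  · congr 1; ext x; rw [Finset.mul_sum]
  · intro k _
    exact (mulL2 ((hζ.d (ee k)).memLp 2) (hJ k)).bdd_mul (c := 1) hu.aestronglyMeasurable (Eventually.of_forall hb)

lemma Conv.D {U : Ultrafilter ℕ} {φ : ℕ → SkyrmeMap} {ψ : SkyrmeMap} {E : ℝ} (h : Conv U φ ψ E) (a b c : Fin 4)
    {ζ : R3 → ℝ} (hζ : IsTestFun ζ) :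
    Tendsto (fun n => ∫ x, ζ x * cD (φ n) a b c x) U (𝓝 (∫ x, ζ x * cD ψ a b c x)) := by
  simp_rw [cD_crf]
  rw [det_ibp (h.W a) (h.W b) (h.W c) (h.JL2 b c) hζ, sum_int_split (J := crf (cg ψ b) (cg ψ c)) (h.W a).meas (h.bd a) (h.JL2 b c) hζ]
  have hn : ∀ n, ∫ x, ζ x * ∑ k, cg (φ n) a k x * crf (cg (φ n) b) (cg (φ n) c) k x =
      - ∑ k, ∫ x, cu (φ n) a x * (fderiv ℝ ζ x (ee k) * cJ (φ n) b c k x) := fun n => by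
    rw [det_ibp ((h.nice n).W a) ((h.nice n).W b) ((h.nice n).W c) ((h.nice n).JL2 b c) hζ,
      ← sum_int_split ((h.nice n).W a).meas ((h.nice n).bd a) ((h.nice n).JL2 b c) hζ]
    rfl
  simp_rw [hn]
  refine (tendsto_finsetSum _ fun k _ => ?_).neg
  exact sw U (fun n => cu_meas _ a) (fun n => (h.nice n).bd a) (cu_meas _ a) (h.bd a) (h.s a)
    (fun n => (h.nice n).JL2 b c k) (fun n => ((h.nice n).J_le b c k).trans (h.en n)) (h.wJ b c k) (hζ.d (ee k))

lemma dist2 {f g : R3 → ℝ} (hf : ∀ x, |f x| ≤ 1) (hg : ∀ x, |g x| ≤ 1) (x : R3) : |f x - g x| ≤ 2 := by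
  have h1 := abs_le.1 (hf x); have h2 := abs_le.1 (hg x)
  rw [abs_le]; constructor <;> linarith

lemma Conv.uD {U : Ultrafilter ℕ} {φ : ℕ → SkyrmeMap} {ψ : SkyrmeMap} {E : ℝ} (h : Conv U φ ψ E) (d a b c : Fin 4)
    {ζ : R3 → ℝ} (hζ : IsTestFun ζ) :
    Tendsto (fun n => ∫ x, ζ x * (cu (φ n) d x * cD (φ n) a b c x)) U (𝓝 (∫ x, ζ x * (cu ψ d x * cD ψ a b c x))) := by
  obtain ⟨C0, hC0⟩ := hζ.bdd
  obtain ⟨r, hr⟩ := hζ.supp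
  set C := |C0| + 1
  have hCp : 0 < C := by positivity
  have hC : ∀ x, |ζ x| ≤ C := fun x => (hC0 x).trans ((le_abs_self C0).trans (by simp [C]))
  set K := Metric.closedBall (0:R3) r
  have hKc : IsCompact K := isCompact_closedBall _ _
  have hKm : MeasurableSet K := hKc.measurableSet
  set E' := max E (energy ψ)
  have hE'0 : 0 ≤ E' := le_max_of_le_right (integral_nonneg fun x => dens_nonneg ψ x)
  have hgm : ∀ n a i, Measurable (cg (φ n) a i) := fun n a i => (h.nice n).pm i a
  have hgm0 : ∀ a i, Measurable (cg ψ a i) := fun a i => (h.W a).gmeas i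
  have hsE : ∀ {χ : SkyrmeMap}, _root_.memX χ → energy χ ≤ E' → ∫ x in K, energyDensity χ x ≤ E' := fun hX hE =>
    (setIntegral_le_integral hX (Eventually.of_forall fun x => dens_nonneg _ x)).trans hE
  rw [Metric.tendsto_nhds]
  intro ε hε
  -- lam
  set lam := ε / (8 * C * (E' + 1)) with hlam
  have hl : 0 < lam := by positivity
  have hlE : C * (lam * E') ≤ ε / 8 := by
    have : C * (lam * E') = ε / 8 * (E' / (E' + 1)) := by rw [hlam]; field_simp
    rw [this]
    have : E' / (E' + 1) ≤ 1 := by rw [div_le_one (by positivity)]; linarith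
    nlinarith
  set M := C * ((lam ^ 3)⁻¹ * 4)
  have hM : 0 < M := by positivity
  -- delta
  have hub := h.bd d
  have hum := cu_meas ψ d
  obtain ⟨δ, hδ1, hδ0⟩ := (((mol_loc_tendsto hum hub 0 r).eventually
    (gt_mem_nhds (show (0:ℝ) < ε / (16 * M) by positivity))).and self_mem_nhdsWithin).exists
  replace hδ0 : 0 < δ := hδ0
  have hmc := mol_contDiff hδ0 (h.W d).locInt
  have hmb := mol_bdd hub δ
  have hmm : Measurable (mol δ (cu ψ d)) := hmc.continuous.measurable
  have hD := Metric.tendsto_nhds.1 (h.D a b c (hζ.mul hmc)) (ε / 4) (by positivity)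
  have hsn := (h.s d r).eventually (gt_mem_nhds (show (0:ℝ) < ε / (64 * M) by positivity))
  filter_upwards [hD, hsn] with n hn1 hn2
  have b1 := det_young (t := fun x => cu (φ n) d x - mol δ (cu ψ d) x) (hgm n) (h.nice n).memX a b c hKm hKc.measure_lt_top.ne
    hζ.cont.measurable hC hr ((cu_meas _ d).sub hmm) (dist2 ((h.nice n).bd d) hmb) hl
  have b2 := det_young (t := fun x => mol δ (cu ψ d) x - cu ψ d x) hgm0 h.memX a b c hKm hKc.measure_lt_top.ne
    hζ.cont.measurable hC hr (hmm.sub hum) (dist2 hmb hub) hl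
  have b3 := (det_young (t := mol δ (cu ψ d)) (hgm n) (h.nice n).memX a b c hKm hKc.measure_lt_top.ne
    hζ.cont.measurable hC hr hmm (fun x => (hmb x).trans one_le_two) hl).1
  have b4 := (det_young (t := mol δ (cu ψ d)) hgm0 h.memX a b c hKm hKc.measure_lt_top.ne
    hζ.cont.measurable hC hr hmm (fun x => (hmb x).trans one_le_two) hl).1
  have e1 : ∫ x, ζ x * (cu (φ n) d x * cD (φ n) a b c x) = (∫ x, ζ x * ((cu (φ n) d x - mol δ (cu ψ d) x) * cD (φ n) a b c x))
      + ∫ x, ζ x * (mol δ (cu ψ d) x * cD (φ n) a b c x) := by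
    rw [← integral_add b1.1 b3]; congr 1; ext x; ring
  have e2 : ∫ x, ζ x * (mol δ (cu ψ d) x * cD ψ a b c x) = (∫ x, ζ x * ((mol δ (cu ψ d) x - cu ψ d x) * cD ψ a b c x))
      + ∫ x, ζ x * (cu ψ d x * cD ψ a b c x) := by
    have b5 := (det_young (t := cu ψ d) hgm0 h.memX a b c hKm hKc.measure_lt_top.ne
      hζ.cont.measurable hC hr hum (fun x => (hub x).trans one_le_two) hl).1
    rw [← integral_add b2.1 b5]; congr 1; ext x; ring
  have c1 : ∫ x in K, (cu (φ n) d x - mol δ (cu ψ d) x) ^ 2 ≤ 2 * (ε / (64 * M)) + 2 * (ε / (16 * M)) := by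
    have i1 : IntegrableOn (fun x => (cu (φ n) d x - cu ψ d x) ^ 2) K volume :=
      bddsq_int (u := fun x => cu (φ n) d x - cu ψ d x) ((cu_meas _ d).sub hum) (dist2 ((h.nice n).bd d) hub) _ _
    have i2 : IntegrableOn (fun x => (mol δ (cu ψ d) x - cu ψ d x) ^ 2) K volume :=
      bddsq_int (u := fun x => mol δ (cu ψ d) x - cu ψ d x) (hmm.sub hum) (dist2 hmb hub) _ _
    have i3 : IntegrableOn (fun x => (cu (φ n) d x - mol δ (cu ψ d) x) ^ 2) K volume :=
      bddsq_int (u := fun x => cu (φ n) d x - mol δ (cu ψ d) x) ((cu_meas _ d).sub hmm) (dist2 ((h.nice n).bd d) hmb) _ _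
    have hle := integral_mono i3 ((i1.const_mul 2).add (i2.const_mul 2)) fun x => (by
      simp only [Pi.add_apply]
      nlinarith [sq_nonneg (cu (φ n) d x - cu ψ d x + (mol δ (cu ψ d) x - cu ψ d x))] :
      (cu (φ n) d x - mol δ (cu ψ d) x) ^ 2 ≤ _)
    simp only [Pi.add_apply] at hle
    rw [integral_add (i1.const_mul 2) (i2.const_mul 2), integral_const_mul, integral_const_mul] at hle
    exact hle.trans (by gcongr)
  have f1 : M * (2 * (ε / (64 * M)) + 2 * (ε / (16 * M))) = ε / 32 + ε / 8 := by field_simp; norm_num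
  have f2 : M * (ε / (16 * M)) = ε / 16 := by field_simp
  have g1 : |∫ x, ζ x * ((cu (φ n) d x - mol δ (cu ψ d) x) * cD (φ n) a b c x)| ≤ ε / 8 + (ε / 32 + ε / 8) := by
    refine b1.2.trans ?_
    have s1 := hsE (h.nice n).memX ((h.en n).trans (le_max_left _ _))
    have s2 : C * (lam * ∫ x in K, energyDensity (φ n) x) ≤ C * (lam * E') := by gcongr
    have s3 := mul_le_mul_of_nonneg_left c1 hM.le
    rw [f1] at s3
    calc _ = C * (lam * ∫ x in K, energyDensity (φ n) x) + M * ∫ x in K, (cu (φ n) d x - mol δ (cu ψ d) x) ^ 2 := by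
          simp only [M]; ring
      _ ≤ _ := by linarith
  have g2 : |∫ x, ζ x * ((mol δ (cu ψ d) x - cu ψ d x) * cD ψ a b c x)| ≤ ε / 8 + ε / 16 := by
    refine b2.2.trans ?_
    have s1 := hsE h.memX (le_max_right _ _)
    have s2 : C * (lam * ∫ x in K, energyDensity ψ x) ≤ C * (lam * E') := by gcongr
    have s3 := mul_le_mul_of_nonneg_left hδ1.le hM.le
    rw [f2] at s3
    calc _ = C * (lam * ∫ x in K, energyDensity ψ x) + M * ∫ x in K, (mol δ (cu ψ d) x - cu ψ d x) ^ 2 := by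
          simp only [M]; ring
      _ ≤ _ := by linarith
  simp only [mul_assoc] at hn1
  rw [Real.dist_eq] at hn1 ⊢
  rw [abs_lt] at *
  rw [abs_le] at g1 g2
  constructor <;> linarith [hn1.1, hn1.2, g1.1, g1.2, g2.1, g2.2]

lemma det_int_split {φ : SkyrmeMap} (hm : ∀ a i, Measurable (cg φ a i)) (hX : memX φ) (hb : ∀ a x, |cu φ a x| ≤ 1)
    {ζ : R3 → ℝ} (hζ : IsTestFun ζ) : ∫ x, ζ x * detDen φ x =
    (∫ x, ζ x * (cu φ 0 x * cD φ 1 2 3 x)) - (∫ x, ζ x * (cu φ 1 x * cD φ 0 2 3 x)) +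
      (∫ x, ζ x * (cu φ 2 x * cD φ 0 1 3 x)) - ∫ x, ζ x * (cu φ 3 x * cD φ 0 1 2 x) := by
  obtain ⟨C, hC⟩ := hζ.bdd
  obtain ⟨r, hr⟩ := hζ.supp
  have hi := fun d a b c => (det_young (t := cu φ d) hm hX a b c (isCompact_closedBall (0:R3) r).measurableSet
    (isCompact_closedBall (0:R3) r).measure_lt_top.ne
      hζ.cont.measurable hC hr (cu_meas φ d) (fun x => (hb d x).trans one_le_two) one_pos).1
  have h1 := (hi 0 1 2 3).sub (hi 1 0 2 3)
  have h2 := h1.add (hi 2 0 1 3)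
  have e : ∀ x, ζ x * detDen φ x = (ζ x * (cu φ 0 x * cD φ 1 2 3 x) - ζ x * (cu φ 1 x * cD φ 0 2 3 x) +
      ζ x * (cu φ 2 x * cD φ 0 1 3 x)) - ζ x * (cu φ 3 x * cD φ 0 1 2 x) := fun x => by
    rw [det_dT, dT]; simp only [cu]; ring
  rw [integral_congr_ae (Eventually.of_forall e)]
  refine (integral_sub h2 (hi 3 0 1 2)).trans ?_
  congr 1
  refine (integral_add h1 (hi 2 0 1 3)).trans ?_
  congr 1
  exact integral_sub (hi 0 1 2 3) (hi 1 0 2 3)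

lemma Conv.det {U : Ultrafilter ℕ} {φ : ℕ → SkyrmeMap} {ψ : SkyrmeMap} {E : ℝ} (h : Conv U φ ψ E)
    {ζ : R3 → ℝ} (hζ : IsTestFun ζ) :
    Tendsto (fun n => ∫ x, ζ x * detDen (φ n) x) U (𝓝 (∫ x, ζ x * detDen ψ x)) := by
  rw [det_int_split (fun a i => (h.W a).gmeas i) h.memX h.bd hζ]
  simp_rw [fun n => det_int_split (fun a i => (h.nice n).pm i a) (h.nice n).memX (h.nice n).bd hζ]
  exact (((h.uD 0 1 2 3 hζ).sub (h.uD 1 0 2 3 hζ)).add (h.uD 2 0 1 3 hζ)).sub (h.uD 3 0 1 2 hζ)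

lemma Conv.lsc {U : Ultrafilter ℕ} {φ : ℕ → SkyrmeMap} {ψ : SkyrmeMap} {E : ℝ} (h : Conv U φ ψ E)
    {ζ : R3 → ℝ} (hζ : IsTestFun ζ) (h0 : ∀ x, 0 ≤ ζ x) {c : ℝ}
    (hc : ∀ᶠ n in (U : Filter ℕ), ∫ x, ζ x * energyDensity (φ n) x ≤ c) : ∫ x, ζ x * energyDensity ψ x ≤ c := by
  obtain ⟨C, hC⟩ := hζ.bdd
  have hm := hζ.cont.measurable
  have zL : ∀ {f : R3 → ℝ}, MemLp f 2 volume → MemLp (fun x => ζ x * f x) 2 volume := fun hf => bddL2 hm hC hf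
  -- bilinear form
  let B : SkyrmeMap → R3 → ℝ := fun χ x => ∑ a, ∑ i, (ζ x * cg ψ a i x) * cg χ a i x +
    ∑ a, ∑ b, ∑ k, (ζ x * cJ ψ a b k x) * cJ χ a b k x
  have hBi : ∀ χ, (∀ a i, MemLp (cg χ a i) 2 volume) → (∀ a b k, MemLp (cJ χ a b k) 2 volume) →
      Integrable (B χ) volume ∧ ∫ x, B χ x = ∑ a, ∑ i, (∫ x, (ζ x * cg ψ a i x) * cg χ a i x) +
    ∑ a, ∑ b, ∑ k, ∫ x, (ζ x * cJ ψ a b k x) * cJ χ a b k x := by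
    intro χ hg hJ
    have i1 : ∀ a i, Integrable (fun x => (ζ x * cg ψ a i x) * cg χ a i x) volume := fun a i =>
      mulL2 (zL ((h.W a).gL2 i)) (hg a i)
    have i2 : ∀ a b k, Integrable (fun x => (ζ x * cJ ψ a b k x) * cJ χ a b k x) volume := fun a b k =>
      mulL2 (zL (h.JL2 a b k)) (hJ a b k)
    have s1 := integrable_finsetSum Finset.univ fun a _ => integrable_finsetSum Finset.univ fun i _ => i1 a i
    have s2 := integrable_finsetSum Finset.univ fun a _ => integrable_finsetSum Finset.univ fun b _ =>
      integrable_finsetSum Finset.univ fun k _ => i2 a b k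
    refine ⟨s1.add s2, ?_⟩
    simp only [B]
    rw [integral_add s1 s2, integral_finsetSum _ fun a _ => integrable_finsetSum Finset.univ fun i _ => i1 a i,
      integral_finsetSum _ fun a _ => integrable_finsetSum Finset.univ fun b _ =>
      integrable_finsetSum Finset.univ fun k _ => i2 a b k]
    congr 1
    · refine Finset.sum_congr rfl fun a _ => ?_
      rw [integral_finsetSum _ fun i _ => i1 a i]
    · refine Finset.sum_congr rfl fun a _ => ?_
      rw [integral_finsetSum _ fun b _ => integrable_finsetSum Finset.univ fun k _ => i2 a b k]
      refine Finset.sum_congr rfl fun b _ => ?_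
      rw [integral_finsetSum _ fun k _ => i2 a b k]
  have hψ := hBi ψ (fun a i => (h.W a).gL2 i) h.JL2
  have hφ := fun n => hBi (φ n) (fun a i => (h.nice n).n0.gL2 a i) (h.nice n).JL2
  have hBψ : ∀ x, B ψ x = ζ x * energyDensity ψ x := by
    intro x
    simp only [B]
    rw [dens_eq, mul_add]
    simp only [Finset.mul_sum]
    congr 1 <;> simp only [sq, mul_assoc]
  have hlim : Tendsto (fun n => ∫ x, B (φ n) x) U (𝓝 (∫ x, B ψ x)) := by
    rw [hψ.2]
    simp_rw [fun n => (hφ n).2]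
    refine Tendsto.add ?_ ?_
    · exact tendsto_finsetSum _ fun a _ => tendsto_finsetSum _ fun i _ => (h.wg a i).2 _ (zL ((h.W a).gL2 i))
    · exact tendsto_finsetSum _ fun a _ => tendsto_finsetSum _ fun b _ => tendsto_finsetSum _ fun k _ =>
        (h.wJ a b k).2 _ (zL (h.JL2 a b k))
  have hlim2 : Tendsto (fun n => 2 * (∫ x, B (φ n) x) - ∫ x, B ψ x) U (𝓝 (∫ x, B ψ x)) := by
    have := (hlim.const_mul 2).sub_const (∫ x, B ψ x)
    convert this using 2; ring
  have hfin : ∫ x, B ψ x ≤ c := by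
    refine le_of_tendsto hlim2 ?_
    filter_upwards [hc] with n hn
    refine le_trans ?_ hn
    have hzi : Integrable (fun x => ζ x * energyDensity (φ n) x) volume :=
      Integrable.bdd_mul (c := C) (h.nice n).memX hm.aestronglyMeasurable (Eventually.of_forall hC)
    rw [← integral_const_mul, ← integral_sub ((hφ n).1.const_mul 2) hψ.1]
    refine integral_mono (((hφ n).1.const_mul 2).sub hψ.1) hzi fun x => ?_
    simp only
    rw [dens_eq, mul_add]
    simp only [B, Finset.mul_sum, mul_add]
    have key : ∀ p q : ℝ, 2 * (ζ x * p * q) - ζ x * p * p ≤ ζ x * q ^ 2 := fun p q => by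
      nlinarith [mul_nonneg (h0 x) (sq_nonneg (p - q))]
    have k1 : (∑ a, ∑ i, 2 * (ζ x * cg ψ a i x * cg (φ n) a i x)) - ∑ a, ∑ i, ζ x * cg ψ a i x * cg ψ a i x ≤
        ∑ a, ∑ i, ζ x * cg (φ n) a i x ^ 2 := by
      simp only [← Finset.sum_sub_distrib]
      exact Finset.sum_le_sum fun a _ => Finset.sum_le_sum fun i _ => key _ _
    have k2 : (∑ a, ∑ b, ∑ k, 2 * (ζ x * cJ ψ a b k x * cJ (φ n) a b k x)) - ∑ a, ∑ b, ∑ k, ζ x * cJ ψ a b k x * cJ ψ a b k x ≤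
        ∑ a, ∑ b, ∑ k, ζ x * cJ (φ n) a b k x ^ 2 := by
      simp only [← Finset.sum_sub_distrib]
      exact Finset.sum_le_sum fun a _ => Finset.sum_le_sum fun b _ => Finset.sum_le_sum fun k _ => key _ _
    linarith
  rwa [integral_congr_ae (Eventually.of_forall hBψ)] at hfin

/-- integrals of |f - c| over a small ball controlled by osc -/
lemma shift_osc {f : R3 → ℝ} (hf : LocallyIntegrable f volume) {t s : ℝ} (ht : 0 < t) (hs : s ≤ 2 * t)
    {x y : R3} (hxy : dist y x + t ≤ s) :
    ∫ w in Metric.closedBall (0 : R3) 1, |f (y - t • w) - f x| ≤ 8 * osc f x s := by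
  have hs0 : 0 < s := by have := dist_nonneg (x := y) (y := x); linarith
  have hli : LocallyIntegrable (fun z => |f z - f x|) volume := by
    have h1 : LocallyIntegrable (fun z => f z - f x) volume := hf.sub (locallyIntegrable_const _)
    exact fun z => (h1 z).norm
  rw [osc, int_affine_ball ht (fun z => |f z - f x|) y 1, int_affine_ball hs0 (fun z => |f z - f x|) x 1]
  rw [mul_one, mul_one, ← mul_assoc]
  have hsub : Metric.closedBall y t ⊆ Metric.closedBall x s :=
    Metric.closedBall_subset_closedBall' (by linarith)
  have h1 : ∫ z in Metric.closedBall y t, |f z - f x| ≤ ∫ z in Metric.closedBall x s, |f z - f x| :=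
    setIntegral_mono_set (hli.integrableOn_isCompact (isCompact_closedBall _ _))
      (Eventually.of_forall fun z => abs_nonneg _) hsub.eventuallyLE
  have h2 : t⁻¹ ^ 3 ≤ 8 * s⁻¹ ^ 3 := by
    have : t⁻¹ ≤ 2 * s⁻¹ := by
      rw [← div_eq_mul_inv, inv_eq_one_div, div_le_div_iff₀ ht hs0]; linarith
    calc t⁻¹ ^ 3 ≤ (2 * s⁻¹) ^ 3 := by gcongr
      _ = _ := by ring
  have h0 : 0 ≤ ∫ z in Metric.closedBall y t, |f z - f x| := integral_nonneg fun z => abs_nonneg _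
  exact mul_le_mul h2 h1 h0 (by positivity)

lemma osc_nonneg (f : R3 → ℝ) (x : R3) (s : ℝ) : 0 ≤ osc f x s := integral_nonneg fun _ => abs_nonneg _

lemma osc_mono8 {f : R3 → ℝ} (hf : LocallyIntegrable f volume) {t s : ℝ} (ht : 0 < t) (hts : t ≤ s) (hs : s ≤ 2 * t)
    (x : R3) : osc f x t ≤ 8 * osc f x s := by
  have := shift_osc hf ht hs (x := x) (y := x) (by simpa using hts)
  simpa [osc] using this

lemma osc_meas {f : R3 → ℝ} (hf : Measurable f) (s : ℝ) : StronglyMeasurable (fun x => osc f x s) := by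
  have h : Measurable (fun p : R3 × R3 => |f (p.1 - s • p.2) - f p.1|) := by
    have h1 : Measurable (fun p : R3 × R3 => p.1 - s • p.2) := by fun_prop
    exact ((hf.comp h1).sub (hf.comp measurable_fst)).abs
  exact StronglyMeasurable.integral_prod_right (ν := volume.restrict (Metric.closedBall (0:R3) 1)) h.stronglyMeasurable

/-- the vector field potential -/
def krp (s : ℝ) (i : Fin 3) (z : R3) : ℝ := kr s z * (s⁻¹ * z i)

lemma krp_contDiff (s : ℝ) (i : Fin 3) : ContDiff ℝ (⊤ : ℕ∞) (krp s i) :=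
  (kr_contDiff s).mul (contDiff_const.mul (contDiff_apply ℝ ℝ i))

lemma krp_test {s : ℝ} (hs : 0 < s) (i : Fin 3) (x : R3) : IsTestFun (fun y => krp s i (x - y)) := by
  refine ⟨(krp_contDiff s i).comp (contDiff_const.sub contDiff_id), ?_⟩
  exact HasCompactSupport.comp_homeomorph (f := krp s i) ((kr_hcs hs).mul_right) (Homeomorph.subLeft x)

lemma krp_fderiv (s : ℝ) (x y v : R3) (i : Fin 3) :
    fderiv ℝ (fun y => krp s i (x - y)) y v = - (fderiv ℝ (kr s) (x - y) v * (s⁻¹ * (x - y) i) + kr s (x - y) * (s⁻¹ * v i)) := by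
  have h1 : HasFDerivAt (fun y : R3 => x - y) (-(ContinuousLinearMap.id ℝ R3)) y := by
    simpa using (hasFDerivAt_id (𝕜 := ℝ) y).const_sub x
  have h2 : HasFDerivAt (kr s) (fderiv ℝ (kr s) (x - y)) (x - y) :=
    ((kr_contDiff s).differentiable (by simp) _).hasFDerivAt
  have h3 : HasFDerivAt (fun z : R3 => s⁻¹ * z i) (s⁻¹ • (ContinuousLinearMap.proj i : R3 →L[ℝ] ℝ)) (x - y) :=
    ((ContinuousLinearMap.proj i : R3 →L[ℝ] ℝ).hasFDerivAt).const_mul s⁻¹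
  have h4 := (h2.mul h3).comp y h1
  have h5 : (fun y => krp s i (x - y)) = (kr s * fun z : R3 => s⁻¹ * z i) ∘ (fun y => x - y) := rfl
  rw [h5, h4.fderiv]
  simp
  ring

lemma kr_ds {s : ℝ} (hs : 0 < s) (z : R3) : HasDerivAt (fun t => kr t z)
    (-(s⁻¹ * fderiv ℝ (kr s) z z + 3 * (s⁻¹ * kr s z))) s := by
  have hi : HasDerivAt (fun t : ℝ => t⁻¹) (-(s ^ 2)⁻¹) s := hasDerivAt_inv hs.ne'
  have hr : HasFDerivAt rho (fderiv ℝ rho (s⁻¹ • z)) (s⁻¹ • z) :=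
    (rho_contDiff.differentiable (by simp) _).hasFDerivAt
  have h1 : HasDerivAt (fun t : ℝ => rho (t⁻¹ • z)) (fderiv ℝ rho (s⁻¹ • z) (-(s ^ 2)⁻¹ • z)) s :=
    hr.comp_hasDerivAt s (hi.smul_const z)
  have h2 := (hi.fun_pow 3).mul h1
  have h3 : fderiv ℝ (kr s) z z = s⁻¹ ^ 3 * fderiv ℝ rho (s⁻¹ • z) (s⁻¹ • z) := by
    have : HasFDerivAt (fun z : R3 => s⁻¹ ^ 3 * rho (s⁻¹ • z)) (s⁻¹ ^ 3 • ((fderiv ℝ rho (s⁻¹ • z)).comp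
        (s⁻¹ • ContinuousLinearMap.id ℝ R3))) z :=
      (hr.comp z ((hasFDerivAt_id (𝕜 := ℝ) z).const_smul s⁻¹)).const_mul _
    have e : kr s = fun z : R3 => s⁻¹ ^ 3 * rho (s⁻¹ • z) := rfl
    rw [e, this.fderiv]; simp
  refine h2.congr_deriv ?_
  rw [h3, map_smul, map_smul]
  simp only [kr, smul_eq_mul, Nat.add_one_sub_one, inv_pow]
  push_cast
  field_simp
  ring

lemma fderiv_diag (L : R3 →L[ℝ] ℝ) (z : R3) : ∑ i, L (ee i) * z i = L z := by
  conv_rhs => rw [vec_eq_sum z]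
  rw [map_sum]
  simp [mul_comm]

lemma mol_ds {u g} (h : W u g) {s : ℝ} (hs : 0 < s) (x : R3) :
    HasDerivAt (fun t => mol t u x) (- ∑ i, ∫ y, krp s i (x - y) * g i y) s := by
  obtain ⟨C, hC⟩ := h.bdd
  have hC0 : 0 ≤ C := (abs_nonneg _).trans (hC 0)
  obtain ⟨K, hK0, hK⟩ := rho_bdd
  -- bound of the derivative of rho
  obtain ⟨L, hL⟩ : ∃ L, ∀ w, ‖fderiv ℝ rho w‖ ≤ L :=
    (rho_contDiff.continuous_fderiv (by simp)).bounded_above_of_compact_support (rho_hcs.fderiv (𝕜 := ℝ))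
  have hL0 : 0 ≤ L := (norm_nonneg _).trans (hL 0)
  set F : ℝ → R3 → ℝ := fun t y => kr t (x - y) * u y
  set F' : ℝ → R3 → ℝ := fun t y => (-(t⁻¹ * fderiv ℝ (kr t) (x - y) (x - y) + 3 * (t⁻¹ * kr t (x - y)))) * u y
  have hF : ∀ t, 0 < t → Integrable (F t) volume := fun t ht =>
    Integrable.mul_bdd (c := C) (kr_test t ht x).integrable h.meas.aestronglyMeasurable (Eventually.of_forall hC)
  have hD : ∀ t, 0 < t → ∀ y, HasDerivAt (fun t => F t y) (F' t y) t := fun t ht y =>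
    (kr_ds ht (x - y)).mul_const (u y)
  have hF'm : AEStronglyMeasurable (F' s) volume := by
    refine Measurable.aestronglyMeasurable ?_
    have h1 : Continuous (fun y => fderiv ℝ (kr s) (x - y) (x - y)) := by
      have := (kr_contDiff s).continuous_fderiv (by simp)
      exact (this.comp (continuous_const.sub continuous_id)).clm_apply (continuous_const.sub continuous_id)
    have h2 : Continuous (fun y => kr s (x - y)) := (kr_test s hs x).cont
    exact (((h1.measurable.const_mul _).add ((h2.measurable.const_mul _).const_mul _)).neg).mul h.meas
  set M := (2 * s⁻¹) * ((2 * s⁻¹) ^ 3 * (L * 4)) + 3 * ((2 * s⁻¹) * ((2 * s⁻¹) ^ 3 * K))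
  set bound : R3 → ℝ := (Metric.closedBall x (2 * s)).indicator fun _ => M * C
  have hbi : Integrable bound volume :=
    (integrableOn_const (isCompact_closedBall _ _).measure_lt_top.ne).integrable_indicator Metric.isClosed_closedBall.measurableSet
  have hbd : ∀ y, ∀ t ∈ Metric.ball s (s / 2), ‖F' t y‖ ≤ bound y := by
    intro y t ht
    rw [Metric.mem_ball, Real.dist_eq, abs_lt] at ht
    have ht0 : 0 < t := by linarith [ht.1]
    have htinv : t⁻¹ ≤ 2 * s⁻¹ := by
      rw [← div_eq_mul_inv, inv_eq_one_div, div_le_div_iff₀ ht0 hs]; linarith [ht.1]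
    have h3 : fderiv ℝ (kr t) (x - y) (x - y) = t⁻¹ ^ 3 * fderiv ℝ rho (t⁻¹ • (x - y)) (t⁻¹ • (x - y)) := by
      have hr : HasFDerivAt rho (fderiv ℝ rho (t⁻¹ • (x - y))) (t⁻¹ • (x - y)) :=
        (rho_contDiff.differentiable (by simp) _).hasFDerivAt
      have : HasFDerivAt (fun z : R3 => t⁻¹ ^ 3 * rho (t⁻¹ • z)) (t⁻¹ ^ 3 • ((fderiv ℝ rho (t⁻¹ • (x - y))).comp
          (t⁻¹ • ContinuousLinearMap.id ℝ R3))) (x - y) :=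
        (hr.comp (x - y) ((hasFDerivAt_id (𝕜 := ℝ) (x - y)).const_smul t⁻¹)).const_mul _
      have e : kr t = fun z : R3 => t⁻¹ ^ 3 * rho (t⁻¹ • z) := rfl
      rw [e, this.fderiv]; simp
    by_cases hy : y ∈ Metric.closedBall x (2 * s)
    · simp only [bound, Set.indicator_of_mem hy, F']
      rw [norm_mul]
      refine mul_le_mul ?_ (hC y) (norm_nonneg _) (by positivity)
      rw [norm_neg]
      have hxy : ‖x - y‖ ≤ 2 * s := by rw [← dist_eq_norm, dist_comm]; exact hy
      have a1 : |fderiv ℝ rho (t⁻¹ • (x - y)) (t⁻¹ • (x - y))| ≤ L * 4 := by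
        refine ((fderiv ℝ rho (t⁻¹ • (x - y))).le_opNorm _).trans ?_
        refine mul_le_mul (hL _) ?_ (norm_nonneg _) hL0
        rw [norm_smul, norm_inv, Real.norm_eq_abs, abs_of_pos ht0]
        calc t⁻¹ * ‖x - y‖ ≤ (2 * s⁻¹) * (2 * s) := by gcongr
          _ = 4 := by field_simp; norm_num
      have a2 : |kr t (x - y)| ≤ (2 * s⁻¹) ^ 3 * K := by
        rw [abs_of_nonneg (kr_nonneg ht0 _), kr]
        have := hK (t⁻¹ • (x - y))
        have h0 := rho_nonneg (t⁻¹ • (x - y))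
        gcongr
      refine (norm_add_le _ _).trans ?_
      rw [norm_mul, norm_mul, norm_mul, h3]
      simp only [Real.norm_eq_abs]
      rw [abs_mul (t⁻¹ ^ 3), abs_of_pos (show 0 < t⁻¹ by positivity), abs_of_pos (show 0 < t⁻¹ ^ 3 by positivity),
        abs_of_pos (show (0:ℝ) < 3 by norm_num)]
      simp only [M]
      gcongr
    · have hy' : 1 ≤ ‖t⁻¹ • (x - y)‖ := by
        rw [Metric.mem_closedBall, not_le, dist_comm, dist_eq_norm] at hy
        rw [norm_smul, norm_inv, Real.norm_eq_abs, abs_of_pos ht0, ← div_eq_inv_mul, le_div_iff₀ ht0]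
        linarith [ht.2]
      have hd : fderiv ℝ rho (t⁻¹ • (x - y)) = 0 := by
        have hmin : IsLocalMin rho (t⁻¹ • (x - y)) :=
          Eventually.of_forall fun w => by rw [rho_zero hy']; exact rho_nonneg w
        exact hmin.fderiv_eq_zero
      simp only [bound, Set.indicator_of_notMem hy, F']
      rw [h3, hd, kr, rho_zero hy']; simp
  have key := (hasDerivAt_integral_of_dominated_loc_of_deriv_le (μ := volume) (F := F) (F' := F') (x₀ := s) (bound := bound)
    (Metric.ball_mem_nhds s (half_pos hs))
    (by filter_upwards [lt_mem_nhds hs] with t ht using (hF t ht).aestronglyMeasurable) (hF s hs) hF'm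
    (Eventually.of_forall hbd) hbi (Eventually.of_forall fun y t ht => hD t (by
      rw [Metric.mem_ball, Real.dist_eq, abs_lt] at ht; linarith [ht.1]) y)).2
  have e1 : (fun t => mol t u x) =ᶠ[𝓝 s] fun t => ∫ y, F t y := by
    filter_upwards [lt_mem_nhds hs] with t ht using mol_eq_kr ht u x
  refine (key.congr_of_eventuallyEq e1).congr_deriv ?_
  have e2 : ∀ y, F' s y = ∑ i, fderiv ℝ (fun y => krp s i (x - y)) y (ee i) * u y := by
    intro y
    simp only [F']
    rw [← Finset.sum_mul]
    congr 1
    simp_rw [krp_fderiv]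
    rw [Finset.sum_neg_distrib, Finset.sum_add_distrib]
    congr 2
    · rw [← fderiv_diag, Finset.mul_sum]
      exact Finset.sum_congr rfl fun i _ => by ring
    · simp [ee]; ring
  rw [integral_congr_ae (Eventually.of_forall e2), integral_finsetSum]
  · rw [← Finset.sum_neg_distrib]
    exact Finset.sum_congr rfl fun i _ => h.weak i _ (krp_test hs i x)
  · intro i _
    exact Integrable.mul_bdd (c := C) ((krp_test hs i x).d (ee i)).integrable h.meas.aestronglyMeasurable (Eventually.of_forall hC)

lemma rho_odd (i : Fin 3) : ∫ w : R3, rho w * w i = 0 := by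
  have h := integral_neg_eq_self (fun w : R3 => rho w * w i) volume
  simp only [rho_neg, Pi.neg_apply, mul_neg] at h
  rw [integral_neg] at h
  linarith

lemma krp_int {s : ℝ} (hs : 0 < s) (i : Fin 3) (g : R3 → ℝ) (x : R3) :
    ∫ y, krp s i (x - y) * g y = ∫ w, (rho w * w i) * g (x - s • w) := by
  have h := int_affine hs (fun y => krp s i (x - y) * g y) x
  simp only [sub_sub_cancel, krp, kr, smul_smul, inv_mul_cancel₀ hs.ne', one_smul, Pi.smul_apply, smul_eq_mul] at h
  have e : ∀ w : R3, s⁻¹ ^ 3 * rho w * (s⁻¹ * (s * w i)) * g (x - s • w) = s⁻¹ ^ 3 * ((rho w * w i) * g (x - s • w)) :=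
    fun w => by field_simp
  rw [integral_congr_ae (Eventually.of_forall e), integral_const_mul] at h
  have h3 : s⁻¹ ^ 3 ≠ 0 := by positivity
  exact (mul_left_cancel₀ h3 h).symm

lemma krp_bound {s : ℝ} (hs : 0 < s) (i : Fin 3) {g : R3 → ℝ} (hg : LocallyIntegrable g volume) (x : R3)
    {K : ℝ} (hK : ∀ w, rho w ≤ K) :
    |∫ y, krp s i (x - y) * g y| ≤ K * osc g x s := by
  have hK0 : 0 ≤ K := (rho_nonneg 0).trans (hK 0)
  have hrt : IsTestFun (fun w : R3 => rho w * w i) :=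
    rho_test.mul (contDiff_apply ℝ ℝ i)
  set S := Metric.closedBall (0 : R3) 1
  have hSm : MeasurableSet S := Metric.isClosed_closedBall.measurableSet
  have hSc : IsCompact S := isCompact_closedBall _ _
  have hi : IntegrableOn (fun w => |g (x - s • w) - g x|) S volume := by
    have h1 := integrableOn_affine hs hg x 1
    exact (h1.sub (integrableOn_const hSc.measure_lt_top.ne)).abs
  have hle : ∀ w, ‖(rho w * w i) * (g (x - s • w) - g x)‖ ≤ S.indicator (fun w => K * |g (x - s • w) - g x|) w := by
    intro w
    by_cases hw : w ∈ S
    · rw [Set.indicator_of_mem hw, norm_mul]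
      refine mul_le_mul_of_nonneg_right ?_ (norm_nonneg _)
      rw [norm_mul, Real.norm_eq_abs, abs_of_nonneg (rho_nonneg w)]
      have h1 : ‖w i‖ ≤ 1 := (norm_le_pi_norm w i).trans (by simpa [S] using hw)
      calc rho w * ‖w i‖ ≤ K * 1 := mul_le_mul (hK w) h1 (norm_nonneg _) hK0
        _ = K := mul_one K
    · have : 1 ≤ ‖w‖ := by simp [S] at hw; exact hw.le
      rw [rho_zero this, Set.indicator_of_notMem hw]; simp
  have hI : Integrable (S.indicator (fun w => K * |g (x - s • w) - g x|)) volume :=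
    IntegrableOn.integrable_indicator (hi.const_mul K) hSm
  have hb : |∫ w, (rho w * w i) * (g (x - s • w) - g x)| ≤ K * osc g x s := by
    refine (norm_integral_le_of_norm_le hI (Eventually.of_forall hle)).trans (le_of_eq ?_)
    rw [integral_indicator hSm, integral_const_mul, osc]
  rw [krp_int hs]
  have hsm : AEStronglyMeasurable (fun w => g (x - s • w)) volume := by
    have : Measure.map (fun w : R3 => x - s • w) volume ≪ volume := by
      have hq : Measure.QuasiMeasurePreserving (fun w : R3 => x - s • w) volume volume := by
        have h1 : Measure.QuasiMeasurePreserving (fun w : R3 => s • w) volume volume :=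
          ⟨by fun_prop, by
            rw [Measure.map_addHaar_smul _ hs.ne']
            exact Measure.smul_absolutelyContinuous⟩
        exact (quasiMeasurePreserving_sub_left volume x).comp h1
      exact hq.absolutelyContinuous
    exact (hg.aestronglyMeasurable.mono_ac this).comp_measurable (by fun_prop)
  have hintg : Integrable (fun w => (rho w * w i) * (g (x - s • w) - g x)) volume := by
    exact hI.mono' (hrt.cont.aestronglyMeasurable.mul (hsm.sub aestronglyMeasurable_const)) (Eventually.of_forall hle)
  have e : ∫ w, (rho w * w i) * g (x - s • w) = ∫ w, (rho w * w i) * (g (x - s • w) - g x) := by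
    have h2 := hrt.integrable.mul_const (g x)
    have : ∀ w, (rho w * w i) * g (x - s • w) = (rho w * w i) * (g (x - s • w) - g x) + rho w * w i * g x := fun w => by ring
    rw [integral_congr_ae (Eventually.of_forall this), integral_add hintg h2, integral_mul_const, rho_odd, zero_mul, add_zero]
  rw [e]; exact hb

lemma mol_dist {u g} (h : W u g) {x : R3} (hx : Tendsto (fun s => mol s u x) (𝓝[>] 0) (𝓝 (u x)))
    {K : ℝ} (hK : ∀ w, rho w ≤ K) {s om : ℝ} (hs : 0 < s) (hom : ∀ t, 0 < t → t ≤ s → ∑ i, osc (g i) x t ≤ om) :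
    |mol s u x - u x| ≤ K * om * s := by
  have hK0 : 0 ≤ K := (rho_nonneg 0).trans (hK 0)
  have ho0 : 0 ≤ om := (Finset.sum_nonneg fun i _ => osc_nonneg (g i) x s).trans (hom s hs le_rfl)
  have key : ∀ t, 0 < t → t ≤ s → |mol s u x - mol t u x| ≤ K * om * s := by
    intro t ht hts
    have := (convex_Icc t s).norm_image_sub_le_of_norm_hasDerivWithin_le (C := K * om)
      (f := fun t => mol t u x) (f' := fun r => - ∑ i, ∫ y, krp r i (x - y) * g i y) (x := t) (y := s)
      (fun r hr => (mol_ds h (ht.trans_le hr.1) x).hasDerivWithinAt) (fun r hr => by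
        rw [norm_neg]
        have hr0 := ht.trans_le hr.1
        calc _ ≤ ∑ i, |∫ y, krp r i (x - y) * g i y| := norm_sum_le _ _
          _ ≤ ∑ i, K * osc (g i) x r := Finset.sum_le_sum fun i _ => krp_bound hr0 i (h.gloc i) x hK
          _ = K * ∑ i, osc (g i) x r := by rw [Finset.mul_sum]
          _ ≤ K * om := mul_le_mul_of_nonneg_left (hom r hr0 hr.2) hK0) ⟨le_rfl, hts⟩ ⟨hts, le_rfl⟩
    refine this.trans ?_
    rw [Real.norm_eq_abs, abs_of_nonneg (by linarith)]
    gcongr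
    linarith
  have h2 : Tendsto (fun t => |mol s u x - mol t u x|) (𝓝[>] 0) (𝓝 |mol s u x - u x|) :=
    (tendsto_const_nhds.sub hx).abs
  refine le_of_tendsto h2 ?_
  have : Set.Ioo 0 s ∈ 𝓝[>] (0:ℝ) := Ioo_mem_nhdsGT hs
  filter_upwards [this] with t ht using key t ht.1 ht.2.le

/-- the candidate derivative -/
def Lg (g : Fin 3 → R3 → ℝ) (x : R3) : R3 →L[ℝ] ℝ := ∑ i, g i x • (ContinuousLinearMap.proj i : R3 →L[ℝ] ℝ)

lemma Lg_apply (g : Fin 3 → R3 → ℝ) (x v : R3) : Lg g x v = ∑ i, g i x * v i := by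
  simp [Lg]

lemma taylor_est {u g} (h : W u g) {K : ℝ} (hK : ∀ w, rho w ≤ K) {x z : R3}
    (hx : Tendsto (fun s => mol s u x) (𝓝[>] 0) (𝓝 (u x))) (hz : Tendsto (fun s => mol s u z) (𝓝[>] 0) (𝓝 (u z)))
    (hne : x ≠ z) {om : ℝ} (hox : ∀ t, 0 < t → t ≤ 2 * ‖z - x‖ → ∑ i, osc (g i) x t ≤ om)
    (hoz : ∀ t, 0 < t → t ≤ 2 * ‖z - x‖ → ∑ i, osc (g i) z t ≤ om) :
    |u z - u x - Lg g x (z - x)| ≤ 10 * K * om * ‖z - x‖ := by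
  have hK0 : 0 ≤ K := (rho_nonneg 0).trans (hK 0)
  set s := ‖z - x‖ with hsd
  have hs : 0 < s := norm_pos_iff.2 (sub_ne_zero.2 hne.symm)
  have h1 := mol_dist h hx hK hs fun t h0 h1 => hox t h0 (by linarith)
  have h2 := mol_dist h hz hK hs fun t h0 h1 => hoz t h0 (by linarith)
  have h3 : |mol s u z - mol s u x - Lg g x (z - x)| ≤ 8 * K * om * s := by
    have hd : ∀ y, HasFDerivAt (fun y => mol s u y - Lg g x y) (fderiv ℝ (mol s u) y - Lg g x) y := fun y =>
      (((mol_contDiff hs h.locInt).differentiable (by simp) y).hasFDerivAt).sub (Lg g x).hasFDerivAt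
    have hb : ∀ y ∈ Metric.closedBall x s, ‖fderiv ℝ (mol s u) y - Lg g x‖ ≤ 8 * K * om := by
      intro y hy
      have ho0 : 0 ≤ om := (Finset.sum_nonneg fun i _ => osc_nonneg (g i) x s).trans (hox s hs (by linarith))
      have hsum : ∑ i, |mol s (g i) y - g i x| ≤ 8 * K * om := by
        calc _ ≤ ∑ i, K * (8 * osc (g i) x (2 * s)) := Finset.sum_le_sum fun i _ => by
              refine (mol_sub_le (h.gloc i) hK hs y (g i x)).trans ?_
              refine mul_le_mul_of_nonneg_left ?_ hK0
              exact shift_osc (h.gloc i) hs le_rfl (by have := Metric.mem_closedBall.1 hy; linarith)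
          _ = 8 * K * ∑ i, osc (g i) x (2 * s) := by rw [Finset.mul_sum]; exact Finset.sum_congr rfl fun i _ => by ring
          _ ≤ _ := mul_le_mul_of_nonneg_left (hox _ (by linarith) le_rfl) (by positivity)
      refine ContinuousLinearMap.opNorm_le_bound _ (by positivity) fun v => ?_
      rw [fderiv_apply_sum, Real.norm_eq_abs]
      refine (Finset.abs_sum_le_sum_abs _ _).trans ?_
      calc _ ≤ ∑ i, |mol s (g i) y - g i x| * ‖v‖ := Finset.sum_le_sum fun i _ => by
            have e : (fderiv ℝ (mol s u) y - Lg g x) (ee i) = mol s (g i) y - g i x := by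
              rw [ContinuousLinearMap.sub_apply, h.mol_deriv hs, Lg_apply]
              simp [ee, Pi.single_apply]
            rw [e, abs_mul, mul_comm]
            exact mul_le_mul_of_nonneg_left (norm_le_pi_norm v i) (abs_nonneg _)
        _ = (∑ i, |mol s (g i) y - g i x|) * ‖v‖ := by rw [Finset.sum_mul]
        _ ≤ _ := mul_le_mul_of_nonneg_right hsum (norm_nonneg _)
    have := (convex_closedBall x s).norm_image_sub_le_of_norm_hasFDerivWithin_le
      (fun y _ => (hd y).hasFDerivWithinAt) hb (Metric.mem_closedBall_self hs.le)
      (show z ∈ Metric.closedBall x s by rw [Metric.mem_closedBall, dist_eq_norm])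
    rw [map_sub]
    calc _ = ‖mol s u z - Lg g x z - (mol s u x - Lg g x x)‖ := by rw [Real.norm_eq_abs]; congr 1; ring
      _ ≤ _ := this
  rw [abs_le] at *
  constructor <;> linarith [h1.1, h1.2, h2.1, h2.2, h3.1, h3.2]

theorem approx_diff {u : Fin 3 → R3 → ℝ} {g : Fin 3 → Fin 3 → R3 → ℝ} (h : ∀ b, W (u b) (g b)) :
    ∃ E : ℕ → Set R3, (∀ j, MeasurableSet (E j)) ∧ (∀ᵐ x, x ∈ ⋃ j, E j) ∧
      ∀ j, ∀ x ∈ E j, ∀ b, HasFDerivWithinAt (u b) (Lg (g b) x) (E j) x := by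
  obtain ⟨K, hK0, hK⟩ := rho_bdd
  set O : R3 → ℝ → ℝ := fun x s => ∑ b, ∑ i, osc (g b i) x s with hO
  have hO1 : ∀ b x s, ∑ i, osc (g b i) x s ≤ O x s := fun b x s =>
    Finset.single_le_sum (f := fun b => ∑ i, osc (g b i) x s)
      (fun b _ => Finset.sum_nonneg fun i _ => osc_nonneg _ _ _) (Finset.mem_univ b)
  have hOm : ∀ s, StronglyMeasurable (fun x => O x s) := fun s => by
    have : Measurable (fun x => O x s) := Finset.measurable_sum _ fun b _ => Finset.measurable_sum _ fun i _ =>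
      (osc_meas ((h b).gmeas i) s).measurable
    exact this.stronglyMeasurable
  have hae : ∀ᵐ x, Tendsto (O x) (𝓝[>] 0) (𝓝 0) := by
    have : ∀ᵐ x, ∀ b i, Tendsto (osc (g b i) x) (𝓝[>] 0) (𝓝 0) := by
      rw [ae_all_iff]; intro b; rw [ae_all_iff]; intro i; exact leb_osc ((h b).gloc i)
    filter_upwards [this] with x hx
    have := tendsto_finsetSum Finset.univ fun b _ => tendsto_finsetSum Finset.univ fun i _ => hx b i
    simpa using this
  have hpow : Tendsto (fun k : ℕ => ((1/2 : ℝ)) ^ k) atTop (𝓝[>] 0) := by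
    rw [tendsto_nhdsWithin_iff]
    exact ⟨tendsto_pow_atTop_nhds_zero_of_lt_one (by norm_num) (by norm_num), Eventually.of_forall fun k => by
      simp⟩
  set μ' := (volume : Measure R3).toFinite
  have hac : μ' ≪ volume := toFinite_absolutelyContinuous volume
  have hac' : (volume : Measure R3) ≪ μ' := absolutelyContinuous_toFinite volume
  have hEg := fun j : ℕ => tendstoUniformlyOn_of_ae_tendsto' (μ := μ') (f := fun k x => O x ((1/2) ^ k)) (g := fun _ => 0)
    (fun k => hOm _) stronglyMeasurable_const (hac.ae_le (hae.mono fun x hx => hx.comp hpow))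
    (show (0:ℝ) < 1 / (j + 1) by positivity)
  choose t htm htμ htu using hEg
  have hmol : ∀ᵐ x, ∀ b, Tendsto (fun s => mol s (u b) x) (𝓝[>] 0) (𝓝 (u b x)) := by
    rw [ae_all_iff]; intro b; exact mol_tendsto_ae (h b).locInt
  obtain ⟨Z, hZsub, hZm, hZ0⟩ := exists_measurable_superset_of_null (ae_iff.1 hmol)
  refine ⟨fun j => (t j)ᶜ ∩ Zᶜ, fun j => (htm j).compl.inter hZm.compl, ?_, ?_⟩
  · have h1 : μ' (⋂ j, t j) = 0 := by
      have : ∀ j : ℕ, μ' (⋂ j, t j) ≤ ENNReal.ofReal (1 / (j + 1)) := fun j =>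
        (measure_mono (Set.iInter_subset t j)).trans (htμ j)
      have hl : Tendsto (fun j : ℕ => ENNReal.ofReal (1 / ((j:ℝ) + 1))) atTop (𝓝 0) := by
        have := ENNReal.tendsto_ofReal (tendsto_one_div_add_atTop_nhds_zero_nat (𝕜 := ℝ))
        simpa using this
      exact le_antisymm (ge_of_tendsto hl (Eventually.of_forall this)) (zero_le)
    have h2 : volume (⋂ j, t j) = 0 := hac' h1
    rw [ae_iff]
    refine measure_mono_null (t := (⋂ j, t j) ∪ Z) (fun x hx => ?_) (measure_union_null h2 hZ0)
    simp only [Set.mem_setOf_eq, Set.mem_iUnion, Set.mem_inter_iff, Set.mem_compl_iff, not_exists, not_and, not_not] at hx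
    by_cases hz : x ∈ Z
    · exact Or.inr hz
    · refine Or.inl (Set.mem_iInter.2 fun j => ?_)
      by_contra hc; exact hz (hx j hc)
  · intro j x hx b
    have hgood : ∀ y ∈ (t j)ᶜ ∩ Zᶜ, Tendsto (fun s => mol s (u b) y) (𝓝[>] 0) (𝓝 (u b y)) := fun y hy => by
      by_contra hc
      exact hy.2 (hZsub fun hh => hc (hh b))
    refine HasFDerivWithinAt.of_isLittleO (Asymptotics.isLittleO_iff.2 fun c hc => ?_)
    set η := c / (80 * K)
    have hη : 0 < η := by positivity
    have hu := Metric.tendstoUniformlyOn_iff.1 (htu j) η hη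
    obtain ⟨k0, hk0⟩ := eventually_atTop.1 hu
    have hosc : ∀ y ∈ (t j)ᶜ, ∀ σ, 0 < σ → σ ≤ (1/2) ^ k0 → O y σ ≤ 8 * η := by
      intro y hy σ h0 h1
      obtain ⟨k, hk1, hk2⟩ := exists_nat_pow_near_of_lt_one h0
        (h1.trans (pow_le_one₀ (by norm_num) (by norm_num))) (show (0:ℝ) < 1/2 by norm_num) (by norm_num)
      have hkk : k0 ≤ k := by
        have : (1/2:ℝ) ^ (k+1) < (1/2) ^ k0 := hk1.trans_le h1
        have := (pow_lt_pow_iff_right_of_lt_one₀ (by norm_num) (by norm_num)).1 this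
        omega
      have h3 := hk0 k hkk y hy
      rw [dist_comm, Real.dist_eq, sub_zero] at h3
      have h4 : O y σ ≤ 8 * O y ((1/2) ^ k) := by
        simp only [hO, Finset.mul_sum]
        refine Finset.sum_le_sum fun b _ => Finset.sum_le_sum fun i _ => ?_
        exact osc_mono8 ((h b).gloc i) h0 hk2 (by rw [pow_succ] at hk1; linarith) y
      linarith [le_abs_self (O y ((1/2) ^ k))]
    have hball : Metric.ball x ((1/2) ^ k0 / 2) ∈ 𝓝[(t j)ᶜ ∩ Zᶜ] x :=
      mem_nhdsWithin_of_mem_nhds (Metric.ball_mem_nhds _ (by positivity))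
    filter_upwards [hball, self_mem_nhdsWithin] with z hz1 hz2
    rcases eq_or_ne x z with rfl | hne
    · simp
    · rw [Metric.mem_ball, dist_eq_norm] at hz1
      have := taylor_est (h b) hK (hgood x hx) (hgood z hz2) hne (om := 8 * η)
        (fun t h0 h1 => (hO1 b x t).trans (hosc x hx.1 t h0 (by linarith)))
        (fun t h0 h1 => (hO1 b z t).trans (hosc z hz2.1 t h0 (by linarith)))
      refine this.trans (le_of_eq ?_)
      simp only [η]; field_simp; norm_num

lemma inj_partition {f : R3 → R3} {f' : R3 → R3 →L[ℝ] R3} {s : Set R3}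
    (hf' : ∀ x ∈ s, HasFDerivWithinAt f (f' x) s x) (hd : ∀ x ∈ s, (f' x).det ≠ 0) :
    ∃ t : ℕ → Set R3, Pairwise (Function.onFun Disjoint t) ∧ (∀ n, MeasurableSet (t n)) ∧ (s ⊆ ⋃ n, t n) ∧
      ∀ n, Set.InjOn f (s ∩ t n) := by
  classical
  let r : (R3 →L[ℝ] R3) → NNReal := fun A =>
    if h : A.det ≠ 0 then (‖((A.toContinuousLinearEquivOfDetNeZero h).symm : R3 →L[ℝ] R3)‖₊)⁻¹ / 2 else 1
  have rpos : ∀ A, r A ≠ 0 := by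
    intro A
    simp only [r]
    split_ifs with h
    · have := ContinuousLinearEquiv.nnnorm_symm_pos (A.toContinuousLinearEquivOfDetNeZero h)
      exact (div_pos (inv_pos.2 this) two_pos).ne'
    · exact one_ne_zero
  obtain ⟨t, A, h1, h2, h3, h4, h5⟩ := exists_partition_approximatesLinearOn_of_hasFDerivWithinAt f s f' hf' r rpos
  refine ⟨t, h1, h2, h3, fun n => ?_⟩
  rcases s.eq_empty_or_nonempty with rfl | hne
  · simp
  obtain ⟨y, hy, hA⟩ := h5 hne n
  have hdA : (A n).det ≠ 0 := hA ▸ hd y hy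
  have h6 := h4 n
  have h7 : ApproximatesLinearOn f (((A n).toContinuousLinearEquivOfDetNeZero hdA : R3 ≃L[ℝ] R3) : R3 →L[ℝ] R3) (s ∩ t n) (r (A n)) := by
    convert h6
    ext v; rfl
  refine h7.injOn (Or.inr ?_)
  have := ContinuousLinearEquiv.nnnorm_symm_pos ((A n).toContinuousLinearEquivOfDetNeZero hdA)
  simp only [r, dif_pos hdA]
  exact NNReal.half_lt_self (inv_pos.2 this).ne'

lemma int_tsum {ι : Type*} {f : ι → ℝ} (h : ∀ i, f i = 0 ∨ f i = 1 ∨ f i = -1) : ∃ m : ℤ, ∑' i, f i = m := by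
  by_cases hs : Summable f
  · have h0 := hs.tendsto_cofinite_zero
    have h1 := Metric.tendsto_nhds.1 h0 1 one_pos
    have hfin : (Function.support f).Finite := by
      refine Set.Finite.subset (Filter.mem_cofinite.1 h1) fun i hi => ?_
      simp only [Function.mem_support] at hi
      have : ¬ dist (f i) 0 < 1 := by
        rcases h i with h | h | h
        · exact absurd h hi
        · rw [h]; simp
        · rw [h]; simp
      exact this
    rw [tsum_eq_sum (s := hfin.toFinset) (by intro b hb; simpa using hb)]
    choose k hk using fun i => (show ∃ k : ℤ, f i = k by
      rcases h i with h | h | h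
      · exact ⟨0, by simp [h]⟩
      · exact ⟨1, by simp [h]⟩
      · exact ⟨-1, by simp [h]⟩)
    refine ⟨∑ i ∈ hfin.toFinset, k i, ?_⟩
    push_cast
    exact Finset.sum_congr rfl fun i _ => hk i
  · exact ⟨0, by rw [tsum_eq_zero_of_not_summable hs]; simp⟩

lemma count_fun {ι : Type} [Countable ι] {A : ι → Set R3} (hA : ∀ i, MeasurableSet (A i)) (hs : ∑' i, volume (A i) ≠ ⊤)
    {σ : ι → ℝ} (hσ : ∀ i, σ i = 1 ∨ σ i = -1) :
    ∃ N : R3 → ℝ, Integrable N volume ∧ (∀ z, ∃ m : ℤ, N z = m) ∧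
      ∀ h : R3 → ℝ, Measurable h → (∃ C, ∀ z, |h z| ≤ C) → HasSum (fun i => σ i * ∫ z in A i, h z) (∫ z, h z * N z) := by
  have hσ1 : ∀ i, |σ i| = 1 := fun i => by rcases hσ i with h | h <;> simp [h]
  have hAf : ∀ i, volume (A i) ≠ ⊤ := fun i => ENNReal.ne_top_of_tsum_ne_top hs i
  have hsum : Summable (fun i => (volume (A i)).toReal) := ENNReal.summable_toReal hs
  set N : R3 → ℝ := fun z => ∑' i, (A i).indicator (fun _ => σ i) z with hN
  have hFi : ∀ i, Integrable ((A i).indicator (fun _ => σ i)) volume := fun i =>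
    (integrableOn_const (hAf i)).integrable_indicator (hA i)
  have hFn : ∀ i, ∫⁻ z, ‖(A i).indicator (fun _ => σ i) z‖ₑ = volume (A i) := by
    intro i
    have : ∀ z, ‖(A i).indicator (fun _ => σ i) z‖ₑ = (A i).indicator (fun _ => (1:ℝ≥0∞)) z := by
      intro z
      rw [enorm_indicator_eq_indicator_enorm]
      congr 1
      ext z
      rw [← ofReal_norm_eq_enorm, Real.norm_eq_abs, hσ1]; simp
    simp_rw [this]
    rw [lintegral_indicator (hA i)]; simp
  have hfin : ∑' i, ∫⁻ z, ‖(A i).indicator (fun _ => σ i) z‖ₑ ≠ ⊤ := by simp_rw [hFn]; exact hs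
  have hNm : Measurable N := by
    haveI := Encodable.ofCountable ι
    refine Measurable.tsum fun i => ?_
    exact measurable_const.indicator (hA i)
  have hNi : Integrable N volume := by
    refine ⟨hNm.aestronglyMeasurable, ?_⟩
    rw [hasFiniteIntegral_iff_enorm]
    calc ∫⁻ z, ‖N z‖ₑ ≤ ∫⁻ z, ∑' i, ‖(A i).indicator (fun _ => σ i) z‖ₑ := lintegral_mono fun z => enorm_tsum_le_tsum_enorm
      _ = ∑' i, ∫⁻ z, ‖(A i).indicator (fun _ => σ i) z‖ₑ :=
        lintegral_tsum fun i => (hFi i).aestronglyMeasurable.enorm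
      _ < ⊤ := lt_top_iff_ne_top.2 hfin
  refine ⟨N, hNi, fun z => int_tsum fun i => ?_, fun h hm ⟨C, hC⟩ => ?_⟩
  · by_cases hz : z ∈ A i
    · rw [Set.indicator_of_mem hz]; exact Or.inr (hσ i)
    · rw [Set.indicator_of_notMem hz]; exact Or.inl rfl
  · set F : ι → R3 → ℝ := fun i z => h z * (A i).indicator (fun _ => σ i) z
    have hC0 : 0 ≤ C := (abs_nonneg _).trans (hC 0)
    have h1 : ∀ i, Integrable (F i) volume := fun i =>
      Integrable.bdd_mul (c := C) (hFi i) hm.aestronglyMeasurable (Eventually.of_forall hC)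
    have hb : ∀ i, ∫ z, ‖F i z‖ ≤ C * (volume (A i)).toReal := by
      intro i
      have : ∀ z, ‖F i z‖ ≤ C * (A i).indicator (fun _ => (1:ℝ)) z := by
        intro z
        simp only [F]
        rw [norm_mul]
        refine mul_le_mul (hC z) ?_ (norm_nonneg _) hC0
        by_cases hz : z ∈ A i
        · rw [Set.indicator_of_mem hz, Set.indicator_of_mem hz, Real.norm_eq_abs, hσ1]
        · rw [Set.indicator_of_notMem hz, Set.indicator_of_notMem hz]; simp
      refine (integral_mono (h1 i).norm (((integrableOn_const (C := (1:ℝ)) (hAf i)).integrable_indicator (hA i)).const_mul C) this).trans ?_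
      rw [integral_const_mul, integral_indicator (hA i)]
      simp [Measure.real]
    have h2 : Summable (fun i => ∫ z, ‖F i z‖) :=
      Summable.of_nonneg_of_le (fun i => integral_nonneg fun z => norm_nonneg _) hb (hsum.mul_left C)
    have h3 := hasSum_integral_of_summable_integral_norm h1 h2
    have e1 : (fun i => σ i * ∫ z in A i, h z) = fun i => ∫ z, F i z := by
      ext i
      rw [← integral_const_mul, ← integral_indicator (hA i)]
      congr 1; ext z
      by_cases hz : z ∈ A i
      · simp [F, hz, mul_comm]
      · simp [F, hz]
    have e2 : ∫ z, h z * N z = ∫ z, ∑' i, F i z := by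
      congr 1; ext z
      simp only [hN, F]
      rw [tsum_mul_left]
    rw [e1, e2]
    exact h3

theorem area_int {f : R3 → R3} {f' : R3 → R3 →L[ℝ] R3} {E : ℕ → Set R3} (hE : ∀ j, MeasurableSet (E j))
    (hcov : ∀ᵐ x, x ∈ ⋃ j, E j) (hd : ∀ j, ∀ x ∈ E j, HasFDerivWithinAt f (f' x) (E j) x) (hfm : Measurable f)
    {P : Set R3} (hP : MeasurableSet P) (hDm : Measurable fun x => (f' x).det)
    (hDi : IntegrableOn (fun x => (f' x).det) P volume) :
    ∃ N : R3 → ℝ, Integrable N volume ∧ (∀ z, ∃ m : ℤ, N z = m) ∧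
      ∀ h : R3 → ℝ, Measurable h → (∃ C, ∀ z, |h z| ≤ C) → ∫ x in P, h (f x) * (f' x).det = ∫ z, h z * N z := by
  let σ : Bool → ℝ := fun b => if b then 1 else -1
  let s : ℕ → Bool → Set R3 := fun j b => (disjointed E j ∩ P) ∩ {x | 0 < σ b * (f' x).det}
  have hsm : ∀ j b, MeasurableSet (s j b) := fun j b =>
    ((MeasurableSet.disjointed hE j).inter hP).inter (measurableSet_lt measurable_const (hDm.const_mul _))
  have hsd : ∀ j b, ∀ x ∈ s j b, HasFDerivWithinAt f (f' x) (s j b) x := fun j b x hx =>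
    (hd j x (disjointed_subset E j hx.1.1)).mono fun y hy => disjointed_subset E j hy.1.1
  have hs0 : ∀ j b, ∀ x ∈ s j b, (f' x).det ≠ 0 := fun j b x hx h0 => by
    have := hx.2; simp [h0] at this
  choose t ht1 ht2 ht3 ht4 using fun j b => inj_partition (hsd j b) (hs0 j b)
  let S : ℕ × Bool × ℕ → Set R3 := fun p => s p.1 p.2.1 ∩ t p.1 p.2.1 p.2.2
  have hSm : ∀ p, MeasurableSet (S p) := fun p => (hsm _ _).inter (ht2 _ _ _)
  have hSd : Pairwise (Function.onFun Disjoint S) := by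
    rintro ⟨j, b, n⟩ ⟨j', b', n'⟩ hne
    rw [Function.onFun, Set.disjoint_left]
    rintro x ⟨⟨⟨hx1, -⟩, hx2⟩, hx3⟩ ⟨⟨⟨hy1, -⟩, hy2⟩, hy3⟩
    have hj : j = j' := by
      by_contra hj
      exact Set.disjoint_left.1 (disjoint_disjointed E hj) hx1 hy1
    subst hj
    have hb : b = b' := by
      by_contra hb
      simp only [σ, Set.mem_setOf_eq] at hx2 hy2
      cases b <;> cases b' <;> simp at hb hx2 hy2 <;> linarith
    subst hb
    have hn : n = n' := by
      by_contra hn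
      exact Set.disjoint_left.1 (ht1 j b hn) hx3 hy3
    exact hne (by rw [hn])
  have hSder : ∀ p, ∀ x ∈ S p, HasFDerivWithinAt f (f' x) (S p) x := fun p x hx =>
    (hsd _ _ x hx.1).mono Set.inter_subset_left
  have hSinj : ∀ p, Set.InjOn f (S p) := fun p => ht4 _ _ _
  have hSP : (⋃ p, S p) ⊆ P := Set.iUnion_subset fun p x hx => hx.1.1.2
  have hSrest : ∀ᵐ x, x ∈ P \ ⋃ p, S p → (f' x).det = 0 := by
    filter_upwards [hcov] with x hx hxP
    by_contra h0
    rw [← iUnion_disjointed] at hx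
    obtain ⟨j, hj⟩ := Set.mem_iUnion.1 hx
    obtain ⟨b, hb⟩ : ∃ b, 0 < σ b * (f' x).det := by
      rcases lt_or_gt_of_ne h0 with h | h
      · exact ⟨false, by simp [σ]; exact h⟩
      · exact ⟨true, by simp [σ]; exact h⟩
    have hxs : x ∈ s j b := ⟨⟨hj, hxP.1⟩, hb⟩
    obtain ⟨n, hn⟩ := Set.mem_iUnion.1 (ht3 j b hxs)
    exact hxP.2 (Set.mem_iUnion.2 ⟨(j, b, n), hxs, hn⟩)
  have hAm : ∀ p, MeasurableSet (Set.image f (S p)) := fun p => measurable_image_of_fderivWithin (hSm p) (hSder p) (hSinj p)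
  have hvol : ∑' p, volume (Set.image f (S p)) ≠ ⊤ := by
    have e : ∀ p, volume (Set.image f (S p)) = ∫⁻ x in S p, ENNReal.ofReal |(f' x).det| := fun p =>
      (lintegral_abs_det_fderiv_eq_addHaar_image volume (hSm p) (hSder p) (hSinj p)).symm
    simp_rw [e]
    rw [← lintegral_iUnion hSm hSd]
    refine ne_top_of_le_ne_top ?_ (lintegral_mono_set hSP)
    have := hDi.2
    rw [hasFiniteIntegral_iff_norm] at this
    exact this.ne
  obtain ⟨N, hN1, hN2, hN3⟩ := count_fun (A := fun p => Set.image f (S p)) hAm hvol (σ := fun p => σ p.2.1)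
    (fun p => by rcases p with ⟨j, b, n⟩; cases b <;> simp [σ])
  refine ⟨N, hN1, hN2, fun h hm hC => ?_⟩
  have h3 := hN3 h hm hC
  obtain ⟨C, hC⟩ := hC
  have hintg : IntegrableOn (fun x => h (f x) * (f' x).det) P volume :=
    Integrable.bdd_mul (c := C) hDi (hm.comp hfm).aestronglyMeasurable (Eventually.of_forall fun x => hC _)
  have h4 := hasSum_integral_iUnion hSm hSd (hintg.mono_set hSP)
  have h5 : ∫ x in P, h (f x) * (f' x).det = ∫ x in ⋃ p, S p, h (f x) * (f' x).det := by
    refine setIntegral_eq_of_subset_of_ae_diff_eq_zero hP.nullMeasurableSet hSP ?_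
    filter_upwards [hSrest] with x hx hx2
    rw [hx hx2, mul_zero]
  rw [h5]
  refine h4.unique ?_
  have e : (fun p => ∫ x in S p, h (f x) * (f' x).det) = fun p : ℕ × Bool × ℕ => σ p.2.1 * ∫ z in Set.image f (S p), h z := by
    ext p
    rw [integral_image_eq_integral_abs_det_fderiv_smul volume (hSm p) (hSder p) (hSinj p), ← integral_const_mul]
    refine setIntegral_congr_fun (hSm p) fun x hx => ?_
    have h6 : 0 < σ p.2.1 * (f' x).det := hx.1.2
    rcases p with ⟨j, b, n⟩
    cases b
    · simp only [σ] at h6 ⊢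
      simp at h6
      simp [abs_of_neg h6]; ring
    · simp only [σ] at h6 ⊢
      simp at h6
      simp [abs_of_pos h6]; ring
  rw [e]
  exact h3

lemma Nice.detm {φ : SkyrmeMap} (h : Nice φ) : Measurable (detDen φ) := by
  have h1 : detDen φ = fun x => dT φ (φ.toFun x) x := funext fun x => det_dT φ x
  rw [h1]
  unfold dT cD
  have this : ∀ a, Measurable fun x => φ.toFun x a := fun a => cu_meas φ a
  have h2 := fun a k => h.pm k a
  have h3 := fun a b k => h.n0.cJm a b k
  have h4 : ∀ a b c, Measurable fun x => ∑ k, cg φ a k x * cJ φ b c k x := fun a b c =>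
    Finset.measurable_sum _ fun k _ => (h2 _ _).mul (h3 _ _ _)
  exact ((((this 0).mul (h4 _ _ _)).sub ((this 1).mul (h4 _ _ _))).add ((this 2).mul (h4 _ _ _))).sub
    ((this 3).mul (h4 _ _ _))

lemma Nice.detI {φ : SkyrmeMap} (h : Nice φ) : Integrable (detDen φ) volume := by
  refine Integrable.mono' h.memX h.detm.aestronglyMeasurable (Eventually.of_forall fun x => ?_)
  have := six_det h x
  rw [Real.norm_eq_abs]
  have := abs_nonneg (detDen φ x)
  linarith

lemma Nice.DI {φ : SkyrmeMap} (h : Nice φ) (a b c : Fin 4) : Integrable (cD φ a b c) volume := by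
  unfold cD
  exact integrable_finsetSum _ fun k _ => (h.n0.gL2 a k).integrable_mul (h.JL2 b c k)

lemma Nice.dDI {φ : SkyrmeMap} (h : Nice φ) {a : R4 → ℝ} (ha : ContDiff ℝ (⊤ : ℕ∞) a) (d b c : Fin 4) :
    Integrable (fun x => fderiv ℝ a (fun b => cu φ b x) (Pi.single d 1) * cD φ d b c x) volume := by
  have hc : Continuous fun y : R4 => fderiv ℝ a y (Pi.single d 1) :=
    (ha.continuous_fderiv (by simp)).clm_apply continuous_const
  obtain ⟨C, hC⟩ := (isCompact_closedBall (0 : R4) 1).exists_bound_of_continuousOn hc.continuousOn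
  have hm : Measurable fun x => fun b => cu φ b x := measurable_pi_lambda _ fun b => cu_meas φ b
  refine Integrable.bdd_mul (c := C) (h.DI d b c) (hc.measurable.comp hm).aestronglyMeasurable
    (Eventually.of_forall fun x => hC _ ?_)
  rw [mem_closedBall_zero_iff, pi_norm_le_iff_of_nonneg zero_le_one]
  exact fun b => abs_le_one_of_sum (h.sph x) b

lemma Nice.G1 {φ : SkyrmeMap} (h : Nice φ) {a : R4 → ℝ} (ha : ContDiff ℝ (⊤ : ℕ∞) a) (b c : Fin 4) :
    ∫ x, ∑ d, fderiv ℝ a (fun b => cu φ b x) (Pi.single d 1) * cD φ d b c x = 0 := by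
  have hW := W.comp (fun b => h.W b) ha
  have e : ∀ x, ∑ d, fderiv ℝ a (fun b => cu φ b x) (Pi.single d 1) * cD φ d b c x =
      ∑ k, (∑ d, fderiv ℝ a (fun b => cu φ b x) (Pi.single d 1) * cg φ d k x) * crf (cg φ b) (cg φ c) k x := by
    intro x
    simp only [cD, cJ, Finset.mul_sum, Finset.sum_mul]
    rw [Finset.sum_comm]
    refine Finset.sum_congr rfl fun k _ => Finset.sum_congr rfl fun d _ => by ring
  have := lemB hW (h.W b) (h.W c) (fun k => h.JL2 b c k) (by
    simp_rw [← e]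
    exact integrable_finsetSum _ fun d _ => h.dDI ha d b c)
  simp_rw [e]
  exact this

lemma cD_perm (φ : SkyrmeMap) (x : R3) (b c d : Fin 4) : cD φ b c b x = 0 ∧ cD φ b b c x = 0 ∧
    cD φ b c d x = cD φ c d b x ∧ cD φ b c d x = - cD φ b d c x := by
  simp only [cD, cJ, crf, cr, Fin.sum_univ_three]
  norm_num
  refine ⟨?_, ?_, ?_, ?_⟩ <;> simp <;> ring

lemma Nice.rot {φ : SkyrmeMap} (h : Nice φ) {a : R4 → ℝ} (ha : ContDiff ℝ (⊤ : ℕ∞) a) (j : Fin 3) :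
    ∫ x, (fderiv ℝ a (fun b => cu φ b x) (Pi.single j.succ 1) * cu φ 0 x
      - fderiv ℝ a (fun b => cu φ b x) (Pi.single 0 1) * cu φ j.succ x) * detDen φ x = 0 := by
  have hp := cD_perm φ
  fin_cases j
  · rw [← h.G1 ha 2 3]
    congr 1; ext x
    obtain ⟨e0, e1, e2, e3⟩ := h.D_eq x
    rw [Fin.sum_univ_four, (hp x 2 3 0).2.1, (hp x 3 2 0).1, e0, e1]
    simp only [cu]; norm_num; ring
  · rw [← h.G1 ha 3 1]
    congr 1; ext x
    obtain ⟨e0, e1, e2, e3⟩ := h.D_eq x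
    rw [Fin.sum_univ_four, (hp x 3 1 0).2.1, (hp x 1 3 0).1, (hp x 2 3 1).2.2.1, (hp x 3 1 2).2.2.1, e0,
      (hp x 0 3 1).2.2.2, e2]
    simp only [cu]; norm_num; ring
  · change ∫ x, (fderiv ℝ a (fun b => cu φ b x) (Pi.single 3 1) * cu φ 0 x
      - fderiv ℝ a (fun b => cu φ b x) (Pi.single 0 1) * cu φ 3 x) * detDen φ x = 0
    rw [← h.G1 ha 1 2]
    congr 1; ext x
    obtain ⟨e0, e1, e2, e3⟩ := h.D_eq x
    rw [Fin.sum_univ_four, (hp x 1 2 0).2.1, (hp x 2 1 0).1, (hp x 3 1 2).2.2.1, e0, e3]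
    simp only [cu]; norm_num; ring

def mom (φ : SkyrmeMap) (k : ℕ) : ℝ := ∫ x, cu φ 0 x ^ k * detDen φ x

lemma Nice.momI {φ : SkyrmeMap} (h : Nice φ) (k : ℕ) (j : Fin 4) (l : ℕ) :
    Integrable (fun x => cu φ 0 x ^ k * cu φ j x ^ l * detDen φ x) volume := by
  refine Integrable.bdd_mul (c := 1) h.detI (((cu_meas φ 0).pow_const k).mul ((cu_meas φ j).pow_const l)).aestronglyMeasurable
    (Eventually.of_forall fun x => ?_)
  rw [norm_mul, norm_pow, norm_pow]
  exact mul_le_one₀ (pow_le_one₀ (norm_nonneg _) (h.bd 0 x)) (by positivity) (pow_le_one₀ (norm_nonneg _) (h.bd j x))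

lemma Nice.mom_rec {φ : SkyrmeMap} (h : Nice φ) (k : ℕ) :
    3 * mom φ (k + 1) = k * (mom φ (k - 1) - mom φ (k + 1)) := by
  have h1 : ∀ j : Fin 3, ∫ x, (cu φ 0 x ^ (k + 1) * detDen φ x - k * (cu φ 0 x ^ (k - 1) * cu φ j.succ x ^ 2 * detDen φ x)) = 0 := by
    intro j
    rw [← h.rot (a := fun y => y 0 ^ k * y j.succ) (by fun_prop) j]
    congr 1; ext x
    set y : R4 := fun b => cu φ b x
    have hf : HasFDerivAt (fun y : R4 => y 0 ^ k * y j.succ) _ y :=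
      ((hasFDerivAt_apply (𝕜 := ℝ) (0 : Fin 4) y).pow k).mul (hasFDerivAt_apply (𝕜 := ℝ) j.succ y)
    rw [hf.fderiv]
    simp [y, Pi.single_apply, Fin.succ_ne_zero, (Fin.succ_ne_zero j).symm]
    ring
  have I1 : Integrable (fun x => cu φ 0 x ^ (k + 1) * detDen φ x) volume := by simpa using h.momI (k+1) 0 0
  have I2 : Integrable (fun x => cu φ 0 x ^ (k - 1) * detDen φ x) volume := by simpa using h.momI (k-1) 0 0
  have I3 := fun j : Fin 3 => (h.momI (k-1) j.succ 2)
  have h2 : ∀ j : Fin 3, mom φ (k + 1) = k * ∫ x, cu φ 0 x ^ (k - 1) * cu φ j.succ x ^ 2 * detDen φ x := by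
    intro j
    have := h1 j
    rw [integral_sub I1 ((I3 j).const_mul _), integral_const_mul] at this
    unfold mom
    linarith
  have h3 : ∑ j : Fin 3, ∫ x, cu φ 0 x ^ (k - 1) * cu φ j.succ x ^ 2 * detDen φ x = mom φ (k - 1) - ∫ x, cu φ 0 x ^ (k - 1) * cu φ 0 x ^ 2 * detDen φ x := by
    rw [← integral_finsetSum _ fun j _ => I3 j]
    unfold mom
    rw [← integral_sub I2 (h.momI (k-1) 0 2)]
    congr 1; ext x
    have := h.sph x
    rw [Fin.sum_univ_succ] at this
    rw [← Finset.sum_mul, ← Finset.mul_sum]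
    rw [show ∑ j : Fin 3, cu φ j.succ x ^ 2 = 1 - cu φ 0 x ^ 2 by linarith]
    ring
  rcases Nat.eq_zero_or_pos k with rfl | hk
  · have := h2 0; simp at this ⊢; exact this
  · have h4 : (fun x => cu φ 0 x ^ (k - 1) * cu φ 0 x ^ 2 * detDen φ x) = fun x => cu φ 0 x ^ (k + 1) * detDen φ x := by
      ext x; rw [← pow_add]; congr 2; omega
    rw [h4] at h3
    rw [show mom φ (k - 1) - mom φ (k+1) = _ from h3.symm, Finset.mul_sum]
    simp_rw [← h2]
    simp

def cmom (k : ℕ) : ℝ := ∫ y in (-1:ℝ)..1, y ^ k * √(1 - y ^ 2)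

lemma cmom_rec (k : ℕ) : 3 * cmom (k + 1) = k * (cmom (k - 1) - cmom (k + 1)) := by
  have hc : ∀ n : ℕ, Continuous fun y : ℝ => y ^ n * √(1 - y ^ 2) := fun n => by fun_prop
  have hd : ∀ y ∈ Set.Ioo (-1:ℝ) 1, HasDerivAt (fun y : ℝ => y ^ k * ((1 - y ^ 2) * √(1 - y ^ 2)))
      (k * (y ^ (k - 1) * √(1 - y ^ 2) * (1 - y ^ 2)) - 3 * (y ^ (k + 1) * √(1 - y ^ 2))) y := by
    intro y hy
    have hp : 0 < 1 - y ^ 2 := by nlinarith [hy.1, hy.2]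
    have h1 : HasDerivAt (fun y : ℝ => 1 - y ^ 2) (-(2 * y)) y := by
      simpa using ((hasDerivAt_id y).pow 2).const_sub 1
    have h2 := (hasDerivAt_pow k y).mul (h1.mul (h1.sqrt hp.ne'))
    refine HasDerivAt.congr_deriv h2 ?_
    have hs : 0 < √(1 - y ^ 2) := Real.sqrt_pos.2 hp
    have hs2 : √(1 - y ^ 2) ^ 2 = 1 - y ^ 2 := Real.sq_sqrt hp.le
    simp only [Pi.mul_apply]
    field_simp
    simp only [hs2]
    rw [pow_succ y k]
    ring
  have h3 := intervalIntegral.integral_eq_sub_of_hasDerivAt_of_le (by norm_num : (-1:ℝ) ≤ 1) (by fun_prop) hd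
    (by apply Continuous.intervalIntegrable; fun_prop)
  rw [intervalIntegral.integral_sub (by apply Continuous.intervalIntegrable; fun_prop)
    (by apply Continuous.intervalIntegrable; fun_prop), intervalIntegral.integral_const_mul, intervalIntegral.integral_const_mul] at h3
  have h4 : 0 < k → ∫ y in (-1:ℝ)..1, y ^ (k - 1) * √(1 - y ^ 2) * (1 - y ^ 2) = cmom (k - 1) - cmom (k + 1) := by
    intro hk
    unfold cmom
    rw [← intervalIntegral.integral_sub ((hc _).intervalIntegrable _ _) ((hc _).intervalIntegrable _ _)]
    congr 1; ext y
    obtain ⟨n, rfl⟩ : ∃ n, k = n + 1 := ⟨k - 1, by omega⟩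
    simp only [Nat.add_sub_cancel]
    ring
  rcases Nat.eq_zero_or_pos k with rfl | hk
  · simp at h3 ⊢
    unfold cmom; simpa using h3
  · rw [h4 hk] at h3
    norm_num at h3
    unfold cmom at h3 ⊢
    linarith

lemma cmom_zero : cmom 0 = π / 2 := by
  unfold cmom; simpa using integral_sqrt_one_sub_sq

lemma Nice.mom_eq {φ : SkyrmeMap} (h : Nice φ) (k : ℕ) : mom φ k * (π / 2) = mom φ 0 * cmom k := by
  induction k using Nat.twoStepInduction with
  | zero => rw [cmom_zero]
  | one =>
    have h1 := h.mom_rec 0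
    have h2 := cmom_rec 0
    simp at h1 h2
    rw [h1, h2]; simp
  | more k ih _ =>
    have h1 := h.mom_rec (k + 1)
    have h2 := cmom_rec (k + 1)
    simp only [Nat.add_sub_cancel, add_assoc] at h1 h2
    norm_num at h1 h2
    have h3 : (k + 4 : ℝ) * mom φ (k + 2) = (k + 1) * mom φ k := by linarith
    have h4 : (k + 4 : ℝ) * cmom (k + 2) = (k + 1) * cmom k := by linarith
    have : (k + 4 : ℝ) ≠ 0 := by positivity
    apply mul_left_cancel₀ this
    calc (k + 4 : ℝ) * (mom φ (k + 2) * (π / 2)) = ((k + 4 : ℝ) * mom φ (k + 2)) * (π / 2) := by ring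
      _ = (k + 1) * (mom φ k * (π / 2)) := by rw [h3]; ring
      _ = mom φ 0 * ((k + 1) * cmom k) := by rw [ih]; ring
      _ = _ := by rw [← h4]; ring

lemma Nice.zpoly {φ : SkyrmeMap} (h : Nice φ) (p : Polynomial ℝ) :
    (∫ x, p.eval (cu φ 0 x) * detDen φ x) * (π / 2) = mom φ 0 * ∫ y in (-1:ℝ)..1, p.eval y * √(1 - y ^ 2) := by
  have I1 : ∀ p : Polynomial ℝ, Integrable (fun x => p.eval (cu φ 0 x) * detDen φ x) volume := by
    intro p
    obtain ⟨C, hC⟩ := (isCompact_Icc (a := (-1:ℝ)) (b := 1)).exists_bound_of_continuousOn p.continuous.continuousOn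
    exact Integrable.bdd_mul (c := C) h.detI (p.continuous.measurable.comp (cu_meas φ 0)).aestronglyMeasurable
      (Eventually.of_forall fun x => hC _ (abs_le.1 (h.bd 0 x)))
  induction p using Polynomial.induction_on' with
  | add p q hp hq =>
    simp only [Polynomial.eval_add, add_mul]
    rw [integral_add (I1 p) (I1 q), intervalIntegral.integral_add, add_mul, hp, hq, mul_add]
    · apply Continuous.intervalIntegrable; fun_prop
    · apply Continuous.intervalIntegrable; fun_prop
  | monomial n a =>
    simp only [Polynomial.eval_monomial, mul_assoc]
    rw [integral_const_mul, intervalIntegral.integral_const_mul]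
    have := h.mom_eq n
    unfold mom cmom at this
    unfold mom
    calc _ = a * ((∫ x, cu φ 0 x ^ n * detDen φ x) * (π / 2)) := by ring
      _ = _ := by rw [this]; ring

lemma Nice.zonal {φ : SkyrmeMap} (h : Nice φ) {f : ℝ → ℝ} (hf : Continuous f) :
    (∫ x, f (cu φ 0 x) * detDen φ x) * (π / 2) = mom φ 0 * ∫ y in (-1:ℝ)..1, f y * √(1 - y ^ 2) := by
  have I0 : Integrable (fun x => f (cu φ 0 x) * detDen φ x) volume := by
    obtain ⟨C, hC⟩ := (isCompact_Icc (a := (-1:ℝ)) (b := 1)).exists_bound_of_continuousOn hf.continuousOn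
    exact Integrable.bdd_mul (c := C) h.detI (hf.measurable.comp (cu_meas φ 0)).aestronglyMeasurable
      (Eventually.of_forall fun x => hC _ (abs_le.1 (h.bd 0 x)))
  choose p hp using fun n : ℕ => exists_polynomial_near_of_continuousOn (-1) 1 f hf.continuousOn (1 / ((n:ℝ) + 1)) (by positivity)
  have hpt : ∀ y ∈ Set.Icc (-1:ℝ) 1, Tendsto (fun n => (p n).eval y) atTop (𝓝 (f y)) := by
    intro y hy
    rw [tendsto_iff_norm_sub_tendsto_zero]
    exact squeeze_zero (fun n => norm_nonneg _) (fun n => (hp n y hy).le) tendsto_one_div_add_atTop_nhds_zero_nat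
  obtain ⟨C, hC⟩ := (isCompact_Icc (a := (-1:ℝ)) (b := 1)).exists_bound_of_continuousOn hf.continuousOn
  have hb : ∀ n, ∀ y ∈ Set.Icc (-1:ℝ) 1, ‖(p n).eval y‖ ≤ C + 1 := by
    intro n y hy
    have h1 := hp n y hy
    have h2 := hC y hy
    have h3 : 1 / ((n:ℝ) + 1) ≤ 1 := by rw [div_le_one (by positivity)]; linarith [(Nat.cast_nonneg n : (0:ℝ) ≤ n)]
    rw [Real.norm_eq_abs] at *
    have := abs_sub_abs_le_abs_sub ((p n).eval y) (f y)
    linarith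
  have hx : ∀ x, cu φ 0 x ∈ Set.Icc (-1:ℝ) 1 := fun x => abs_le.1 (h.bd 0 x)
  have L1 : Tendsto (fun n => ∫ x, (p n).eval (cu φ 0 x) * detDen φ x) atTop (𝓝 (∫ x, f (cu φ 0 x) * detDen φ x)) := by
    refine tendsto_integral_of_dominated_convergence (fun x => (C + 1) * |detDen φ x|)
      (fun n => (((p n).continuous.measurable.comp (cu_meas φ 0)).mul h.detm).aestronglyMeasurable) (h.detI.abs.const_mul _) ?_ ?_
    · refine fun n => Eventually.of_forall fun x => ?_
      rw [norm_mul]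
      exact mul_le_mul_of_nonneg_right (hb n _ (hx x)) (norm_nonneg _)
    · exact Eventually.of_forall fun x => (hpt _ (hx x)).mul_const _
  have L2 : Tendsto (fun n => ∫ y in (-1:ℝ)..1, (p n).eval y * √(1 - y ^ 2)) atTop (𝓝 (∫ y in (-1:ℝ)..1, f y * √(1 - y ^ 2))) := by
    refine intervalIntegral.tendsto_integral_filter_of_dominated_convergence (fun y => (C + 1) * √(1 - y ^ 2)) ?_ ?_ ?_ ?_
    · refine Eventually.of_forall fun n => Continuous.aestronglyMeasurable (by fun_prop)
    · refine Eventually.of_forall fun n => Eventually.of_forall fun y hy => ?_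
      rw [Set.uIoc_of_le (by norm_num)] at hy
      rw [norm_mul, Real.norm_of_nonneg (Real.sqrt_nonneg _)]
      exact mul_le_mul_of_nonneg_right (hb n _ ⟨hy.1.le, hy.2⟩) (Real.sqrt_nonneg _)
    · apply Continuous.intervalIntegrable; fun_prop
    · refine Eventually.of_forall fun y hy => ?_
      rw [Set.uIoc_of_le (by norm_num)] at hy
      exact (hpt y ⟨hy.1.le, hy.2⟩).mul_const _
  exact tendsto_nhds_unique (L1.mul_const _) (by simpa only [h.zpoly] using L2.const_mul (mom φ 0))

lemma half_int : ∫ y in (-1:ℝ)..1, (max y 0) * √(1 - y ^ 2) = 1 / 3 := by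
  have hc : Continuous fun y : ℝ => (max y 0) * √(1 - y ^ 2) := by fun_prop
  rw [← intervalIntegral.integral_add_adjacent_intervals (hc.intervalIntegrable (-1) 0) (hc.intervalIntegrable 0 1)]
  have h1 : ∫ y in (-1:ℝ)..0, (max y 0) * √(1 - y ^ 2) = 0 := by
    rw [intervalIntegral.integral_congr (g := fun _ => 0)]
    · simp
    · intro y hy
      rw [Set.uIcc_of_le (by norm_num)] at hy
      simp only [max_eq_right hy.2, zero_mul]
  have h2 : ∫ y in (0:ℝ)..1, (max y 0) * √(1 - y ^ 2) = ∫ y in (0:ℝ)..1, y * √(1 - y ^ 2) := by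
    refine intervalIntegral.integral_congr fun y hy => ?_
    rw [Set.uIcc_of_le (by norm_num)] at hy
    simp only [max_eq_left hy.1]
  have hd : ∀ y ∈ Set.Ioo (0:ℝ) 1, HasDerivAt (fun y : ℝ => - (1/3) * ((1 - y ^ 2) * √(1 - y ^ 2)))
      (y * √(1 - y ^ 2)) y := by
    intro y hy
    have hp : 0 < 1 - y ^ 2 := by nlinarith [hy.1, hy.2]
    have h1 : HasDerivAt (fun y : ℝ => 1 - y ^ 2) (-(2 * y)) y := by
      simpa using ((hasDerivAt_id y).pow 2).const_sub 1
    have h2 := (h1.mul (h1.sqrt hp.ne')).const_mul (-(1/3))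
    refine HasDerivAt.congr_deriv h2 ?_
    have hs : 0 < √(1 - y ^ 2) := Real.sqrt_pos.2 hp
    have hs2 : √(1 - y ^ 2) ^ 2 = 1 - y ^ 2 := Real.sq_sqrt hp.le
    field_simp
    simp only [hs2]
    ring
  rw [h1, h2, intervalIntegral.integral_eq_sub_of_hasDerivAt_of_le (by norm_num : (0:ℝ) ≤ 1) (by fun_prop) hd
    (by apply Continuous.intervalIntegrable; fun_prop)]
  norm_num

lemma Nice.hemi {φ : SkyrmeMap} (h : Nice φ) :
    ∫ x in {x | 0 < cu φ 0 x}, cD φ 1 2 3 x = 2 * (∫ x, detDen φ x) / (3 * π) := by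
  have h1 := h.zonal (f := fun y => max y 0) (by fun_prop)
  rw [half_int] at h1
  have hP : MeasurableSet {x | 0 < cu φ 0 x} := measurableSet_lt measurable_const (cu_meas φ 0)
  rw [← integral_indicator hP]
  have e : ∀ x, Set.indicator {x | 0 < cu φ 0 x} (fun x => cD φ 1 2 3 x) x = max (cu φ 0 x) 0 * detDen φ x := by
    intro x
    by_cases hx : 0 < cu φ 0 x
    · rw [Set.indicator_of_mem (by exact hx), (h.D_eq x).1, max_eq_left hx.le]
    · rw [Set.indicator_of_notMem (by exact hx), max_eq_right (not_lt.1 hx), zero_mul]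
  simp_rw [e]
  have : mom φ 0 = ∫ x, detDen φ x := by simp [mom]
  rw [this] at h1
  have := Real.pi_pos
  field_simp
  linarith

def UB : Set R3 := {z | ∑ i, z i ^ 2 < 1}

lemma UB_open : IsOpen UB := isOpen_lt (by fun_prop) continuous_const

lemma UB_convex : Convex ℝ UB := by
  intro x hx y hy a b ha hb hab
  simp only [UB, Set.mem_setOf_eq, Fin.sum_univ_three, Pi.add_apply, Pi.smul_apply, smul_eq_mul] at *
  have hb' : b = 1 - a := by linarith
  have key : (a * x 0 + b * y 0) ^ 2 + (a * x 1 + b * y 1) ^ 2 + (a * x 2 + b * y 2) ^ 2 =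
    a * (x 0 ^ 2 + x 1 ^ 2 + x 2 ^ 2) + b * (y 0 ^ 2 + y 1 ^ 2 + y 2 ^ 2)
      - a * b * ((x 0 - y 0) ^ 2 + (x 1 - y 1) ^ 2 + (x 2 - y 2) ^ 2) := by subst hb'; ring
  have h1 : 0 ≤ a * b * ((x 0 - y 0) ^ 2 + (x 1 - y 1) ^ 2 + (x 2 - y 2) ^ 2) := by positivity
  rcases eq_or_lt_of_le ha with h | h
  · subst h
    have hb1 : b = 1 := by linarith
    subst hb1
    rw [key]; linarith
  · have h2 : a * (x 0 ^ 2 + x 1 ^ 2 + x 2 ^ 2) < a * 1 := mul_lt_mul_of_pos_left hx h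
    have h3 : b * (y 0 ^ 2 + y 1 ^ 2 + y 2 ^ 2) ≤ b * 1 := mul_le_mul_of_nonneg_left hy.le hb
    rw [key]; linarith

lemma UB_vol : (volume UB).toReal = 4 * π / 3 := by
  have h1 := (PiLp.volume_preserving_ofLp (Fin 3)).measure_preimage UB_open.measurableSet.nullMeasurableSet
  have h2 : (@WithLp.ofLp 2 (Fin 3 → ℝ)) ⁻¹' UB = Metric.ball (0 : EuclideanSpace ℝ (Fin 3)) 1 := by
    ext x
    simp only [UB, Set.mem_preimage, Set.mem_setOf_eq, mem_ball_zero_iff, EuclideanSpace.norm_eq]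
    rw [Real.sqrt_lt' one_pos]
    simp
  rw [← h1, h2, EuclideanSpace.volume_ball_fin_three]
  rw [ENNReal.toReal_mul, ENNReal.toReal_ofReal (by have := Real.pi_pos; positivity)]
  simp
  ring

def fmap (φ : SkyrmeMap) (x : R3) : R3 := fun b => cu φ b.succ x

def fmap' (φ : SkyrmeMap) (x : R3) : R3 →L[ℝ] R3 := ContinuousLinearMap.pi fun b => Lg (cg φ b.succ) x

lemma fmap'_det (φ : SkyrmeMap) (x : R3) : (fmap' φ x).det = cD φ 1 2 3 x := by
  have h : ((fmap' φ x : R3 →L[ℝ] R3) : R3 →ₗ[ℝ] R3) = Matrix.toLin' (Matrix.of fun b i => cg φ b.succ i x) := by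
    ext v b
    simp [fmap', Lg_apply, Matrix.mulVec, dotProduct]
  rw [ContinuousLinearMap.det, h, LinearMap.det_toLin', Matrix.det_fin_three]
  simp only [cD, cJ, crf, cr, Fin.sum_univ_three, Matrix.of_apply]
  norm_num
  have e2 : (Fin.succ 2 : Fin 4) = 3 := rfl
  have e3 : (1 + 2 : Fin 3) = 0 := rfl
  have e4 : (2 + 2 : Fin 3) = 1 := rfl
  have e5 : (2 + 1 : Fin 3) = 0 := rfl
  have e6 : (1 + 1 : Fin 3) = 2 := rfl
  simp only [e2, e3, e4, e5, e6]
  ring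

lemma Nice.fmap_P {φ : SkyrmeMap} (h : Nice φ) {x : R3} (hx : 0 < cu φ 0 x) : fmap φ x ∈ UB := by
  have := h.sph x
  rw [Fin.sum_univ_succ] at this
  simp only [UB, Set.mem_setOf_eq, fmap]
  nlinarith

lemma fmap_meas (φ : SkyrmeMap) : Measurable (fmap φ) := measurable_pi_lambda _ fun b => cu_meas φ b.succ

lemma st_deriv {t : ℝ} (h : 2 ≤ |t|) : deriv Real.smoothTransition t = 0 := by
  rcases le_abs.1 h with h | h
  · have : Real.smoothTransition =ᶠ[𝓝 t] fun _ => 1 := by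
      filter_upwards [lt_mem_nhds (show 1 < t by linarith)] with s hs
      exact Real.smoothTransition.one_of_one_le hs.le
    rw [this.deriv_eq]; simp
  · have : Real.smoothTransition =ᶠ[𝓝 t] fun _ => 0 := by
      filter_upwards [gt_mem_nhds (show t < 0 by linarith)] with s hs
      exact Real.smoothTransition.zero_of_nonpos hs.le
    rw [this.deriv_eq]; simp

lemma Nice.hemi_test {φ : SkyrmeMap} (h : Nice φ) {k : R3 → ℝ} (hk : IsTestFun k) (hK : tsupport k ⊆ UB) (j : Fin 3) :
    ∫ x in {x | 0 < cu φ 0 x}, fderiv ℝ k (fmap φ x) (ee j) * cD φ 1 2 3 x = 0 := by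
  obtain ⟨c, hc0, hc⟩ : ∃ c : ℝ, 0 < c ∧ ∀ z ∈ tsupport k, c ^ 2 ≤ 1 - ∑ i, z i ^ 2 := by
    rcases (tsupport k).eq_empty_or_nonempty with he | hne
    · exact ⟨1, one_pos, by simp [he]⟩
    · obtain ⟨z0, hz0, hmin⟩ := hk.2.isCompact.exists_isMinOn hne
        (show ContinuousOn (fun z : R3 => 1 - ∑ i, z i ^ 2) _ by fun_prop)
      have hp : 0 < 1 - ∑ i, z0 i ^ 2 := by have := hK hz0; simp only [UB, Set.mem_setOf_eq] at this; linarith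
      refine ⟨√(1 - ∑ i, z0 i ^ 2), Real.sqrt_pos.2 hp, fun z hz => ?_⟩
      rw [Real.sq_sqrt hp.le]
      exact hmin hz
  let q : R4 →L[ℝ] R3 := ContinuousLinearMap.pi fun b => ContinuousLinearMap.proj b.succ
  have hq0 : q (Pi.single 0 1) = 0 := by
    ext b; simp [q, Fin.succ_ne_zero]
  have hqj : q (Pi.single j.succ 1) = ee j := by
    ext b; simp [q, Pi.single_apply]
  let a : R4 → ℝ := fun y => k (q y) * Real.smoothTransition (y 0 * (2 / c))
  have hst : ContDiff ℝ (⊤ : ℕ∞) Real.smoothTransition := Real.smoothTransition.contDiff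
  have ha : ContDiff ℝ (⊤ : ℕ∞) a := (hk.1.comp q.contDiff).mul (hst.comp (by fun_prop))
  have hd : ∀ y : R4, HasFDerivAt a (k (q y) • (deriv Real.smoothTransition (y 0 * (2 / c)) • ((2 / c) • (ContinuousLinearMap.proj 0 : R4 →L[ℝ] ℝ)))
      + Real.smoothTransition (y 0 * (2 / c)) • ((fderiv ℝ k (q y)).comp q)) y := by
    intro y
    have h1 : HasFDerivAt (fun y => k (q y)) ((fderiv ℝ k (q y)).comp q) y :=
      ((hk.1.differentiable (by simp)) (q y)).hasFDerivAt.comp y q.hasFDerivAt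
    have h2 : HasFDerivAt (fun y : R4 => y 0 * (2 / c)) ((2 / c) • (ContinuousLinearMap.proj 0 : R4 →L[ℝ] ℝ)) y :=
      (hasFDerivAt_apply (𝕜 := ℝ) (0 : Fin 4) y).mul_const _
    have h3 : HasFDerivAt (fun y : R4 => Real.smoothTransition (y 0 * (2 / c))) _ y :=
      HasDerivAt.comp_hasFDerivAt y ((hst.differentiable (by simp)) _).hasDerivAt h2
    exact h1.mul h3
  have hr := h.rot ha j
  have hP : MeasurableSet {x | 0 < cu φ 0 x} := measurableSet_lt measurable_const (cu_meas φ 0)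
  rw [← integral_indicator hP]
  refine Eq.trans ?_ hr
  congr 1
  ext x
  have hqx : q (fun b => cu φ b x) = fmap φ x := rfl
  rw [(hd _).fderiv]
  simp only [ContinuousLinearMap.add_apply, ContinuousLinearMap.smul_apply, ContinuousLinearMap.comp_apply,
    ContinuousLinearMap.proj_apply, smul_eq_mul, hq0, hqj, map_zero, hqx, mul_zero, add_zero]
  by_cases hz : fmap φ x ∈ tsupport k
  · have h1 := hc _ hz
    have h2 := h.sph x
    rw [Fin.sum_univ_succ] at h2
    have h3 : c ^ 2 ≤ cu φ 0 x ^ 2 := by simp only [fmap] at h1; linarith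
    have h4 : c ≤ |cu φ 0 x| := by
      have := Real.sqrt_le_sqrt h3
      rwa [Real.sqrt_sq hc0.le, Real.sqrt_sq_eq_abs] at this
    have h5 : 2 ≤ |cu φ 0 x * (2 / c)| := by
      rw [abs_mul, abs_of_pos (show 0 < 2 / c by positivity), mul_div_assoc', le_div_iff₀ hc0]
      linarith
    rw [st_deriv h5]
    by_cases hx : 0 < cu φ 0 x
    · rw [Set.indicator_of_mem (by exact hx), (h.D_eq x).1, Real.smoothTransition.one_of_one_le
        (by rw [abs_of_pos (by positivity)] at h5; linarith)]
      simp; ring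
    · have h6 : cu φ 0 x * (2 / c) ≤ 0 := mul_nonpos_of_nonpos_of_nonneg (not_lt.1 hx) (by positivity)
      rw [Set.indicator_of_notMem (by exact hx), Real.smoothTransition.zero_of_nonpos h6]
      simp
  · have h1 : k (fmap φ x) = 0 := image_eq_zero_of_notMem_tsupport hz
    have h2 : fderiv ℝ k (fmap φ x) = 0 := by
      have := fun hh => hz (support_fderiv_subset ℝ (f := k) hh)
      simpa using this
    rw [h1, h2]
    simp [Set.indicator, h2]

lemma const_UB {N : R3 → ℝ} (hN : LocallyIntegrable N volume)
    (hz : ∀ k : R3 → ℝ, IsTestFun k → tsupport k ⊆ UB → ∀ j, ∫ z, fderiv ℝ k z (ee j) * N z = 0) :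
    ∃ z0, ∀ᵐ z, z ∈ UB → N z = N z0 := by
  have hL := mol_tendsto_ae hN
  obtain ⟨x0, hx0, hx0B⟩ : ∃ x0, Tendsto (fun s => mol s N x0) (𝓝[>] 0) (𝓝 (N x0)) ∧ x0 ∈ UB := by
    by_contra hcon
    push Not at hcon
    have : ∀ᵐ x : R3, x ∉ UB := by filter_upwards [hL] with x hx using hcon x hx
    have h0 : volume UB = 0 := by
      rw [← compl_mem_ae_iff]; exact this
    have := UB_vol
    rw [h0] at this
    have := Real.pi_pos
    simp at *
    linarith
  refine ⟨x0, ?_⟩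
  filter_upwards [hL] with x hx hxB
  have hseg : segment ℝ x0 x ⊆ UB := UB_convex.segment_subset hx0B hxB
  have hsc : IsCompact (segment ℝ x0 x) := by
    rw [segment_eq_image']
    exact isCompact_Icc.image (by fun_prop)
  obtain ⟨δ, hδ, hδs⟩ := hsc.exists_cthickening_subset_open UB_open hseg
  have key : ∀ᶠ s in 𝓝[>] (0:ℝ), mol s N x = mol s N x0 := by
    filter_upwards [Ioo_mem_nhdsGT hδ] with s hs
    have hd : ∀ z ∈ segment ℝ x0 x, fderiv ℝ (mol s N) z = 0 := by
      intro z hzs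
      have hb : ∀ i, fderiv ℝ (mol s N) z (ee i) = 0 := by
        intro i
        rw [mol_fderiv hs.1 hN]
        have h1 := hz (fun y => kr s (z - y)) (kr_test s hs.1 z) (by
          refine (closure_minimal ?_ Metric.isClosed_closedBall).trans
            ((Metric.closedBall_subset_cthickening hzs δ).trans hδs)
          intro y hy
          rw [Metric.mem_closedBall, dist_comm, dist_eq_norm]
          by_contra hcon
          exact hy (kr_zero hs.1 (hs.2.le.trans (not_le.1 hcon).le))) i
        simp_rw [fderiv_kr_sub, neg_mul] at h1
        rw [integral_neg] at h1
        linarith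
      ext v
      rw [fderiv_apply_sum]
      simp [hb]
    have := (convex_segment x0 x).norm_image_sub_le_of_norm_fderiv_le (𝕜 := ℝ) (f := mol s N) (C := 0)
      (fun z _ => (mol_contDiff hs.1 hN).differentiable (by simp) z) (fun z hz => by rw [hd z hz]; simp)
      (left_mem_segment ℝ x0 x) (right_mem_segment ℝ x0 x)
    simpa [sub_eq_zero] using this
  exact tendsto_nhds_unique (hx.congr' key) hx0

theorem Nice.degree_int {φ : SkyrmeMap} (h : Nice φ) : ∃ m : ℤ, degree φ = m := by
  obtain ⟨E, hE1, hE2, hE3⟩ := approx_diff (u := fun b => cu φ b.succ) (g := fun b => cg φ b.succ) (fun b => h.W b.succ)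
  have hP : MeasurableSet {x | 0 < cu φ 0 x} := measurableSet_lt measurable_const (cu_meas φ 0)
  have hDm : Measurable (cD φ 1 2 3) := cD_meas (fun a i => h.pm i a) 1 2 3
  obtain ⟨N, hN1, hN2, hN3⟩ := area_int (f := fmap φ) (f' := fmap' φ) hE1 hE2
    (fun j x hx => hasFDerivWithinAt_pi.2 fun b => hE3 j x hx b) (fmap_meas φ) hP
    (by simp_rw [fmap'_det]; exact hDm) (by simp_rw [fmap'_det]; exact (h.DI 1 2 3).integrableOn)
  simp_rw [fmap'_det] at hN3
  obtain ⟨z0, hz0⟩ := const_UB hN1.locallyIntegrable (fun k hk hK j => by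
    rw [← hN3 (fun z => fderiv ℝ k z (ee j)) (hk.d (ee j)).cont.measurable (hk.d (ee j)).bdd, h.hemi_test hk hK j])
  obtain ⟨m, hm⟩ := hN2 z0
  refine ⟨m, ?_⟩
  have h1 := hN3 (UB.indicator fun _ => 1) (measurable_const.indicator UB_open.measurableSet)
    ⟨1, fun z => by by_cases hz : z ∈ UB <;> simp [hz]⟩
  have h2 : ∫ z, UB.indicator (fun _ => (1:ℝ)) z * N z = m * (4 * π / 3) := by
    have : ∀ z, UB.indicator (fun _ => (1:ℝ)) z * N z = UB.indicator N z := by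
      intro z; by_cases hz : z ∈ UB <;> simp [hz]
    simp_rw [this]
    rw [integral_indicator UB_open.measurableSet, setIntegral_congr_ae UB_open.measurableSet hz0]
    simp [Measure.real, UB_vol, hm, mul_comm]
  have h3 : ∫ x in {x | 0 < cu φ 0 x}, UB.indicator (fun _ => (1:ℝ)) (fmap φ x) * cD φ 1 2 3 x = ∫ x in {x | 0 < cu φ 0 x}, cD φ 1 2 3 x := by
    refine setIntegral_congr_fun hP fun x hx => ?_
    rw [Set.indicator_of_mem (h.fmap_P hx), one_mul]
  rw [h2, h3, h.hemi] at h1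
  unfold degree
  have := Real.pi_pos
  field_simp at h1 ⊢
  linarith

theorem degree_int {φ : SkyrmeMap} (h : memX φ) : ∃ m : ℤ, degree φ = m := by
  obtain ⟨φ', h1, h2, -⟩ := exists_nice φ h
  obtain ⟨m, hm⟩ := h1.degree_int
  exact ⟨m, by rw [← hm, h2]⟩

lemma rad_deriv (a A B C y : ℝ) : HasDerivAt (fun y : ℝ => a * arctan y + A * (y / (1 + y ^ 2)) + B * (y / (1 + y ^ 2) ^ 2)
      + C * (y / (1 + y ^ 2) ^ 3))
    ((a * (1 + y ^ 2) ^ 3 + A * (1 - y ^ 2) * (1 + y ^ 2) ^ 2 + B * (1 - 3 * y ^ 2) * (1 + y ^ 2) + C * (1 - 5 * y ^ 2))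
      / (1 + y ^ 2) ^ 4) y := by
  have hp : 1 + y ^ 2 ≠ 0 := by positivity
  have h1 : HasDerivAt (fun y : ℝ => 1 + y ^ 2) (2 * y) y := by
    simpa using ((hasDerivAt_id y).pow 2).const_add 1
  have h2 : ∀ n : ℕ, HasDerivAt (fun y : ℝ => y / (1 + y ^ 2) ^ n) _ y := fun n =>
    (hasDerivAt_id y).div (h1.pow n) (pow_ne_zero n hp)
  have h3 := (((hasDerivAt_arctan y).const_mul a).add (((hasDerivAt_id y).div h1 hp).const_mul A)).add ((h2 2).const_mul B)
  have h4 := h3.add ((h2 3).const_mul C)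
  refine HasDerivAt.congr_deriv h4 ?_
  simp only [id, Pi.pow_apply]
  field_simp
  push_cast
  ring

lemma rad_lim (a A B C : ℝ) : Tendsto (fun y : ℝ => a * arctan y + A * (y / (1 + y ^ 2)) + B * (y / (1 + y ^ 2) ^ 2)
      + C * (y / (1 + y ^ 2) ^ 3)) atTop (𝓝 (a * (π / 2))) := by
  have h0 : ∀ n : ℕ, Tendsto (fun y : ℝ => y / (1 + y ^ 2) ^ (n + 1)) atTop (𝓝 0) := by
    intro n
    refine squeeze_zero' (g := fun y => y⁻¹) ?_ ?_ tendsto_inv_atTop_zero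
    · filter_upwards [eventually_gt_atTop 0] with y hy; positivity
    · filter_upwards [eventually_gt_atTop 0] with y hy
      rw [div_le_iff₀ (by positivity), ← div_eq_inv_mul, le_div_iff₀ hy]
      have : (1 + y ^ 2) ≤ (1 + y ^ 2) ^ (n + 1) := le_self_pow₀ (by nlinarith) (by simp)
      nlinarith
  have h1 := tendsto_nhds_of_tendsto_nhdsWithin tendsto_arctan_atTop
  simpa using (((h1.const_mul a).add ((by simpa using h0 0 : Tendsto (fun y : ℝ => y / (1 + y ^ 2)) atTop (𝓝 0)).const_mul A)).add ((h0 1).const_mul B)).add ((h0 2).const_mul C)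

def enm (x : R3) : ℝ := √(∑ i, x i ^ 2)

lemma rad_int {f : ℝ → ℝ} (a A B C : ℝ) (hf : ∀ y, 0 ≤ f y)
    (he : ∀ y, y ^ 2 * f y = (a * (1 + y ^ 2) ^ 3 + A * (1 - y ^ 2) * (1 + y ^ 2) ^ 2 + B * (1 - 3 * y ^ 2) * (1 + y ^ 2) + C * (1 - 5 * y ^ 2))
      / (1 + y ^ 2) ^ 4) :
    Integrable (fun x : R3 => f (enm x)) volume ∧ ∫ x, f (enm x) = 2 * π ^ 2 * a := by
  have hfin : Module.finrank ℝ (EuclideanSpace ℝ (Fin 3)) = 3 := by simp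
  have hmp := PiLp.volume_preserving_ofLp (Fin 3)
  have hme : MeasurableEmbedding (@WithLp.ofLp 2 (Fin 3 → ℝ)) :=
    (MeasurableEquiv.toLp 2 (Fin 3 → ℝ)).symm.measurableEmbedding
  have hnorm : ∀ x : EuclideanSpace ℝ (Fin 3), enm (WithLp.ofLp x) = ‖x‖ := by
    intro x; simp [enm, EuclideanSpace.norm_eq]
  have hd : ∀ x ∈ Set.Ici (0:ℝ), HasDerivAt (fun y : ℝ => a * arctan y + A * (y / (1 + y ^ 2)) + B * (y / (1 + y ^ 2) ^ 2)
      + C * (y / (1 + y ^ 2) ^ 3)) (x ^ 2 * f x) x := fun x _ => by rw [he]; exact rad_deriv a A B C x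
  have hpos : ∀ x ∈ Set.Ioi (0:ℝ), 0 ≤ x ^ 2 * f x := fun x _ => mul_nonneg (sq_nonneg _) (hf x)
  have hi := integrableOn_Ioi_deriv_of_nonneg' hd hpos (rad_lim a A B C)
  have hv := integral_Ioi_of_hasDerivAt_of_nonneg' hd hpos (rad_lim a A B C)
  constructor
  · rw [← hmp.integrable_comp_emb hme]
    have : ((fun x : R3 => f (enm x)) ∘ (@WithLp.ofLp 2 (Fin 3 → ℝ))) = fun x : EuclideanSpace ℝ (Fin 3) => f ‖x‖ := by
      ext x; simp [hnorm]
    rw [this, integrable_fun_norm_addHaar (volume : Measure (EuclideanSpace ℝ (Fin 3))) (f := f), hfin]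
    exact hi
  · rw [← hmp.integral_comp hme]
    simp_rw [hnorm]
    rw [integral_fun_norm_addHaar (volume : Measure (EuclideanSpace ℝ (Fin 3))) f, hfin]
    have h3 : (volume : Measure (EuclideanSpace ℝ (Fin 3))).real (Metric.ball 0 1) = 4 * π / 3 := by
      rw [Measure.real, EuclideanSpace.volume_ball_fin_three, ENNReal.toReal_mul, ENNReal.toReal_ofReal (by have := Real.pi_pos; positivity)]
      simp
      ring
    rw [h3]
    simp only [smul_eq_mul]
    norm_num at hv ⊢
    rw [hv]
    ring

def lam (x : R3) : ℝ := 2 / (1 + ∑ i, x i ^ 2)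

lemma lam_eq (x : R3) : lam x * (1 + (x 0 ^ 2 + x 1 ^ 2 + x 2 ^ 2)) = 2 := by
  have : 0 < 1 + ∑ i, x i ^ 2 := by positivity
  rw [lam, ← Fin.sum_univ_three fun i => x i ^ 2]
  field_simp

lemma lam_enm (x : R3) : lam x = 2 / (1 + enm x ^ 2) := by
  rw [enm, Real.sq_sqrt (by positivity), lam]

lemma lam_contDiff : ContDiff ℝ (⊤ : ℕ∞) lam := by
  unfold lam
  refine contDiff_const.div (by fun_prop) fun x => ?_
  positivity

lemma lam_deriv (x : R3) (j : Fin 3) : fderiv ℝ lam x (Pi.single j 1) = - (lam x ^ 2 * x j) := by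
  have hp : 1 + ∑ i, x i ^ 2 ≠ 0 := by positivity
  have h1 : HasFDerivAt (fun x : R3 => 1 + ∑ i, x i ^ 2) (∑ i, (2 * x i) • (ContinuousLinearMap.proj i : R3 →L[ℝ] ℝ)) x := by
    refine HasFDerivAt.const_add _ (HasFDerivAt.fun_sum fun i _ => ?_)
    simpa using (hasFDerivAt_apply (𝕜 := ℝ) i x).pow 2
  have h2 := ((hasDerivAt_inv hp).comp_hasFDerivAt x h1).const_mul (2:ℝ)
  have e : lam = fun y : R3 => (2:ℝ) * (Inv.inv ∘ fun x : R3 => 1 + ∑ i, x i ^ 2) y := by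
    funext y; simp [lam, div_eq_mul_inv]
  rw [e, h2.fderiv]
  simp [Pi.single_apply, lam]
  field_simp

lemma int_lam2 : Integrable (fun x => lam x ^ 2) volume ∧ ∫ x, lam x ^ 2 = 4 * π ^ 2 := by
  have := rad_int (f := fun y => (2 / (1 + y ^ 2)) ^ 2) 2 (-2) 0 0 (fun y => sq_nonneg _) (fun y => by
    have : 1 + y ^ 2 ≠ 0 := by positivity
    field_simp; ring)
  simp_rw [← lam_enm] at this
  exact ⟨this.1, by rw [this.2]; ring⟩

lemma int_lam3 : Integrable (fun x => lam x ^ 3) volume ∧ ∫ x, lam x ^ 3 = 2 * π ^ 2 := by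
  have := rad_int (f := fun y => (2 / (1 + y ^ 2)) ^ 3) 1 1 (-2) 0 (fun y => by positivity) (fun y => by
    have : 1 + y ^ 2 ≠ 0 := by positivity
    field_simp; ring)
  simp_rw [← lam_enm] at this
  exact ⟨this.1, by rw [this.2]; ring⟩

lemma int_lam4 : Integrable (fun x => lam x ^ 4) volume ∧ ∫ x, lam x ^ 4 = 2 * π ^ 2 := by
  have := rad_int (f := fun y => (2 / (1 + y ^ 2)) ^ 4) 1 1 (2/3) (-8/3) (fun y => by positivity) (fun y => by
    have : 1 + y ^ 2 ≠ 0 := by positivity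
    field_simp; ring)
  simp_rw [← lam_enm] at this
  exact ⟨this.1, by rw [this.2]; ring⟩

def tm (x : R3) : R4 := ![lam x - 1, lam x * x 0, lam x * x 1, lam x * x 2]
def tmd (j : Fin 3) (x : R3) : R4 := ![-(lam x ^ 2 * x j), (if j = 0 then lam x else 0) - lam x ^ 2 * x j * x 0,
  (if j = 1 then lam x else 0) - lam x ^ 2 * x j * x 1, (if j = 2 then lam x else 0) - lam x ^ 2 * x j * x 2]

lemma tm_contDiff (a : Fin 4) : ContDiff ℝ (⊤ : ℕ∞) (fun x => tm x a) := by
  have := lam_contDiff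
  fin_cases a <;> simp [tm] <;> fun_prop

lemma tmd_cont (j : Fin 3) : Continuous (tmd j) := by
  have := lam_contDiff.continuous
  refine continuous_pi fun a => ?_
  fin_cases j <;> fin_cases a <;> simp [tmd] <;> fun_prop

lemma tm_deriv (j : Fin 3) (a : Fin 4) (x : R3) : fderiv ℝ (fun x => tm x a) x (Pi.single j 1) = tmd j x a := by
  have hl : HasFDerivAt lam (fderiv ℝ lam x) x := (lam_contDiff.differentiable (by simp) x).hasFDerivAt
  have h2 : ∀ i : Fin 3, fderiv ℝ (fun x => lam x * x i) x (Pi.single j 1) = (if j = i then lam x else 0) - lam x ^ 2 * x j * x i := by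
    intro i
    have h1 : HasFDerivAt (fun x : R3 => lam x * x i) _ x := hl.mul (hasFDerivAt_apply (𝕜 := ℝ) i x)
    rw [h1.fderiv]
    simp [lam_deriv, Pi.single_apply, eq_comm]
    ring
  fin_cases a
  · have h1 : HasFDerivAt (fun x : R3 => lam x - 1) _ x := hl.sub_const 1
    simp [tm, tmd, h1.fderiv, lam_deriv]
  · simpa [tm, tmd] using h2 0
  · simpa [tm, tmd] using h2 1
  · simpa [tm, tmd] using h2 2

def tmap : SkyrmeMap where
  toFun := tm
  pderiv := tmd
  meas := measurable_pi_lambda _ fun a => (tm_contDiff a).continuous.measurable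
  pderiv_locInt := fun i => (tmd_cont i).locallyIntegrable
  sphere := Eventually.of_forall fun x => by
    have := lam_eq x
    simp [nsq, dot, tm, Fin.sum_univ_four]
    linear_combination (lam x) * this
  weak := fun i a ψ hψ => by
    rw [ibp hψ (tm_contDiff a)]
    simp_rw [tm_deriv]

lemma tmd_dot (i j : Fin 3) (x : R3) : dot (tmd i x) (tmd j x) = if i = j then lam x ^ 2 else 0 := by
  have h := lam_eq x
  fin_cases i <;> fin_cases j <;> simp [tmd, dot, Fin.sum_univ_four]
  · linear_combination (lam x ^ 3 * x 0 * x 0) * h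
  · linear_combination (lam x ^ 3 * x 0 * x 1) * h
  · linear_combination (lam x ^ 3 * x 0 * x 2) * h
  · linear_combination (lam x ^ 3 * x 1 * x 0) * h
  · linear_combination (lam x ^ 3 * x 1 * x 1) * h
  · linear_combination (lam x ^ 3 * x 1 * x 2) * h
  · linear_combination (lam x ^ 3 * x 2 * x 0) * h
  · linear_combination (lam x ^ 3 * x 2 * x 1) * h
  · linear_combination (lam x ^ 3 * x 2 * x 2) * h

lemma tmap_dens (x : R3) : energyDensity tmap x = 3 * lam x ^ 2 + 6 * lam x ^ 4 := by
  simp [energyDensity, gradSq, ASq, nsq, wedgeSq, tmap, tmd_dot, Fin.sum_univ_three]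
  ring

lemma tmap_det (x : R3) : detDen tmap x = lam x ^ 3 := by
  have h := lam_eq x
  rw [detDen, det4_eq]
  simp [tmap, tm, tmd]
  linear_combination (lam x ^ 3) * h

lemma tmap_spec : memX tmap ∧ energy tmap = 24 * π ^ 2 ∧ degree tmap = 1 := by
  have e : energyDensity tmap = fun x => 3 * lam x ^ 2 + 6 * lam x ^ 4 := funext tmap_dens
  refine ⟨?_, ?_, ?_⟩
  · rw [memX, e]; exact (int_lam2.1.const_mul 3).add (int_lam4.1.const_mul 6)
  · rw [energy, e]
    refine (integral_add (int_lam2.1.const_mul 3) (int_lam4.1.const_mul 6)).trans ?_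
    rw [integral_const_mul, integral_const_mul, int_lam2.2, int_lam4.2]; ring
  · rw [degree]; simp_rw [tmap_det]; rw [int_lam3.2]
    have := Real.pi_pos
    field_simp

/-- Reflection of the first target coordinate. -/
def reflM (φ : SkyrmeMap) : SkyrmeMap where
  toFun := fun x => Function.update (φ.toFun x) 0 (-φ.toFun x 0)
  pderiv := fun i x => Function.update (φ.pderiv i x) 0 (-φ.pderiv i x 0)
  meas := by
    refine measurable_pi_lambda _ fun a => ?_
    have h : ∀ a, Measurable fun x => φ.toFun x a := fun a => (measurable_pi_apply a).comp φ.meas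
    by_cases ha : a = 0
    · subst ha; simpa using h 0
    · simpa [Function.update_of_ne ha] using h a
  pderiv_locInt := fun i => by
    let L : R4 →L[ℝ] R4 := ContinuousLinearMap.pi fun a => if a = 0 then -ContinuousLinearMap.proj a else ContinuousLinearMap.proj a
    have : (fun x => Function.update (φ.pderiv i x) 0 (-φ.pderiv i x 0)) = fun x => L (φ.pderiv i x) := by
      ext x a
      by_cases ha : a = 0
      · subst ha; simp [L]
      · simp [L, Function.update_of_ne ha, ha]
    rw [this]
    intro x
    obtain ⟨U, hU, hi⟩ := φ.pderiv_locInt i x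
    exact ⟨U, hU, L.integrable_comp hi⟩
  sphere := by
    filter_upwards [φ.sphere] with x hx
    rw [← hx]
    simp [nsq, dot, Fin.sum_univ_four]
  weak := fun i a ψ hψ => by
    have := φ.weak i a ψ hψ
    by_cases ha : a = 0
    · subst ha
      simp [integral_neg, this]
    · simpa [Function.update_of_ne ha] using this

lemma refl_dot (φ : SkyrmeMap) (i j : Fin 3) (x : R3) : dot ((reflM φ).pderiv i x) ((reflM φ).pderiv j x) = dot (φ.pderiv i x) (φ.pderiv j x) := by
  simp [dot, reflM, Fin.sum_univ_four]

lemma refl_dens (φ : SkyrmeMap) : energyDensity (reflM φ) = energyDensity φ := by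
  ext x
  simp only [energyDensity, gradSq, ASq, nsq, wedgeSq, refl_dot]

lemma refl_det (φ : SkyrmeMap) (x : R3) : detDen (reflM φ) x = - detDen φ x := by
  rw [detDen, detDen, det4_eq, det4_eq]
  simp [reflM]
  ring

lemma refl_spec (φ : SkyrmeMap) : energy (reflM φ) = energy φ ∧ degree (reflM φ) = - degree φ ∧ (memX φ → memX (reflM φ)) := by
  refine ⟨by rw [energy, refl_dens, energy], ?_, fun h => by rw [memX, refl_dens]; exact h⟩
  rw [degree, degree]; simp_rw [refl_det]; rw [integral_neg]; ring

lemma J_pow4 (φ : SkyrmeMap) (b c : Fin 4) (k : Fin 3) (x : R3) :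
    (cJ φ b c k x / 2) ^ 4 ≤ energyDensity φ x ^ 3 := by
  have h0 := dens_nonneg φ x
  have h1 := cJ_sq_le φ b c k x
  have h2 : cJ φ b c k x ^ 2 ≤ (2 * energyDensity φ x) ^ 2 := by
    rw [sq_le_sq, abs_of_nonneg (by positivity : 0 ≤ 2 * energyDensity φ x)]
    have a1 := cg_sq_le φ b (k+1) x
    have a2 := cg_sq_le φ b (k+2) x
    have a3 := cg_sq_le φ c (k+1) x
    have a4 := cg_sq_le φ c (k+2) x
    have e : cJ φ b c k x = cg φ b (k+1) x * cg φ c (k+2) x - cg φ b (k+2) x * cg φ c (k+1) x := rfl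
    rw [e, abs_le]
    constructor <;> nlinarith [sq_nonneg (cg φ b (k+1) x + cg φ c (k+2) x), sq_nonneg (cg φ b (k+1) x - cg φ c (k+2) x),
      sq_nonneg (cg φ b (k+2) x + cg φ c (k+1) x), sq_nonneg (cg φ b (k+2) x - cg φ c (k+1) x)]
  have h3 : cJ φ b c k x ^ 4 ≤ energyDensity φ x * (2 * energyDensity φ x) ^ 2 := by
    calc cJ φ b c k x ^ 4 = cJ φ b c k x ^ 2 * cJ φ b c k x ^ 2 := by ring
      _ ≤ _ := mul_le_mul h1 h2 (sq_nonneg _) h0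
  have : 0 ≤ energyDensity φ x ^ 3 := by positivity
  nlinarith

lemma vol_cb (y : R3) {r : ℝ} (hr : 0 ≤ r) : volume.real (Metric.closedBall y r) = (2 * r) ^ 3 := by
  rw [Measure.real, Real.volume_pi_closedBall _ hr, ENNReal.toReal_ofReal (by positivity)]
  simp

lemma mol_pt {δ : ℝ} (hδ : 0 < δ) (hδ1 : δ ≤ 1) : ∃ M, 0 < M ∧ ∀ g : R3 → ℝ, MemLp g 2 volume → ∀ y x : R3,
    x ∈ Metric.closedBall y 1 → |mol δ g x| ≤ M * √(∫ z in Metric.closedBall y 2, g z ^ 2) := by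
  obtain ⟨C, hC, hr⟩ := rho_bdd
  set M := δ⁻¹ ^ 3 * C with hM
  have hMp : 0 < M := by positivity
  have hk : ∀ z, |kr δ z| ≤ M := fun z => by
    rw [abs_of_nonneg (kr_nonneg hδ z), kr]; exact mul_le_mul_of_nonneg_left (hr _) (by positivity)
  refine ⟨8 * M, by positivity, fun g hg y x hx => ?_⟩
  have e : mol δ g x = ∫ z in Metric.closedBall y 2, kr δ (x - z) * g z := by
    rw [mol_eq_kr hδ]
    refine (setIntegral_eq_integral_of_forall_compl_eq_zero fun z hz => ?_).symm
    rw [kr_zero hδ, zero_mul]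
    rw [Metric.mem_closedBall, dist_eq_norm] at hz hx
    have := norm_add_le (z - x) (x - y)
    rw [sub_add_sub_cancel, norm_sub_rev z x] at this
    push Not at hz
    linarith
  have hkm : Continuous fun z => kr δ (x - z) := (kr_contDiff δ).continuous.comp (continuous_const.sub continuous_id)
  have hfin : volume (Metric.closedBall y (2:ℝ)) ≠ ⊤ := (isCompact_closedBall y (2:ℝ)).measure_lt_top.ne
  have : IsFiniteMeasure (volume.restrict (Metric.closedBall y (2:ℝ))) := ⟨by simpa using hfin.lt_top⟩
  have hk2 : MemLp (fun z => kr δ (x - z)) 2 (volume.restrict (Metric.closedBall y 2)) :=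
    MemLp.of_bound hkm.aestronglyMeasurable M (Eventually.of_forall fun z => hk _)
  rw [e]
  refine (cs hk2 (hg.restrict _)).trans ?_
  gcongr
  rw [Real.sqrt_le_left (by positivity)]
  calc ∫ z in Metric.closedBall y 2, kr δ (x - z) ^ 2 ≤ ∫ z in Metric.closedBall y 2, M ^ 2 := by
        refine integral_mono hk2.integrable_sq (integrable_const _) fun z => ?_
        exact sq_le_sq' (abs_le.1 (hk (x - z))).1 (abs_le.1 (hk (x - z))).2
    _ = (8 * M) ^ 2 := by
        rw [setIntegral_const, vol_cb y (by norm_num)]; simp; ring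

lemma mol_K {δ : ℝ} (hδ : 0 < δ) (hδ1 : δ ≤ 1) : ∃ K, 0 < K ∧ ∀ (u : R3 → ℝ) (g : Fin 3 → R3 → ℝ), W u g →
    ∀ y x : R3, x ∈ Metric.closedBall y 1 →
      (mol δ u x - mol δ u y) ^ 4 ≤ K * (∑ i, ∫ z in Metric.closedBall y 2, g i z ^ 2) ^ 2 := by
  obtain ⟨M, hM, hb⟩ := mol_pt hδ hδ1
  refine ⟨(3 * M) ^ 4, by positivity, fun u g h y x hx => ?_⟩
  set G := ∑ i, ∫ z in Metric.closedBall y 2, g i z ^ 2 with hG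
  have hG0 : 0 ≤ G := Finset.sum_nonneg fun i _ => integral_nonneg fun z => sq_nonneg _
  have hd : ∀ z ∈ Metric.closedBall y (1:ℝ), ‖fderiv ℝ (mol δ u) z‖ ≤ 3 * M * √G := by
    intro z hz
    refine ContinuousLinearMap.opNorm_le_bound _ (by positivity) fun v => ?_
    rw [fderiv_apply_sum, Real.norm_eq_abs]
    refine (Finset.abs_sum_le_sum_abs _ _).trans ?_
    have : ∀ i ∈ Finset.univ, |v i * fderiv ℝ (mol δ u) z (ee i)| ≤ ‖v‖ * (M * √G) := fun i _ => by
      rw [abs_mul, h.mol_deriv hδ]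
      refine mul_le_mul (norm_le_pi_norm v i) ((hb _ (h.gL2 i) y z hz).trans ?_) (abs_nonneg _) (norm_nonneg _)
      gcongr
      rw [hG]
      exact Finset.single_le_sum (f := fun i => ∫ z in Metric.closedBall y 2, g i z ^ 2)
        (fun i _ => integral_nonneg fun z => sq_nonneg _) (Finset.mem_univ i)
    refine (Finset.sum_le_sum this).trans (le_of_eq ?_)
    simp; ring
  have hdiff : Differentiable ℝ (mol δ u) := (mol_contDiff hδ h.locInt).differentiable (by simp)
  have hmv := (convex_closedBall y (1:ℝ)).norm_image_sub_le_of_norm_fderiv_le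
    (fun z _ => hdiff z) hd (Metric.mem_closedBall_self zero_le_one) hx
  have hxy : ‖x - y‖ ≤ 1 := by rwa [← dist_eq_norm]
  have h1 : |mol δ u x - mol δ u y| ≤ 3 * M * √G := by
    rw [Real.norm_eq_abs] at hmv
    refine hmv.trans (mul_le_of_le_one_right (by positivity) hxy)
  calc (mol δ u x - mol δ u y) ^ 4 = |mol δ u x - mol δ u y| ^ 4 := by
        rw [← abs_pow, abs_of_nonneg]; positivity
    _ ≤ (3 * M * √G) ^ 4 := by gcongr
    _ = (3 * M) ^ 4 * ((√G) ^ 2) ^ 2 := by ring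
    _ = _ := by rw [Real.sq_sqrt hG0]

/-- local energy -/
def eloc (φ : SkyrmeMap) (y : R3) : ℝ := ∫ x in Metric.closedBall y 2, energyDensity φ x

lemma eloc_nonneg (φ : SkyrmeMap) (y : R3) : 0 ≤ eloc φ y := integral_nonneg fun x => dens_nonneg φ x

lemma locS {θ : ℝ} (hθ : 0 < θ) : ∃ δ ε : ℝ, 0 < δ ∧ 0 < ε ∧ ∀ φ : SkyrmeMap, Nice φ → ∀ (d : Fin 4) (X : R3 → ℝ),
    Measurable X → (∀ x, X x ^ 4 ≤ energyDensity φ x ^ 3) → ∀ (y : R3) (η : R3 → ℝ) (C : ℝ), Measurable η →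
    (∀ x, |η x| ≤ C) → (∀ x, x ∉ Metric.closedBall y 1 → η x = 0) → eloc φ y ≤ ε →
    Integrable (fun x => η x * ((cu φ d x - mol δ (cu φ d) y) * X x)) volume ∧
    |∫ x, η x * ((cu φ d x - mol δ (cu φ d) y) * X x)| ≤ C * (θ * eloc φ y) := by
  set lam := θ / 3 with hlam
  have hl : 0 < lam := by positivity
  obtain ⟨δ, hδ, hδ1, hδ2⟩ : ∃ δ : ℝ, 0 < δ ∧ δ ≤ 1 ∧ (lam ^ 3)⁻¹ * (288 * δ ^ 2) ≤ θ / 3 := by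
    refine ⟨min 1 (θ / 3 * lam ^ 3 / 288), by positivity, min_le_left _ _, ?_⟩
    set m := min 1 (θ / 3 * lam ^ 3 / 288)
    have h0 : 0 ≤ m := by positivity
    have h1 : m ≤ 1 := min_le_left _ _
    have h2 : m ≤ θ / 3 * lam ^ 3 / 288 := min_le_right _ _
    rw [inv_mul_le_iff₀ (by positivity)]
    nlinarith
  obtain ⟨K, hK, hmK⟩ := mol_K hδ hδ1
  refine ⟨δ, θ / 3 * lam ^ 3 / (576 * K), hδ, by positivity, ?_⟩
  intro φ h d X hXm hX4 y η C hη hC hs he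
  set e := eloc φ y with hedef
  have he0 : 0 ≤ e := eloc_nonneg φ y
  set Q := Metric.closedBall y (1:ℝ) with hQ
  have hQm : MeasurableSet Q := Metric.isClosed_closedBall.measurableSet
  have hQf : volume Q ≠ ⊤ := (isCompact_closedBall y (1:ℝ)).measure_lt_top.ne
  have hC0 : 0 ≤ C := (abs_nonneg _).trans (hC 0)
  set p := mol δ (cu φ d) y with hp
  set t1 : R3 → ℝ := fun x => mol δ (cu φ d) x - cu φ d x with ht1
  have hmc := mol_contDiff hδ (h.W d).locInt
  have hmb := mol_bdd (h.bd d) δ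
  have ht1m : Measurable t1 := hmc.continuous.measurable.sub (cu_meas φ d)
  have ht1b : ∀ x, |t1 x| ≤ 2 := dist2 hmb (h.bd d)
  have i1 : IntegrableOn (fun x => t1 x ^ 2) Q volume := bddsq_int ht1m ht1b _ _
  set G := ∑ i, ∫ z in Metric.closedBall y 2, cg φ d i z ^ 2 with hG
  have hG0 : 0 ≤ G := Finset.sum_nonneg fun i _ => integral_nonneg fun z => sq_nonneg _
  have hGe : G ≤ 3 * e := by
    have : ∀ i ∈ Finset.univ, ∫ z in Metric.closedBall y 2, cg φ d i z ^ 2 ≤ e := fun i _ =>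
      integral_mono ((h.n0.gL2 d i).integrable_sq.integrableOn) h.memX.integrableOn fun x => cg_sq_le φ d i x
    refine (Finset.sum_le_sum this).trans (le_of_eq ?_)
    simp
  have ht1i : ∫ x in Q, t1 x ^ 2 ≤ 9 * δ ^ 2 * e := by
    have := (h.W d).rel_est y 1 hδ hδ1
    norm_num at this
    refine this.trans ?_
    calc 3 * δ ^ 2 * G ≤ 3 * δ ^ 2 * (3 * e) := by gcongr
      _ = _ := by ring
  have hpt : ∀ x ∈ Q, (cu φ d x - p) ^ 4 ≤ 32 * t1 x ^ 2 + 72 * K * e ^ 2 := by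
    intro x hx
    have h2 := hmK _ _ (h.W d) y x hx
    have h3 : G ^ 2 ≤ (3 * e) ^ 2 := by gcongr
    have h4 : (mol δ (cu φ d) x - p) ^ 4 ≤ 9 * K * e ^ 2 := by
      refine h2.trans ?_
      nlinarith
    have h5 : t1 x ^ 2 ≤ 4 := by have := abs_le.1 (ht1b x); nlinarith
    have h6 : t1 x ^ 4 ≤ 4 * t1 x ^ 2 := by nlinarith [sq_nonneg (t1 x)]
    have e1 : cu φ d x - p = (mol δ (cu φ d) x - p) - t1 x := by simp only [ht1]; ring
    rw [e1]
    set a := mol δ (cu φ d) x - p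
    set b := t1 x
    have h7 : (a - b) ^ 2 ≤ 2 * (a ^ 2 + b ^ 2) := by nlinarith [sq_nonneg (a + b)]
    have h8 : (a - b) ^ 4 ≤ 8 * (a ^ 4 + b ^ 4) := by
      calc (a - b) ^ 4 = ((a - b) ^ 2) ^ 2 := by ring
        _ ≤ (2 * (a ^ 2 + b ^ 2)) ^ 2 := by gcongr
        _ ≤ _ := by nlinarith [sq_nonneg (a ^ 2 - b ^ 2)]
    linarith
  set H : R3 → ℝ := fun x => C * (lam * energyDensity φ x + (lam ^ 3)⁻¹ * (32 * t1 x ^ 2 + 72 * K * e ^ 2)) with hH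
  have j1 : IntegrableOn (fun x => lam * energyDensity φ x) Q volume := h.memX.integrableOn.const_mul lam
  have j2 : IntegrableOn (fun x => 32 * t1 x ^ 2 + 72 * K * e ^ 2) Q volume :=
    (i1.const_mul 32).add (integrableOn_const hQf)
  have hHi : IntegrableOn H Q volume := (j1.add (j2.const_mul _)).const_mul C
  have hle : ∀ x, ‖η x * ((cu φ d x - p) * X x)‖ ≤ Q.indicator H x := by
    intro x
    by_cases hx : x ∈ Q
    · rw [Set.indicator_of_mem hx, norm_mul]
      refine mul_le_mul (hC x) ((young4 (dens_nonneg φ x) hl (hX4 x)).trans ?_) (norm_nonneg _) hC0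
      gcongr
      exact hpt x hx
    · rw [hs x hx, Set.indicator_of_notMem hx]; simp
  have hGi := hHi.integrable_indicator hQm
  refine ⟨hGi.mono' (hη.mul (((cu_meas φ d).sub_const p).mul hXm)).aestronglyMeasurable (Eventually.of_forall hle), ?_⟩
  refine (norm_integral_le_of_norm_le hGi (Eventually.of_forall hle)).trans ?_
  rw [integral_indicator hQm, hH, integral_const_mul]
  refine mul_le_mul_of_nonneg_left ?_ hC0
  have a1 : ∫ x in Q, energyDensity φ x ≤ e :=
    setIntegral_mono_set h.memX.integrableOn (Eventually.of_forall fun x => dens_nonneg φ x)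
      (Metric.closedBall_subset_closedBall (by norm_num)).eventuallyLE
  rw [integral_add j1 (j2.const_mul _), integral_const_mul, integral_const_mul,
    integral_add (i1.const_mul 32) (integrableOn_const hQf), integral_const_mul, setIntegral_const, vol_cb y zero_le_one]
  have hε : (lam ^ 3)⁻¹ * (576 * K * e) ≤ θ / 3 := by
    rw [inv_mul_le_iff₀ (by positivity)]
    rw [le_div_iff₀ (by positivity)] at he
    linarith
  calc lam * (∫ x in Q, energyDensity φ x) + (lam ^ 3)⁻¹ * (32 * (∫ x in Q, t1 x ^ 2) + ((2:ℝ) * 1) ^ 3 • (72 * K * e ^ 2))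
      ≤ lam * e + (lam ^ 3)⁻¹ * (32 * (9 * δ ^ 2 * e) + ((2:ℝ) * 1) ^ 3 • (72 * K * e ^ 2)) := by gcongr
    _ = lam * e + (lam ^ 3)⁻¹ * (288 * δ ^ 2) * e + (lam ^ 3)⁻¹ * (576 * K * e) * e := by simp only [smul_eq_mul]; ring
    _ ≤ lam * e + θ / 3 * e + θ / 3 * e := by gcongr
    _ = θ * e := by rw [hlam]; ring

lemma lemS {θ Lam : ℝ} (hθ : 0 < θ) (hL : 0 ≤ Lam) : ∃ ε : ℝ, 0 < ε ∧ ∀ φ : SkyrmeMap, Nice φ → ∀ (y : R3) (ζ : R3 → ℝ),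
    IsTestFun ζ → (∀ x, |ζ x| ≤ 1) → (∀ i x, |fderiv ℝ ζ x (ee i)| ≤ Lam) →
    (∀ x, x ∉ Metric.closedBall y 1 → ζ x = 0) → (∀ i x, x ∉ Metric.closedBall y 1 → fderiv ℝ ζ x (ee i) = 0) →
    eloc φ y ≤ ε → |∫ x, ζ x * detDen φ x| ≤ θ * eloc φ y := by
  obtain ⟨δ, ε, hδ, hε, hS⟩ := locS (θ := θ / (4 + 24 * Lam)) (by positivity)
  refine ⟨ε, hε, fun φ h y ζ hζ h1 hd hz hdz he => ?_⟩
  set th := θ / (4 + 24 * Lam) with hth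
  set e := eloc φ y
  have he0 : 0 ≤ e := eloc_nonneg φ y
  have hth0 : 0 ≤ th := by positivity
  have hm : ∀ a i, Measurable (cg φ a i) := fun a i => h.pm i a
  have hJm : ∀ b c k, Measurable (cJ φ b c k) := fun b c k => h.n0.cJm b c k
  -- one triple
  have hD : ∀ a b c, |∫ x, ζ x * cD φ a b c x| ≤ 6 * Lam * (th * e) := by
    intro a b c
    have hi : ∀ k, Integrable (fun x => (2 * fderiv ℝ ζ x (ee k)) * ((cu φ a x - mol δ (cu φ a) y) * (cJ φ b c k x / 2))) volume ∧
        |∫ x, (2 * fderiv ℝ ζ x (ee k)) * ((cu φ a x - mol δ (cu φ a) y) * (cJ φ b c k x / 2))| ≤ (2 * Lam) * (th * e) := fun k =>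
      hS φ h a (fun x => cJ φ b c k x / 2) ((hJm b c k).div_const 2) (J_pow4 φ b c k) y _ _
        (measurable_const.mul (hζ.d (ee k)).cont.measurable)
        (fun x => by rw [abs_mul, abs_of_pos (by norm_num : (0:ℝ) < 2)]; gcongr; exact hd k x)
        (fun x hx => by rw [hdz k x hx, mul_zero]) he
    have e1 : ∫ x, ζ x * cD φ a b c x = -∑ k, ∫ x, (2 * fderiv ℝ ζ x (ee k)) * ((cu φ a x - mol δ (cu φ a) y) * (cJ φ b c k x / 2)) := by
      rw [← integral_finsetSum _ fun k _ => (hi k).1]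
      simp_rw [cD_crf]
      rw [det_ibp (h.W a) (h.W b) (h.W c) (h.JL2 b c) hζ]
      have z0 := minor_div (h.W b) (h.W c) hζ
      have s1 : Integrable (fun x => cu φ a x * ∑ k, fderiv ℝ ζ x (ee k) * crf (cg φ b) (cg φ c) k x) volume := by
        refine Integrable.bdd_mul (c := 1) (integrable_finsetSum _ fun k _ => mulL2 ((hζ.d (ee k)).memLp 2) (h.JL2 b c k))
          (cu_meas φ a).aestronglyMeasurable (Eventually.of_forall (h.bd a))
      have s2 : Integrable (fun x => ∑ k, fderiv ℝ ζ x (ee k) * crf (cg φ b) (cg φ c) k x) volume :=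
        integrable_finsetSum _ fun k _ => mulL2 ((hζ.d (ee k)).memLp 2) (h.JL2 b c k)
      have : ∫ x, cu φ a x * ∑ k, fderiv ℝ ζ x (ee k) * crf (cg φ b) (cg φ c) k x =
          (∫ x, cu φ a x * ∑ k, fderiv ℝ ζ x (ee k) * crf (cg φ b) (cg φ c) k x) -
          ∫ x, mol δ (cu φ a) y * ∑ k, fderiv ℝ ζ x (ee k) * crf (cg φ b) (cg φ c) k x := by
        rw [integral_const_mul, z0]; ring
      rw [this, ← integral_sub s1 (s2.const_mul _)]
      congr 2; ext x
      simp only [Finset.mul_sum, ← Finset.sum_sub_distrib]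
      refine Finset.sum_congr rfl fun k _ => ?_
      simp only [cJ]; ring
    rw [e1, abs_neg]
    refine (Finset.abs_sum_le_sum_abs _ _).trans ((Finset.sum_le_sum fun k _ => (hi k).2).trans (le_of_eq ?_))
    simp; ring
  have hU : ∀ d a b c, |∫ x, ζ x * (cu φ d x * cD φ a b c x)| ≤ (1 + 6 * Lam) * (th * e) := by
    intro d a b c
    have hh := hS φ h d (cD φ a b c) (cD_meas hm a b c) (D_pow4 φ a b c) y ζ 1 hζ.cont.measurable h1 hz he
    have s2 : Integrable (fun x => mol δ (cu φ d) y * (ζ x * cD φ a b c x)) volume :=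
      ((h.DI a b c).bdd_mul (c := 1) hζ.cont.aestronglyMeasurable (Eventually.of_forall h1)).const_mul _
    have e1 : ∫ x, ζ x * (cu φ d x * cD φ a b c x) = (∫ x, ζ x * ((cu φ d x - mol δ (cu φ d) y) * cD φ a b c x)) +
        mol δ (cu φ d) y * ∫ x, ζ x * cD φ a b c x := by
      rw [← integral_const_mul, ← integral_add hh.1 s2]
      congr 1; ext x; ring
    rw [e1]
    refine (abs_add_le _ _).trans ?_
    have : |mol δ (cu φ d) y * ∫ x, ζ x * cD φ a b c x| ≤ 1 * (6 * Lam * (th * e)) := by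
      rw [abs_mul]
      exact mul_le_mul (mol_bdd (h.bd d) δ y) (hD a b c) (abs_nonneg _) zero_le_one
    linarith [hh.2]
  rw [det_int_split hm h.memX h.bd hζ]
  have u1 := abs_le.1 (hU 0 1 2 3)
  have u2 := abs_le.1 (hU 1 0 2 3)
  have u3 := abs_le.1 (hU 2 0 1 3)
  have u4 := abs_le.1 (hU 3 0 1 2)
  have e2 : θ * e = 4 * ((1 + 6 * Lam) * (th * e)) := by rw [hth]; field_simp; ring
  rw [e2, abs_le]
  constructor <;> linarith [u1.1, u1.2, u2.1, u2.2, u3.1, u3.2, u4.1, u4.2]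

/-- Translation of a Skyrme map. -/
def trM (φ : SkyrmeMap) (z : R3) : SkyrmeMap where
  toFun := fun x => φ.toFun (x + z)
  pderiv := fun i x => φ.pderiv i (x + z)
  meas := φ.meas.comp (measurable_id.add_const z)
  pderiv_locInt := fun i x => by
    obtain ⟨V, hV, hi⟩ := φ.pderiv_locInt i (x + z)
    refine ⟨(fun x => x + z) ⁻¹' V, (continuous_id.add continuous_const).continuousAt.preimage_mem_nhds hV, ?_⟩
    exact ((measurePreserving_add_right volume z).integrableOn_comp_preimage
      (Homeomorph.addRight z).measurableEmbedding).2 hi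
  sphere := (measurePreserving_add_right volume z).quasiMeasurePreserving.ae φ.sphere
  weak := fun i a ψ hψ => by
    have ht : IsTestFun fun x => ψ (x - z) :=
      ⟨hψ.1.comp (contDiff_id.sub contDiff_const), hψ.2.comp_homeomorph (Homeomorph.subRight z)⟩
    have h := φ.weak i a _ ht
    have e1 := integral_add_right_eq_self (μ := volume) (fun x => fderiv ℝ (fun x => ψ (x - z)) x (Pi.single i 1) * φ.toFun x a) z
    have e2 := integral_add_right_eq_self (μ := volume) (fun x => ψ (x - z) * φ.pderiv i x a) z
    rw [← e1, ← e2] at h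
    simpa [fderiv_comp_sub] using h

lemma tr_dens (φ : SkyrmeMap) (z x : R3) : energyDensity (trM φ z) x = energyDensity φ (x + z) := rfl
lemma tr_det (φ : SkyrmeMap) (z x : R3) : detDen (trM φ z) x = detDen φ (x + z) := rfl

lemma tr_energy (φ : SkyrmeMap) (z : R3) : energy (trM φ z) = energy φ :=
  integral_add_right_eq_self (μ := volume) (energyDensity φ) z

lemma tr_nice {φ : SkyrmeMap} (h : Nice φ) (z : R3) : Nice (trM φ z) where
  memX := h.memX.comp_add_right z
  sph := fun x => h.sph (x + z)
  orth := fun x i => h.orth (x + z) i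
  pm := fun i a => (h.pm i a).comp (measurable_id.add_const z)

lemma tr_chi (φ : SkyrmeMap) (z : R3) (R : ℝ) :
    ∫ x, chi R x * detDen (trM φ z) x = ∫ x, chi R (x - z) * detDen φ x := by
  rw [← integral_add_right_eq_self (μ := volume) (fun x => chi R (x - z) * detDen φ x) z]
  simp [tr_det]

lemma degree_mul (φ : SkyrmeMap) : ∫ x, detDen φ x = 2 * π ^ 2 * degree φ := by
  rw [degree]; field_simp

lemma detI_of {ψ : SkyrmeMap} (h : memX ψ) : Integrable (detDen ψ) volume ∧ 12 * π ^ 2 * |degree ψ| ≤ energy ψ := by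
  obtain ⟨φ, hN, hd, he, -, hae⟩ := exists_nice ψ h
  refine ⟨hN.detI.congr hae, ?_⟩
  rw [← hd, ← he]
  have h1 : |∫ x, detDen φ x| ≤ ∫ x, energyDensity φ x / 6 :=
    norm_integral_le_of_norm_le (f := detDen φ) (hN.memX.div_const 6) (Eventually.of_forall fun x => by
      have := six_det hN x
      rw [Real.norm_eq_abs]; linarith)
  rw [integral_div, degree_mul, abs_mul, abs_of_pos (by positivity)] at h1
  rw [energy]; linarith

lemma conv_bound {U : Ultrafilter ℕ} {φ : ℕ → SkyrmeMap} {ψ : SkyrmeMap} {E I : ℝ} (h : Conv U φ ψ E)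
    (hd : ∀ n, degree (φ n) = 1) (hI : Tendsto (fun n => energy (φ n)) U (𝓝 I)) :
    energy ψ + 12 * π ^ 2 * |1 - degree ψ| ≤ I := by
  have hdi := (detI_of h.memX).1
  have key : ∀ R > 0, (∫ x, chi R x * energyDensity ψ x) + 6 * |2 * π ^ 2 - ∫ x, chi R x * detDen ψ x| ≤ I := by
    intro R hR
    have hT := chi_test hR
    have hlim : Tendsto (fun n => energy (φ n) - 6 * |2 * π ^ 2 - ∫ x, chi R x * detDen (φ n) x|) U
        (𝓝 (I - 6 * |2 * π ^ 2 - ∫ x, chi R x * detDen ψ x|)) :=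
      hI.sub (((h.det hT).const_sub _).abs.const_mul 6)
    have hle : ∀ n, ∫ x, chi R x * energyDensity (φ n) x ≤ energy (φ n) - 6 * |2 * π ^ 2 - ∫ x, chi R x * detDen (φ n) x| := by
      intro n
      have hN := h.nice n
      have hb : ∀ x, ‖chi R x‖ ≤ 1 := fun x => by
        rw [Real.norm_eq_abs, abs_of_nonneg (chi_nonneg R x)]; exact chi_le_one R x
      have i1 : Integrable (fun x => chi R x * energyDensity (φ n) x) volume :=
        hN.memX.bdd_mul (c := 1) hT.cont.aestronglyMeasurable (Eventually.of_forall hb)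
      have i2 : Integrable (fun x => chi R x * detDen (φ n) x) volume :=
        hN.detI.bdd_mul (c := 1) hT.cont.aestronglyMeasurable (Eventually.of_forall hb)
      have e1 : energy (φ n) - ∫ x, chi R x * energyDensity (φ n) x = ∫ x, (energyDensity (φ n) x - chi R x * energyDensity (φ n) x) :=
        (integral_sub hN.memX i1).symm
      have e2 : 2 * π ^ 2 - ∫ x, chi R x * detDen (φ n) x = ∫ x, (detDen (φ n) x - chi R x * detDen (φ n) x) := by
        rw [integral_sub hN.detI i2, degree_mul, hd n, mul_one]
      have h6 : |∫ x, (detDen (φ n) x - chi R x * detDen (φ n) x)| ≤ ∫ x, (energyDensity (φ n) x - chi R x * energyDensity (φ n) x) / 6 := by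
        refine norm_integral_le_of_norm_le (f := fun x => detDen (φ n) x - chi R x * detDen (φ n) x) ((hN.memX.sub i1).div_const 6) (Eventually.of_forall fun x => ?_)
        have e : detDen (φ n) x - chi R x * detDen (φ n) x = (1 - chi R x) * detDen (φ n) x := by ring
        have h0 := sub_nonneg.2 (chi_le_one R x)
        rw [e, norm_mul, Real.norm_eq_abs, Real.norm_eq_abs, abs_of_nonneg h0]
        have := mul_le_mul_of_nonneg_left (six_det hN x) h0
        linarith
      rw [integral_div, ← e1, ← e2] at h6
      linarith
    have : ∫ x, chi R x * energyDensity ψ x ≤ I - 6 * |2 * π ^ 2 - ∫ x, chi R x * detDen ψ x| := by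
      refine le_of_forall_gt_imp_ge_of_dense fun c hc => ?_
      refine h.lsc hT (chi_nonneg R) ?_
      filter_upwards [hlim.eventually (gt_mem_nhds hc)] with n hn
      exact (hle n).trans hn.le
    linarith
  have hl : Tendsto (fun R => (∫ x, chi R x * energyDensity ψ x) + 6 * |2 * π ^ 2 - ∫ x, chi R x * detDen ψ x|) atTop
      (𝓝 ((∫ x, energyDensity ψ x) + 6 * |2 * π ^ 2 - ∫ x, detDen ψ x|)) :=
    (chi_tendsto h.memX).add (((chi_tendsto hdi).const_sub _).abs.const_mul 6)
  have := le_of_tendsto hl (by filter_upwards [eventually_gt_atTop (0:ℝ)] with R hR using key R hR)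
  rw [degree_mul] at this
  have e : 2 * π ^ 2 - 2 * π ^ 2 * degree ψ = 2 * π ^ 2 * (1 - degree ψ) := by ring
  rw [e, abs_mul, abs_of_pos (by positivity : (0:ℝ) < 2 * π ^ 2)] at this
  rw [energy]; linarith

lemma conv_dich {U : Ultrafilter ℕ} {φ : ℕ → SkyrmeMap} {ψ : SkyrmeMap} {E I : ℝ} (h : Conv U φ ψ E)
    (hd : ∀ n, degree (φ n) = 1) (hI : Tendsto (fun n => energy (φ n)) U (𝓝 I)) (hI2 : I ≤ 24 * π ^ 2) :
    degree ψ = 0 ∨ (degree ψ = 1 ∧ energy ψ ≤ I) := by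
  obtain ⟨k, hk⟩ := degree_int h.memX
  have h1 := conv_bound h hd hI
  have h2 := (detI_of h.memX).2
  rw [hk] at *
  have hp : 0 < π ^ 2 := by positivity
  have h3 : (|(k:ℝ)| + |1 - (k:ℝ)|) ≤ 2 := by
    by_contra hc
    push Not at hc
    nlinarith
  have h4 : |k| + |1 - k| ≤ 2 := by exact_mod_cast h3
  have h5 : k = 0 ∨ k = 1 := by
    rcases abs_cases k with h | h <;> rcases abs_cases (1 - k) with h' | h' <;> omega
  rcases h5 with h5 | h5
  · left; simp [h5]
  · right; subst h5; refine ⟨by simp, ?_⟩; simpa using h1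

/-- complement cutoff -/
def cut {m : ℕ} (R : ℝ) (z : Fin m → R3) (x : R3) : ℝ := 1 - ∑ i, chi R (x - z i)

lemma sum_le_one_nz {m : ℕ} (a : Fin m → ℝ) (P : ℝ → Prop) (h0 : P 0) (h1 : ∀ i, P (a i))
    (hu : ∀ i j, i ≠ j → a i = 0 ∨ a j = 0) : P (∑ i, a i) := by
  by_cases h : ∃ i, a i ≠ 0
  · obtain ⟨i, hi⟩ := h
    rw [Finset.sum_eq_single i (fun j _ hj => (hu i j hj.symm).resolve_left hi) (by simp)]
    exact h1 i
  · push Not at h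
    simp [h, h0]

lemma chi_dzero {R : ℝ} (hR : 0 < R) (i : Fin 3) {x : R3} (hx : 2 * R < ‖x‖) : fderiv ℝ (chi R) x (ee i) = 0 := by
  have : chi R =ᶠ[𝓝 x] fun _ => 0 := by
    filter_upwards [(isOpen_lt continuous_const continuous_norm).mem_nhds hx] with w hw
    exact chi_zero hR (le_of_lt hw)
  rw [this.fderiv_eq]; simp

lemma rho_dzero (i : Fin 3) {x : R3} (hx : 1 < ‖x‖) : fderiv ℝ rho x (ee i) = 0 := by
  have : rho =ᶠ[𝓝 x] fun _ => 0 := by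
    filter_upwards [(isOpen_lt continuous_const continuous_norm).mem_nhds hx] with w hw
    exact rho_zero (le_of_lt hw)
  rw [this.fderiv_eq]; simp

lemma hasFD_sub {f : R3 → ℝ} (y x : R3) (hf : DifferentiableAt ℝ f (x - y)) :
    HasFDerivAt (fun x => f (x - y)) (fderiv ℝ f (x - y)) x := by
  have h := hf.hasFDerivAt.comp x ((hasFDerivAt_id x).sub_const y)
  rw [ContinuousLinearMap.comp_id] at h
  exact h

lemma cut_contDiff {m : ℕ} {R : ℝ} (hR : 0 < R) (z : Fin m → R3) : ContDiff ℝ (⊤ : ℕ∞) (cut R z) :=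
  contDiff_const.sub (ContDiff.sum fun i _ => (chi_test hR).1.comp (contDiff_id.sub contDiff_const))

lemma cut_deriv {m : ℕ} {R : ℝ} (hR : 0 < R) (z : Fin m → R3) (k : Fin 3) (x : R3) :
    fderiv ℝ (cut R z) x (ee k) = - ∑ i, fderiv ℝ (chi R) (x - z i) (ee k) := by
  have h : ∀ i ∈ Finset.univ, HasFDerivAt (fun x => chi R (x - z i)) (fderiv ℝ (chi R) (x - z i)) x := fun i _ =>
    hasFD_sub (z i) x ((chi_test hR).diff (x - z i))
  have h2 : HasFDerivAt (cut R z) _ x := (HasFDerivAt.fun_sum h).const_sub 1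
  rw [h2.fderiv]; simp

lemma cut_far {m : ℕ} {R : ℝ} {z : Fin m → R3} (hz : ∀ i j, i ≠ j → 4 * R < ‖z i - z j‖) (x : R3) {i j : Fin m}
    (hij : i ≠ j) : 2 * R < ‖x - z i‖ ∨ 2 * R < ‖x - z j‖ := by
  by_contra hc
  push Not at hc
  have := norm_sub_le (x - z j) (x - z i)
  have e : x - z j - (x - z i) = z i - z j := by abel
  rw [e] at this
  linarith [hz i j hij, hc.1, hc.2]

lemma cut_mem {m : ℕ} {R : ℝ} (hR : 0 < R) {z : Fin m → R3} (hz : ∀ i j, i ≠ j → 4 * R < ‖z i - z j‖) (x : R3) :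
    0 ≤ cut R z x ∧ cut R z x ≤ 1 ∧ ∀ i, ‖x - z i‖ ≤ R → cut R z x = 0 := by
  have hu : ∀ i j, i ≠ j → chi R (x - z i) = 0 ∨ chi R (x - z j) = 0 := fun i j hij =>
    (cut_far hz x hij).imp (fun h => chi_zero hR h.le) (fun h => chi_zero hR h.le)
  have h1 : 0 ≤ ∑ i, chi R (x - z i) ∧ ∑ i, chi R (x - z i) ≤ 1 :=
    sum_le_one_nz (fun i => chi R (x - z i)) (fun t => 0 ≤ t ∧ t ≤ 1) (by simp)
      (fun i => ⟨chi_nonneg R _, chi_le_one R _⟩) hu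
  refine ⟨by rw [cut]; linarith [h1.2], by rw [cut]; linarith [h1.1], fun i hi => ?_⟩
  have hone := chi_one hR hi
  rw [cut, Finset.sum_eq_single i (fun j _ hj => (hu i j hj.symm).resolve_left (by rw [hone]; norm_num)) (by simp), hone, sub_self]

lemma vanish {E : ℝ} (hE : 0 ≤ E) : ∃ ε : ℝ, 0 < ε ∧ ∀ φ : SkyrmeMap, Nice φ → energy φ ≤ E → ∀ (m : ℕ) (z : Fin m → R3) (R R0 : ℝ),
    1 ≤ R → R0 + 1 ≤ R → (∀ i j, i ≠ j → 4 * R < ‖z i - z j‖) →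
    (∀ y, ε < eloc φ y → ∃ i, ‖y - z i‖ ≤ R0) → |∫ x, cut R z x * detDen φ x| ≤ π ^ 2 / 2 := by
  obtain ⟨C1, hC1, hr1⟩ := rho_bdd
  have hr1' : ∀ x, |rho x| ≤ C1 := fun x => by rw [abs_of_nonneg (rho_nonneg x)]; exact hr1 x
  obtain ⟨C2, hC2⟩ : ∃ C, ∀ (i : Fin 3) x, |fderiv ℝ rho x (ee i)| ≤ C := by
    choose B hB using fun i : Fin 3 => (rho_test.d (ee i)).bdd
    refine ⟨∑ i, |B i|, fun i x => (hB i x).trans ((le_abs_self _).trans ?_)⟩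
    exact Finset.single_le_sum (f := fun i => |B i|) (fun i _ => abs_nonneg _) (Finset.mem_univ i)
  have hC20 : 0 ≤ C2 := (abs_nonneg _).trans (hC2 0 0)
  obtain ⟨C3, hC3, hc3⟩ := chi_deriv
  have hchi : Integrable (chi 2) volume := (chi_test two_pos).integrable
  set c2 := ∫ x, chi 2 x
  have hc20 : 0 ≤ c2 := integral_nonneg fun x => chi_nonneg 2 x
  obtain ⟨ε, hε, hS⟩ := lemS (θ := π ^ 2 / 2 / (C1 * (E * c2) + 1)) (Lam := (C2 + C1 * C3) / C1) (by positivity) (by positivity)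
  set θ := π ^ 2 / 2 / (C1 * (E * c2) + 1) with hθ
  refine ⟨ε, hε, fun φ h hφE m z R R0 hR1 hR0 hz hbad => ?_⟩
  have hR : 0 < R := by linarith
  set Ψ := cut R z
  have hΨ := fun x => cut_mem hR hz x
  have hΨc : ContDiff ℝ (⊤ : ℕ∞) Ψ := cut_contDiff hR z
  have hΨd : ∀ k x, |fderiv ℝ Ψ x (ee k)| ≤ C3 := fun k x => by
    rw [cut_deriv hR, abs_neg]
    refine sum_le_one_nz (fun i => fderiv ℝ (chi R) (x - z i) (ee k)) (fun t => |t| ≤ C3) (by simpa using hC3.le)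
      (fun i => (hc3 R hR k _).trans (div_le_self hC3.le hR1)) fun i j hij => ?_
    exact (cut_far hz x hij).imp (fun h => chi_dzero hR k h) (fun h => chi_dzero hR k h)
  set f : R3 → ℝ := fun x => Ψ x * detDen φ x with hf
  have hfi : Integrable f volume := h.detI.bdd_mul (c := 1) hΨc.continuous.aestronglyMeasurable
    (Eventually.of_forall fun x => by rw [Real.norm_eq_abs, abs_le]; constructor <;> linarith [(hΨ x).1, (hΨ x).2.1])
  have k1 := integral_convolution (ContinuousLinearMap.mul ℝ ℝ) hfi rho_integrable
  have k2 := integral_convolution (ContinuousLinearMap.mul ℝ ℝ) h.memX hchi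
  have k2i : Integrable (fun y => ∫ t, energyDensity φ t * chi 2 (y - t)) volume :=
    h.memX.integrable_convolution (ContinuousLinearMap.mul ℝ ℝ) hchi
  simp only [convolution, ContinuousLinearMap.mul_apply', rho_integral, mul_one] at k1 k2
  have hpt : ∀ y, ‖∫ t, f t * rho (y - t)‖ ≤ C1 * θ * ∫ t, energyDensity φ t * chi 2 (y - t) := by
    intro y
    have hel : eloc φ y ≤ ∫ t, energyDensity φ t * chi 2 (y - t) := by
      rw [eloc, ← integral_indicator Metric.isClosed_closedBall.measurableSet]
      refine integral_mono (h.memX.integrableOn.integrable_indicator Metric.isClosed_closedBall.measurableSet) ?_ fun t => ?_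
      · refine h.memX.mul_bdd (c := 1) ((chi_test two_pos).cont.comp (continuous_const.sub continuous_id)).aestronglyMeasurable
          (Eventually.of_forall fun t => ?_)
        rw [Real.norm_eq_abs, abs_of_nonneg (chi_nonneg 2 _)]; exact chi_le_one 2 _
      · by_cases ht : t ∈ Metric.closedBall y 2
        · rw [Set.indicator_of_mem ht]
          simp only
          rw [chi_one two_pos, mul_one]
          rwa [← dist_eq_norm, dist_comm]
        · rw [Set.indicator_of_notMem ht]
          exact mul_nonneg (dens_nonneg φ t) (chi_nonneg 2 _)
    have hnn : 0 ≤ θ := by positivity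
    by_cases hy : ε < eloc φ y
    · obtain ⟨i, hi⟩ := hbad y hy
      have : ∀ t, f t * rho (y - t) = 0 := fun t => by
        by_cases ht : 1 ≤ ‖y - t‖
        · rw [rho_zero ht, mul_zero]
        · push Not at ht
          have : ‖t - z i‖ ≤ R := by
            have h3 := norm_add_le (t - y) (y - z i)
            rw [sub_add_sub_cancel, norm_sub_rev t y] at h3
            linarith
          simp only [hf]
          have h0 : Ψ t = 0 := (hΨ t).2.2 i this
          rw [h0]; ring
      simp only [this, integral_zero, norm_zero]
      have := eloc_nonneg φ y
      have := this.trans hel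
      positivity
    · push Not at hy
      set ζ : R3 → ℝ := fun x => (C1⁻¹ * rho (x - y)) * Ψ x with hζ
      have hrd : ∀ x, HasFDerivAt (fun x => rho (x - y)) (fderiv ℝ rho (x - y)) x := fun x =>
        hasFD_sub y x (rho_test.diff (x - y))
      have hζT : IsTestFun ζ := by
        refine IsTestFun.mul ⟨contDiff_const.mul (rho_test.1.comp (contDiff_id.sub contDiff_const)), ?_⟩ hΨc
        exact (HasCompactSupport.comp_homeomorph rho_test.2 (Homeomorph.subRight y)).mul_left
      have hζd : ∀ x i, fderiv ℝ ζ x (ee i) = C1⁻¹ * rho (x - y) * fderiv ℝ Ψ x (ee i) + Ψ x * (C1⁻¹ * fderiv ℝ rho (x - y) (ee i)) := by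
        intro x i
        have h1 := ((hrd x).const_mul C1⁻¹).mul (hΨc.differentiable (by simp) x).hasFDerivAt
        have h2 : HasFDerivAt ζ _ x := h1
        rw [h2.fderiv]; simp
      have hout : ∀ x, x ∉ Metric.closedBall y 1 → 1 < ‖x - y‖ := fun x hx => by
        rw [Metric.mem_closedBall, dist_eq_norm] at hx; push Not at hx; exact hx
      have a1 : ∀ x, |C1⁻¹ * rho (x - y)| ≤ 1 := fun x => by
        rw [abs_mul, abs_of_pos (inv_pos.2 hC1), inv_mul_le_iff₀ hC1, mul_one]; exact hr1' _
      have a2 : ∀ x, |Ψ x| ≤ 1 := fun x => by rw [abs_le]; constructor <;> linarith [(hΨ x).1, (hΨ x).2.1]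
      have hb := hS φ h y ζ hζT (fun x => by rw [hζ]; simp only; rw [abs_mul]; exact mul_le_one₀ (a1 x) (abs_nonneg _) (a2 x))
        (fun i x => by
          rw [hζd]
          refine (abs_add_le _ _).trans ?_
          rw [abs_mul, abs_mul (Ψ x), abs_mul C1⁻¹ (fderiv _ _ _ _), abs_of_pos (inv_pos.2 hC1)]
          have b1 : |C1⁻¹ * rho (x - y)| * |fderiv ℝ Ψ x (ee i)| ≤ 1 * C3 :=
            mul_le_mul (a1 x) (hΨd i x) (abs_nonneg _) zero_le_one
          have b2 : |Ψ x| * (C1⁻¹ * |fderiv ℝ rho (x - y) (ee i)|) ≤ 1 * (C1⁻¹ * C2) := by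
            refine mul_le_mul (a2 x) ?_ (by positivity) zero_le_one
            have := hC2 i (x - y)
            gcongr
          have e : (C2 + C1 * C3) / C1 = 1 * C3 + 1 * (C1⁻¹ * C2) := by field_simp; ring
          rw [e]; linarith)
        (fun x hx => by rw [hζ]; simp only; rw [rho_zero (hout x hx).le]; ring)
        (fun i x hx => by rw [hζd, rho_zero (hout x hx).le, rho_dzero i (hout x hx)]; ring) hy
      have e : ∫ t, f t * rho (y - t) = C1 * ∫ x, ζ x * detDen φ x := by
        rw [← integral_const_mul]
        congr 1; ext t
        rw [← rho_neg (y - t), neg_sub]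
        simp only [hf, hζ]; field_simp
      rw [e, norm_mul, Real.norm_eq_abs, Real.norm_eq_abs, abs_of_pos hC1, mul_assoc]
      gcongr
      exact hb.trans (by gcongr)
  have hfin := norm_integral_le_of_norm_le (k2i.const_mul (C1 * θ)) (Eventually.of_forall hpt)
  rw [integral_const_mul, k1, k2] at hfin
  refine hfin.trans ?_
  have hnn : 0 ≤ θ := by positivity
  calc C1 * θ * ((∫ x, energyDensity φ x) * c2) ≤ C1 * θ * (E * c2) := by
        gcongr; exact hφE
    _ = π ^ 2 / 2 * (C1 * (E * c2) / (C1 * (E * c2) + 1)) := by rw [hθ]; field_simp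
    _ ≤ π ^ 2 / 2 * 1 := by
        gcongr
        rw [div_le_one (by positivity)]; linarith
    _ = _ := by ring

lemma sep_count {φ : SkyrmeMap} (h : Nice φ) {m : ℕ} {z : Fin m → R3} (hz : ∀ i j, i ≠ j → 4 < ‖z i - z j‖) {ε : ℝ}
    (hb : ∀ i, ε < eloc φ (z i)) : m * ε ≤ energy φ := by
  have hi : ∀ i, Integrable ((Metric.closedBall (z i) 2).indicator (energyDensity φ)) volume := fun i =>
    h.memX.integrableOn.integrable_indicator Metric.isClosed_closedBall.measurableSet
  have h1 : ∑ i, eloc φ (z i) ≤ energy φ := by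
    have e : ∑ i, eloc φ (z i) = ∫ x, ∑ i, (Metric.closedBall (z i) 2).indicator (energyDensity φ) x := by
      rw [integral_finsetSum _ fun i _ => hi i]
      refine Finset.sum_congr rfl fun i _ => ?_
      rw [integral_indicator Metric.isClosed_closedBall.measurableSet, eloc]
    rw [e]
    refine integral_mono (integrable_finsetSum _ fun i _ => hi i) h.memX fun x => ?_
    refine sum_le_one_nz (fun i => (Metric.closedBall (z i) 2).indicator (energyDensity φ) x) (fun t => t ≤ energyDensity φ x)
      (dens_nonneg φ x) (fun i => Set.indicator_le_self' (fun x _ => dens_nonneg φ x) x) fun i j hij => ?_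
    have := cut_far (R := 1) (z := z) (by simpa using hz) x hij
    refine this.imp (fun h => Set.indicator_of_notMem ?_ _) (fun h => Set.indicator_of_notMem ?_ _) <;>
    · rw [Metric.mem_closedBall, dist_eq_norm]; push Not; linarith
  refine le_trans ?_ h1
  have := Finset.sum_le_sum fun (i : Fin m) (_ : i ∈ Finset.univ) => (hb i).le
  simpa using this

/-- m mutually divergent bad centres -/
def PB (U : Ultrafilter ℕ) (φ : ℕ → SkyrmeMap) (ε : ℝ) (m : ℕ) : Prop :=
  ∃ z : Fin m → ℕ → R3, (∀ i j, i ≠ j → ∀ R : ℝ, ∀ᶠ n in (U : Filter ℕ), R < ‖z i n - z j n‖) ∧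
    ∀ i, ∀ᶠ n in (U : Filter ℕ), ε < eloc (φ n) (z i n)

lemma PB_bound {U : Ultrafilter ℕ} {φ : ℕ → SkyrmeMap} (hN : ∀ n, Nice (φ n)) {E : ℝ} (hE : ∀ n, energy (φ n) ≤ E) {ε : ℝ} {m : ℕ}
    (h : PB U φ ε m) : m * ε ≤ E := by
  obtain ⟨z, h1, h2⟩ := h
  have h1' : ∀ᶠ n in (U : Filter ℕ), ∀ i j, i ≠ j → 4 < ‖z i n - z j n‖ := by
    rw [eventually_all]; intro i; rw [eventually_all]; intro j
    by_cases hij : i = j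
    · exact Eventually.of_forall fun n hc => absurd hij hc
    · filter_upwards [h1 i j hij 4] with n hn _ using hn
  obtain ⟨n, hn1, hn2⟩ := (h1'.and (eventually_all.2 h2)).exists
  exact (sep_count (hN n) hn1 hn2).trans (hE n)

lemma PB_max {U : Ultrafilter ℕ} {φ : ℕ → SkyrmeMap} (hN : ∀ n, Nice (φ n)) {E : ℝ} (hE : ∀ n, energy (φ n) ≤ E) {ε : ℝ} (hε : 0 < ε) :
    ∃ m, PB U φ ε m ∧ ¬ PB U φ ε (m + 1) := by
  by_contra hc
  push Not at hc
  have hall : ∀ m, PB U φ ε m := fun m => by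
    induction m with
    | zero => exact ⟨fun i => i.elim0, fun i => i.elim0, fun i => i.elim0⟩
    | succ m ih => exact hc m ih
  obtain ⟨m, hm⟩ := exists_nat_gt (E / ε)
  have := PB_bound hN hE (hall m)
  rw [div_lt_iff₀ hε] at hm
  linarith

lemma PB_ext {U : Ultrafilter ℕ} (hU : (U : Filter ℕ) ≤ atTop) {φ : ℕ → SkyrmeMap} {ε : ℝ} {m : ℕ} {z : Fin m → ℕ → R3}
    (h1 : ∀ i j, i ≠ j → ∀ R : ℝ, ∀ᶠ n in (U : Filter ℕ), R < ‖z i n - z j n‖)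
    (h2 : ∀ i, ∀ᶠ n in (U : Filter ℕ), ε < eloc (φ n) (z i n)) (hno : ¬ PB U φ ε (m + 1)) :
    ∃ R0 : ℝ, ∀ᶠ n in (U : Filter ℕ), ∀ y, ε < eloc (φ n) y → ∃ i, ‖y - z i n‖ ≤ R0 := by
  classical
  by_contra hc
  push Not at hc
  let A : ℕ → ℕ → Prop := fun n R => ∃ y, ε < eloc (φ n) y ∧ ∀ i, (R:ℝ) < ‖y - z i n‖
  have hA : ∀ R : ℕ, ∀ᶠ n in (U : Filter ℕ), A n R := fun R => by
    exact hc R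
  let r : ℕ → ℕ := fun n => Nat.findGreatest (A n) n
  have hr : ∀ R : ℕ, ∀ᶠ n in (U : Filter ℕ), R ≤ r n ∧ A n (r n) := fun R => by
    filter_upwards [hA R, hU (eventually_ge_atTop R)] with n hn hRn
    exact ⟨Nat.le_findGreatest hRn hn, Nat.findGreatest_spec hRn hn⟩
  let y : ℕ → R3 := fun n => if h : A n (r n) then h.choose else 0
  have hy : ∀ n, A n (r n) → ε < eloc (φ n) (y n) ∧ ∀ i, (r n:ℝ) < ‖y n - z i n‖ := fun n hn => by
    simp only [y, dif_pos hn]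
    exact hn.choose_spec
  have hdiv : ∀ i, ∀ R : ℝ, ∀ᶠ n in (U : Filter ℕ), R < ‖y n - z i n‖ := fun i R => by
    obtain ⟨k, hk⟩ := exists_nat_gt R
    filter_upwards [hr k] with n hn
    have h3 := (hy n hn.2).2 i
    have h4 : (k:ℝ) ≤ r n := by exact_mod_cast hn.1
    linarith
  refine hno ⟨Fin.cons y z, fun i j => ?_, fun i => ?_⟩
  · refine Fin.cases ?_ (fun i' => ?_) i <;> refine Fin.cases ?_ (fun j' => ?_) j
    · intro h; exact absurd rfl h
    · intro _ R; simpa using hdiv j' R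
    · intro _ R
      filter_upwards [hdiv i' R] with n hn
      rw [norm_sub_rev] at hn
      simpa using hn
    · intro hij R
      simpa using h1 i' j' (fun h => hij (by rw [h])) R
  · refine Fin.cases ?_ (fun i' => ?_) i
    · filter_upwards [hr 0] with n hn
      simpa using (hy n hn.2).1
    · simpa using h2 i'

lemma no_zero {U : Ultrafilter ℕ} (hU : (U : Filter ℕ) ≤ atTop) {φ : ℕ → SkyrmeMap} (hN : ∀ n, Nice (φ n)) {E : ℝ}
    (hE : ∀ n, energy (φ n) ≤ E) (hd : ∀ n, degree (φ n) = 1)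
    (hz : ∀ (z : ℕ → R3) (ψ : SkyrmeMap), Conv U (fun n => trM (φ n) (z n)) ψ E → degree ψ = 0) : False := by
  have hE0 : 0 ≤ E := le_trans (integral_nonneg fun x => dens_nonneg _ x) (hE 0)
  obtain ⟨ε, hε, hv⟩ := vanish hE0
  obtain ⟨m, ⟨z, h1, h2⟩, hno⟩ := PB_max (U := U) hN hE hε
  obtain ⟨R0, hR0⟩ := PB_ext hU h1 h2 hno
  have hpi : 0 < π ^ 2 := by positivity
  -- small degree near each centre
  have hsm : ∀ i, ∀ᶠ R in atTop, ∀ᶠ n in (U : Filter ℕ), |∫ x, chi R (x - z i n) * detDen (φ n) x| < π ^ 2 / (m + 1) := by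
    intro i
    obtain ⟨ψ, hψ⟩ := exists_conv U (fun n => tr_nice (hN n) (z i n)) (E := E) (fun n => by rw [tr_energy]; exact hE n)
    have h0 : ∫ x, detDen ψ x = 0 := by rw [degree_mul, hz _ ψ hψ, mul_zero]
    have ht := chi_tendsto (detI_of hψ.memX).1
    rw [h0] at ht
    have ht2 := ht.abs
    rw [abs_zero] at ht2
    filter_upwards [ht2.eventually (gt_mem_nhds (show 0 < π ^ 2 / ((m:ℝ) + 1) by positivity)), eventually_gt_atTop 0] with R hR hRp
    have h3 := (hψ.det (chi_test hRp)).abs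
    simp only [tr_chi] at h3
    exact h3.eventually (gt_mem_nhds hR)
  obtain ⟨R, hR1, hR2, hR3⟩ := ((eventually_all.2 hsm).and ((eventually_ge_atTop (1:ℝ)).and (eventually_ge_atTop (R0 + 1)))).exists
  have h1' : ∀ᶠ n in (U : Filter ℕ), ∀ i j, i ≠ j → 4 * R < ‖z i n - z j n‖ := by
    rw [eventually_all]; intro i; rw [eventually_all]; intro j
    by_cases hij : i = j
    · exact Eventually.of_forall fun n hc => absurd hij hc
    · filter_upwards [h1 i j hij (4 * R)] with n hn _ using hn
  obtain ⟨n, hn1, hn2, hn3⟩ := ((eventually_all.2 hR1).and (h1'.and hR0)).exists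
  have hRp : 0 < R := by linarith
  have hk := hv (φ n) (hN n) (hE n) m (fun i => z i n) R R0 hR2 hR3 hn2 hn3
  have hI : ∀ i, Integrable (fun x => chi R (x - z i n) * detDen (φ n) x) volume := fun i =>
    (hN n).detI.bdd_mul (c := 1) ((chi_test hRp).cont.comp (continuous_id.sub continuous_const)).aestronglyMeasurable
      (Eventually.of_forall fun x => by
        rw [Real.norm_eq_abs, abs_of_nonneg (chi_nonneg R _)]; exact chi_le_one R _)
  have e : ∫ x, cut R (fun i => z i n) x * detDen (φ n) x = 2 * π ^ 2 - ∑ i, ∫ x, chi R (x - z i n) * detDen (φ n) x := by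
    have : ∀ x, cut R (fun i => z i n) x * detDen (φ n) x = detDen (φ n) x - ∑ i, chi R (x - z i n) * detDen (φ n) x := fun x => by
      rw [cut, sub_mul, one_mul, Finset.sum_mul]
    simp_rw [this]
    rw [integral_sub (hN n).detI (integrable_finsetSum _ fun i _ => hI i), integral_finsetSum _ fun i _ => hI i, degree_mul, hd n, mul_one]
  have hs : |∑ i, ∫ x, chi R (x - z i n) * detDen (φ n) x| ≤ π ^ 2 := by
    refine (Finset.abs_sum_le_sum_abs _ _).trans ((Finset.sum_le_sum fun i _ => (hn1 i).le).trans ?_)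
    simp only [Finset.sum_const, Finset.card_univ, Fintype.card_fin, nsmul_eq_mul]
    rw [mul_div_assoc', div_le_iff₀ (by positivity)]
    nlinarith
  rw [e] at hk
  have := abs_le.1 hk
  have := abs_le.1 hs
  linarith [(abs_le.1 hk).2, (abs_le.1 hs).2]

lemma I_bdd (k : ℤ) : BddBelow {E : ℝ | ∃ φ : SkyrmeMap, memX φ ∧ degree φ = (k : ℝ) ∧ energy φ = E} :=
  ⟨0, fun _ ⟨φ, _, _, hE⟩ => hE ▸ integral_nonneg fun x => dens_nonneg φ x⟩

lemma exists_one : ∃ φ : SkyrmeMap, memX φ ∧ degree φ = ((1 : ℤ) : ℝ) ∧ energy φ = Skyrme.I 1 := by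
  set S := {E : ℝ | ∃ φ : SkyrmeMap, memX φ ∧ degree φ = ((1:ℤ) : ℝ) ∧ energy φ = E} with hS
  have hmem : 24 * π ^ 2 ∈ S := ⟨tmap, tmap_spec.1, by simpa using tmap_spec.2.2, tmap_spec.2.1⟩
  have hI2 : Skyrme.I 1 ≤ 24 * π ^ 2 := csInf_le (I_bdd 1) hmem
  obtain ⟨u, hanti, hlim, hu⟩ := exists_seq_tendsto_sInf (S := S) ⟨_, hmem⟩ (I_bdd 1)
  choose χ hX hdeg hen using hu
  choose φ hN hd he _ _ using fun n => exists_nice (χ n) (hX n)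
  have hd1 : ∀ n, degree (φ n) = 1 := fun n => by rw [hd, hdeg]; simp
  have hu1 : ∀ n, energy (φ n) = u n := fun n => by rw [he, hen]
  have hE : ∀ n, energy (φ n) ≤ u 0 := fun n => by rw [hu1]; exact hanti (Nat.zero_le n)
  let U : Ultrafilter ℕ := hyperfilter ℕ
  have hU : (U : Filter ℕ) ≤ atTop := Nat.hyperfilter_le_atTop
  have hT : Tendsto (fun n => energy (φ n)) U (𝓝 (Skyrme.I 1)) := by
    simp_rw [hu1]; exact hlim.mono_left hU
  by_contra hc
  refine no_zero hU hN hE hd1 fun z ψ hψ => ?_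
  have hdt : ∀ n, degree (trM (φ n) (z n)) = 1 := fun n => by
    rw [← hd1 n, degree, degree]
    congr 1
    exact integral_add_right_eq_self (μ := volume) (detDen (φ n)) (z n)
  rcases conv_dich hψ hdt (by simp_rw [tr_energy]; exact hT) hI2 with h | ⟨h, hle⟩
  · exact h
  · exact absurd ⟨ψ, hψ.memX, by simpa using h, le_antisymm hle (csInf_le (I_bdd 1) ⟨ψ, hψ.memX, by simpa using h, rfl⟩)⟩ hc

lemma I_neg : Skyrme.I (-1) = Skyrme.I 1 := by
  rw [Skyrme.I, Skyrme.I]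
  congr 1
  ext E
  constructor <;> rintro ⟨φ, h1, h2, h3⟩ <;>
  · obtain ⟨a, b, c⟩ := refl_spec φ
    exact ⟨reflM φ, c h1, by rw [b, h2]; simp, a.trans h3⟩

/-- the infima I_{±1} are achieved. -/
theorem skyrme_degree_pm_one_achieved :
    (∃ φ : SkyrmeMap, memX φ ∧ degree φ = ((1 : ℤ) : ℝ) ∧ energy φ = Skyrme.I 1) ∧
    (∃ φ : SkyrmeMap, memX φ ∧ degree φ = ((-1 : ℤ) : ℝ) ∧ energy φ = Skyrme.I (-1)) := by
  refine ⟨exists_one, ?_⟩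
  obtain ⟨φ, h1, h2, h3⟩ := exists_one
  obtain ⟨a, b, c⟩ := refl_spec φ
  exact ⟨reflM φ, c h1, by rw [b, h2]; simp, by rw [a, h3, I_neg]⟩
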